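/- arXiv:1009.1751 — 3 statements merged into one kernel-verified Lean document; each statement's English description precedes it below -/
import Mathlib

section
/- Let n ≥ 2 and 0<p≤q<∞. Then there exist positive real numbers C_{p,q}^1 and C_{p,q}^2 depending only on p and q such that: (i) C_{p,q}^1 · n^{1/q} ≤ E[‖ω‖_q] ≤ C_{p,q}^2 · n^{1/q}; (ii) C_{p,q}^1 · E[‖ω‖_q]/n^{1/p} ≤ σ_0^{p,q}(μ_p) = ∫_{Δ_p^n} ‖x‖_q dμ_p(x) ≤ C_{p,q}^2 · E[‖ω‖_q]/n^{1/p}; and (iii) C_{p,q}^1 · n^{1/q−1/p} ≤ σ_0^{p,q}(μ_p) ≤ C_{p,q}^2 · n^{1/q−1/p}. -/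
open MeasureTheory Real Set
open scoped ENNReal

noncomputable section

/-- The `m`-th largest value among `|x_1|, …, |x_n|` (for `1 ≤ m ≤ n`). -/
def kthMax {ι : Type*} [Fintype ι] (x : ι → ℝ) (m : ℕ) : ℝ :=
  sSup {t : ℝ | ∃ S : Finset ι, m ≤ S.card ∧ ∀ j ∈ S, t ≤ |x j|}

/-- The positive part `Δ_p^n` of the unit sphere of `ℓ_p^n`:
`Δ_p^n = {t ∈ [0,∞)^n : ∑_j t_j^p = 1}`. -/
def Delta (p : ℝ) (n : ℕ) : Set (Fin n → ℝ) :=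
  {t | (∀ i, 0 ≤ t i) ∧ ∑ i, t i ^ p = 1}

/-- The cone `[0,1] · A = {t • a : t ∈ [0,1], a ∈ A}`. -/
def cone {n : ℕ} (A : Set (Fin n → ℝ)) : Set (Fin n → ℝ) :=
  {x | ∃ t ∈ Icc (0 : ℝ) 1, ∃ a ∈ A, x = t • a}

/-- `μ` is the normalized cone measure on `Δ_p^n`: it is a Borel probability measure with
`μ(A) = λ([0,1]·A) / λ([0,1]·Δ_p^n)` for every Borel `A ⊆ Δ_p^n`. -/
def IsConeMeasure (p : ℝ) (n : ℕ) (μ : Measure (Fin n → ℝ)) : Prop :=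
  IsProbabilityMeasure μ ∧
    ∀ A : Set (Fin n → ℝ), MeasurableSet A → A ⊆ Delta p n →
      μ A = volume (cone A) / volume (cone (Delta p n))

/-- The distribution on `[0,∞)` with density `c_p e^{-t^p}`, `c_p = p / Γ(1/p)`. -/
def expMeasure (p : ℝ) : Measure ℝ :=
  (volume.restrict (Ioi (0 : ℝ))).withDensity fun t =>
    ENNReal.ofReal ((p / Real.Gamma (1 / p)) * Real.exp (-(t ^ p)))

/-- Joint distribution of `n` i.i.d. random variables with density `c_p e^{-t^p}` on `[0,∞)`. -/
def iidExp (p : ℝ) (n : ℕ) : Measure (Fin n → ℝ) := Measure.pi fun _ => expMeasure p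


/-- The norm `‖x‖_q = (∑_j |x_j|^q)^{1/q}` on `ℝ^n` for `0 < q < ∞`. -/
def VNorm {n : ℕ} (q : ℝ) (x : Fin n → ℝ) : ℝ := (∑ j, |x j| ^ q) ^ (1 / q)


lemma VNorm_nonneg {n : ℕ} (q : ℝ) (x : Fin n → ℝ) : 0 ≤ VNorm q x := by
  unfold VNorm; positivity

lemma VNorm_meas {n : ℕ} (q : ℝ) : Measurable (VNorm q : (Fin n → ℝ) → ℝ) := by
  unfold VNorm; fun_prop

lemma VNorm_smul {n : ℕ} {q : ℝ} (hq : 0 < q) {t : ℝ} (ht : 0 < t) (x : Fin n → ℝ) :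
    VNorm q (t • x) = t * VNorm q x := by
  unfold VNorm
  have : ∑ j, |(t • x) j| ^ q = t ^ q * ∑ j, |x j| ^ q := by
    rw [Finset.mul_sum]
    refine Finset.sum_congr rfl fun j _ => ?_
    rw [Pi.smul_apply, smul_eq_mul, abs_mul, abs_of_pos ht, Real.mul_rpow ht.le (abs_nonneg _)]
  rw [this, Real.mul_rpow (by positivity) (by positivity), ← Real.rpow_mul ht.le,
    mul_one_div_cancel hq.ne', Real.rpow_one]

lemma VNorm_rpow {n : ℕ} {q : ℝ} (hq : 0 < q) (x : Fin n → ℝ) :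
    VNorm q x ^ q = ∑ j, |x j| ^ q := by
  unfold VNorm
  rw [← Real.rpow_mul (by positivity), one_div_mul_cancel hq.ne', Real.rpow_one]

/-- the open positive orthant -/
def Orth (n : ℕ) : Set (Fin n → ℝ) := Set.pi univ fun _ => Ioi 0

lemma Orth_meas (n : ℕ) : MeasurableSet (Orth n) :=
  MeasurableSet.univ_pi fun _ => measurableSet_Ioi

lemma mem_Orth {n : ℕ} {x : Fin n → ℝ} : x ∈ Orth n ↔ ∀ i, 0 < x i := by
  simp [Orth]

lemma VNorm_pos {n : ℕ} (hn : 0 < n) {q : ℝ} {x : Fin n → ℝ} (hx : x ∈ Orth n) :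
    0 < VNorm q x := by
  unfold VNorm
  rw [mem_Orth] at hx
  apply Real.rpow_pos_of_pos
  have : Nonempty (Fin n) := ⟨⟨0, hn⟩⟩
  exact Finset.sum_pos (fun i _ => Real.rpow_pos_of_pos (abs_pos.2 (hx i).ne') _)
    Finset.univ_nonempty

lemma VNorm_le_one_iff {n : ℕ} {q : ℝ} (hq : 0 < q) {x : Fin n → ℝ} :
    VNorm q x ≤ 1 ↔ ∑ j, |x j| ^ q ≤ 1 := by
  rw [← VNorm_rpow hq]
  have := Real.rpow_le_rpow_iff (VNorm_nonneg q x) zero_le_one hq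
  rw [Real.one_rpow] at this
  exact this.symm

/-- restricted volume -/
def VO (n : ℕ) : Measure (Fin n → ℝ) := volume.restrict (Orth n)

lemma VO_eq_pi (n : ℕ) : VO n = Measure.pi fun _ : Fin n => (volume : Measure ℝ).restrict (Ioi 0) := by
  rw [VO, Orth, volume_pi, Measure.restrict_pi_pi]

lemma coef_pos {p : ℝ} (hp : 0 < p) : 0 < p / Real.Gamma (1 / p) :=
  div_pos hp (Real.Gamma_pos_of_pos (by positivity))

lemma dens_integrable {p : ℝ} (hp : 0 < p) :
    Integrable (fun t : ℝ => (p / Real.Gamma (1 / p)) * Real.exp (-(t ^ p)))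
      (volume.restrict (Ioi 0)) := by
  have := integrableOn_rpow_mul_exp_neg_rpow (p := p) (s := 0) (by norm_num) hp
  simp only [Real.rpow_zero, one_mul] at this
  exact this.const_mul _

lemma expMeasure_prob {p : ℝ} (hp : 0 < p) : IsProbabilityMeasure (expMeasure p) := by
  constructor
  rw [expMeasure, withDensity_apply _ MeasurableSet.univ, Measure.restrict_univ,
    ← ofReal_integral_eq_lintegral_ofReal (dens_integrable hp)
      (ae_of_all _ fun t => mul_nonneg (coef_pos hp).le (Real.exp_pos _).le)]
  rw [integral_const_mul, integral_exp_neg_rpow hp, Real.Gamma_add_one (by positivity)]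
  have : Real.Gamma (1 / p) ≠ 0 := (Real.Gamma_pos_of_pos (by positivity)).ne'
  rw [← ENNReal.ofReal_one]
  congr 1
  field_simp

lemma iid_eq {p : ℝ} (hp : 0 < p) (n : ℕ) : iidExp p n = (VO n).withDensity
    (fun x => ENNReal.ofReal (∏ i, ((p / Real.Gamma (1 / p)) * Real.exp (-(x i ^ p))))) := by
  have := expMeasure_prob hp
  rw [iidExp]
  refine Measure.pi_eq fun s hs => ?_
  have h0 : ∀ t : ℝ, 0 ≤ (p / Real.Gamma (1 / p)) * Real.exp (-(t ^ p)) :=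
    fun t => mul_nonneg (coef_pos hp).le (Real.exp_pos _).le
  rw [withDensity_apply _ (MeasurableSet.univ_pi hs), VO_eq_pi, Measure.restrict_pi_pi,
    ← ofReal_integral_eq_lintegral_ofReal]
  · rw [integral_fintype_prod_eq_prod (𝕜 := ℝ)
      (f := fun _ t => (p / Real.Gamma (1 / p)) * Real.exp (-(t ^ p))),
      ENNReal.ofReal_prod_of_nonneg fun i _ => integral_nonneg h0]
    refine Finset.prod_congr rfl fun i _ => ?_
    rw [expMeasure, withDensity_apply _ (hs i), ofReal_integral_eq_lintegral_ofReal]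
    · exact (dens_integrable hp).mono_measure Measure.restrict_le_self
    · exact ae_of_all _ h0
  · exact Integrable.fintype_prod (𝕜 := ℝ)
      (f := fun _ t => (p / Real.Gamma (1 / p)) * Real.exp (-(t ^ p)))
      fun i => (dens_integrable hp).mono_measure Measure.restrict_le_self
  · exact ae_of_all _ fun x => Finset.prod_nonneg fun i _ => h0 _

lemma scale {n : ℕ} {p : ℝ} (hp : 0 < p) (h : (Fin n → ℝ) → ℝ≥0∞) (hm : Measurable h)
    (hh : ∀ t : ℝ, 0 < t → ∀ x, h (t • x) = ENNReal.ofReal t * h x) {s : ℝ} (hs : 0 < s) :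
    ∫⁻ x in {x | VNorm p x ≤ s}, h x ∂(VO n) =
      ENNReal.ofReal s ^ (n + 1) * ∫⁻ x in {x | VNorm p x ≤ 1}, h x ∂(VO n) := by
  have hB : ∀ s : ℝ, MeasurableSet {x : Fin n → ℝ | VNorm p x ≤ s} :=
    fun s => measurableSet_le (VNorm_meas p) measurable_const
  have key : ∀ s : ℝ, ∫⁻ x in {x | VNorm p x ≤ s}, h x ∂(VO n) =
      ∫⁻ x, ({x | VNorm p x ≤ s} ∩ Orth n).indicator h x := by
    intro s
    rw [VO, Measure.restrict_restrict (hB s), lintegral_indicator ((hB s).inter (Orth_meas n))]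
  have e1 : ∀ y, ({x | VNorm p x ≤ s} ∩ Orth n).indicator h (s • y)
      = ENNReal.ofReal s * ({x | VNorm p x ≤ 1} ∩ Orth n).indicator h y := by
    intro y
    have : s • y ∈ ({x | VNorm p x ≤ s} ∩ Orth n) ↔ y ∈ ({x | VNorm p x ≤ 1} ∩ Orth n) := by
      simp only [mem_inter_iff, mem_ofPred_eq, VNorm_smul hp hs, mem_Orth, Pi.smul_apply,
        smul_eq_mul, mul_pos_iff_of_pos_left hs, mul_le_iff_le_one_right hs]
    by_cases hy : y ∈ ({x | VNorm p x ≤ 1} ∩ Orth n)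
    · rw [indicator_of_mem hy, indicator_of_mem (this.2 hy), hh s hs]
    · rw [indicator_of_notMem hy, indicator_of_notMem (fun h => hy (this.1 h)), mul_zero]
  have hmI : ∀ s : ℝ, Measurable (({x | VNorm p x ≤ s} ∩ Orth n).indicator h) :=
    fun s => hm.indicator ((hB s).inter (Orth_meas n))
  have e2 : ∫⁻ y, ({x | VNorm p x ≤ s} ∩ Orth n).indicator h (s • y) =
      ENNReal.ofReal |(s ^ n)⁻¹| * ∫⁻ x, ({x | VNorm p x ≤ s} ∩ Orth n).indicator h x := by
    rw [← lintegral_map (hmI s) (measurable_const_smul s),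
      Measure.map_addHaar_smul _ hs.ne', lintegral_smul_measure]
    simp
  rw [key, key]
  simp_rw [e1] at e2
  rw [lintegral_const_mul _ (hmI 1), abs_of_pos (by positivity)] at e2
  have h3 : ENNReal.ofReal (s ^ n) * ENNReal.ofReal (s ^ n)⁻¹ = 1 := by
    rw [← ENNReal.ofReal_mul (by positivity), mul_inv_cancel₀ (by positivity), ENNReal.ofReal_one]
  rw [← one_mul (∫⁻ x, ({x | VNorm p x ≤ s} ∩ Orth n).indicator h x), ← h3, mul_assoc, ← e2,
    ENNReal.ofReal_pow hs.le, pow_succ, mul_assoc]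

lemma prop_meas {n : ℕ} (hn : 0 < n) {p : ℝ} (hp : 0 < p) (h₁ h₂ : (Fin n → ℝ) → ℝ≥0∞)
    (hm₁ : Measurable h₁) (hm₂ : Measurable h₂)
    (hh₁ : ∀ t : ℝ, 0 < t → ∀ x, h₁ (t • x) = ENNReal.ofReal t * h₁ x)
    (hh₂ : ∀ t : ℝ, 0 < t → ∀ x, h₂ (t • x) = ENNReal.ofReal t * h₂ x)
    {a₁ a₂ : ℝ≥0∞} (ha₁ : ∫⁻ x in {x | VNorm p x ≤ 1}, h₁ x ∂(VO n) = a₁)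
    (ha₂ : ∫⁻ x in {x | VNorm p x ≤ 1}, h₂ x ∂(VO n) = a₂) (hf₁ : a₁ ≠ ∞) (hf₂ : a₂ ≠ ∞)
    (φ : ℝ → ℝ≥0∞) (hφ : Measurable φ) :
    a₁ * ∫⁻ x, h₂ x * φ (VNorm p x) ∂(VO n) = a₂ * ∫⁻ x, h₁ x * φ (VNorm p x) ∂(VO n) := by
  have hN : Measurable (VNorm p : (Fin n → ℝ) → ℝ) := VNorm_meas p
  have cdf : ∀ (h : (Fin n → ℝ) → ℝ≥0∞), Measurable h →
      (∀ t : ℝ, 0 < t → ∀ x, h (t • x) = ENNReal.ofReal t * h x) → ∀ s : ℝ,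
      Measure.map (VNorm p) ((VO n).withDensity h) (Iic s) =
      (if 0 < s then ENNReal.ofReal s ^ (n + 1) else 0) *
        ∫⁻ x in {x | VNorm p x ≤ 1}, h x ∂(VO n) := by
    intro h hm hh s
    rw [Measure.map_apply hN measurableSet_Iic, withDensity_apply _ (hN measurableSet_Iic)]
    split_ifs with hs
    · exact scale hp h hm hh hs
    · rw [zero_mul, VO, Measure.restrict_restrict (hN measurableSet_Iic)]
      have : (VNorm p : (Fin n → ℝ) → ℝ) ⁻¹' Iic s ∩ Orth n = ∅ := by
        ext x
        simp only [mem_inter_iff, mem_preimage, mem_Iic, mem_empty_iff_false, iff_false, not_and]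
        intro h1 h2
        have := VNorm_pos hn (q := p) h2
        linarith
      rw [this]; simp
  have key : a₁ • Measure.map (VNorm p) ((VO n).withDensity h₂) =
      a₂ • Measure.map (VNorm p) ((VO n).withDensity h₁) := by
    have c1 : ∀ s, (a₁ • Measure.map (VNorm p) ((VO n).withDensity h₂)) (Iic s) =
        (if 0 < s then ENNReal.ofReal s ^ (n + 1) else 0) * (a₁ * a₂) := by
      intro s
      rw [Measure.smul_apply, cdf h₂ hm₂ hh₂, ha₂, smul_eq_mul]; ring
    have c2 : ∀ s, (a₂ • Measure.map (VNorm p) ((VO n).withDensity h₁)) (Iic s) =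
        (if 0 < s then ENNReal.ofReal s ^ (n + 1) else 0) * (a₁ * a₂) := by
      intro s
      rw [Measure.smul_apply, cdf h₁ hm₁ hh₁, ha₁, smul_eq_mul]; ring
    have fin : ∀ s : ℝ, (if 0 < s then ENNReal.ofReal s ^ (n + 1) else 0) * (a₁ * a₂) ≠ ∞ := by
      intro s
      refine ENNReal.mul_ne_top ?_ (ENNReal.mul_ne_top hf₁ hf₂)
      split_ifs
      · exact ENNReal.pow_ne_top ENNReal.ofReal_ne_top
      · simp
    have hd : ∀ a b : ℝ, Ioc a b = Iic b \ Iic a := fun a b => by ext; simp [and_comm]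
    refine Measure.ext_of_Ioc' _ _ ?_ ?_
    · intro a b hab
      refine ne_top_of_le_ne_top (fin b) ?_
      rw [← c1 b]
      exact measure_mono fun x hx => hx.2
    · intro a b hab
      rw [hd, measure_sdiff (Iic_subset_Iic.2 hab.le) measurableSet_Iic.nullMeasurableSet,
        measure_sdiff (Iic_subset_Iic.2 hab.le) measurableSet_Iic.nullMeasurableSet,
        c1, c1, c2, c2]
      · rw [c2]; exact fin a
      · rw [c1]; exact fin a
  have l : ∀ h : (Fin n → ℝ) → ℝ≥0∞, Measurable h → ∀ a : ℝ≥0∞,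
      ∫⁻ t, φ t ∂(a • Measure.map (VNorm p) ((VO n).withDensity h)) =
      a * ∫⁻ x, h x * φ (VNorm p x) ∂(VO n) := by
    intro h hm a
    rw [lintegral_smul_measure, lintegral_map hφ hN,
      lintegral_withDensity_eq_lintegral_mul (VO n) hm (g := fun x => φ (VNorm p x)) (hφ.comp hN)]
    rfl
  rw [← l h₂ hm₂, ← l h₁ hm₁, key]

/-- radial projection -/
def rad {n : ℕ} (p : ℝ) (x : Fin n → ℝ) : Fin n → ℝ := (VNorm p x)⁻¹ • x

lemma rad_meas {n : ℕ} (p : ℝ) : Measurable (rad p : (Fin n → ℝ) → _) :=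
  (VNorm_meas p).inv.smul measurable_id

lemma ball_meas (n : ℕ) (p s : ℝ) : MeasurableSet {x : Fin n → ℝ | VNorm p x ≤ s} :=
  measurableSet_le (VNorm_meas p) measurable_const

lemma Delta_meas (p : ℝ) (n : ℕ) : MeasurableSet (Delta p n) := by
  have h1 : MeasurableSet {t : Fin n → ℝ | ∀ i, 0 ≤ t i} := by
    have : {t : Fin n → ℝ | ∀ i, 0 ≤ t i} = ⋂ i, {t | 0 ≤ t i} := by ext; simp
    rw [this]
    exact MeasurableSet.iInter fun i => measurableSet_le measurable_const (measurable_pi_apply i)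
  have h2 : MeasurableSet {t : Fin n → ℝ | ∑ i, t i ^ p = 1} :=
    measurableSet_eq_fun (by fun_prop) measurable_const
  exact h1.inter h2

lemma Delta_VNorm {n : ℕ} {p : ℝ} {a : Fin n → ℝ} (ha : a ∈ Delta p n) :
    VNorm p a = 1 := by
  obtain ⟨h1, h2⟩ := ha
  unfold VNorm
  simp_rw [abs_of_nonneg (h1 _)]
  rw [h2, Real.one_rpow]

lemma vol_cone {n : ℕ} (hn : 0 < n) {p : ℝ} (hp : 0 < p) (A : Set (Fin n → ℝ))
    (hA : MeasurableSet A) :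
    volume (cone (A ∩ Delta p n)) = VO n ({x | VNorm p x ≤ 1} ∩ rad p ⁻¹' A) := by
  rw [VO, Measure.restrict_apply ((ball_meas n p 1).inter (rad_meas p hA))]
  have h1 : cone (A ∩ Delta p n) ∩ Orth n = {x | VNorm p x ≤ 1} ∩ rad p ⁻¹' A ∩ Orth n := by
    ext x
    simp only [mem_inter_iff, and_congr_left_iff]
    intro hx
    constructor
    · rintro ⟨t, ht, a, ⟨haA, haD⟩, rfl⟩
      have ht0 : 0 < t := by
        rcases ht.1.lt_or_eq with h | h
        · exact h
        · have := mem_Orth.1 hx ⟨0, hn⟩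
          simp [← h] at this
      have hNa := Delta_VNorm haD
      have : VNorm p (t • a) = t := by rw [VNorm_smul hp ht0, hNa, mul_one]
      refine ⟨by simpa [this] using ht.2, ?_⟩
      simp only [mem_preimage, rad, this]
      rwa [smul_smul, inv_mul_cancel₀ ht0.ne', one_smul]
    · rintro ⟨h1, h2⟩
      have hpos := VNorm_pos hn (q := p) hx
      refine ⟨VNorm p x, ⟨hpos.le, h1⟩, rad p x, ⟨h2, ?_, ?_⟩, ?_⟩
      · intro i
        exact mul_nonneg (inv_nonneg.2 hpos.le) (mem_Orth.1 hx i).le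
      · have hN : VNorm p (rad p x) = 1 := by
          rw [rad, VNorm_smul hp (inv_pos.2 hpos), inv_mul_cancel₀ hpos.ne']
        have h3 := VNorm_rpow hp (rad p x)
        rw [hN, Real.one_rpow] at h3
        rw [h3]
        refine Finset.sum_congr rfl fun i _ => ?_
        rw [abs_of_nonneg]
        exact mul_nonneg (inv_nonneg.2 hpos.le) (mem_Orth.1 hx i).le
      · rw [rad, smul_smul, mul_inv_cancel₀ hpos.ne', one_smul]
  rw [← h1]
  have h2 : cone (A ∩ Delta p n) ⊆ Ici 0 := by
    rintro x ⟨t, ht, a, ⟨-, haD⟩, rfl⟩ i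
    exact mul_nonneg ht.1 (haD.1 i)
  have h3 : Orth n =ᵐ[volume] (Ici 0 : Set (Fin n → ℝ)) := by
    rw [volume_pi]
    exact Measure.univ_pi_Ioi_ae_eq_Ici (f := (0 : Fin n → ℝ))
  have h4 : cone (A ∩ Delta p n) = cone (A ∩ Delta p n) ∩ Ici 0 :=
    (inter_eq_left.2 h2).symm
  conv_lhs => rw [h4]
  exact measure_congr ((ae_eq_refl _).inter h3.symm)

lemma abs_le_one_of_ball {n : ℕ} {p : ℝ} (hp : 0 < p) {x : Fin n → ℝ} (hx : VNorm p x ≤ 1)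
    (i : Fin n) : |x i| ≤ 1 := by
  rw [VNorm_le_one_iff hp] at hx
  have h1 : |x i| ^ p ≤ 1 := le_trans
    (Finset.single_le_sum (f := fun j => |x j| ^ p) (fun j _ => by positivity) (Finset.mem_univ i))
    hx
  have := Real.rpow_le_rpow_iff (abs_nonneg (x i)) zero_le_one hp
  rw [Real.one_rpow] at this
  exact this.1 h1

lemma ball_fin (n : ℕ) {p : ℝ} (hp : 0 < p) : VO n {x | VNorm p x ≤ 1} ≠ ∞ := by
  rw [VO, Measure.restrict_apply (ball_meas n p 1)]
  refine ne_top_of_le_ne_top (b := volume (Icc (-1 : Fin n → ℝ) 1)) ?_ (measure_mono ?_)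
  · exact (isCompact_Icc.measure_lt_top).ne
  · rintro x ⟨hx, -⟩
    exact ⟨fun i => (abs_le.1 (abs_le_one_of_ball hp hx i)).1,
      fun i => (abs_le.1 (abs_le_one_of_ball hp hx i)).2⟩

lemma ball_pos {n : ℕ} (hn : 0 < n) {p : ℝ} (hp : 0 < p) : VO n {x | VNorm p x ≤ 1} ≠ 0 := by
  have hn' : (0 : ℝ) < n := by exact_mod_cast hn
  set δ : ℝ := ((n : ℝ)⁻¹) ^ (1 / p) with hδ
  have hδ0 : 0 < δ := by positivity
  have hδp : δ ^ p = (n : ℝ)⁻¹ := by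
    rw [hδ, ← Real.rpow_mul (by positivity), one_div_mul_cancel hp.ne', Real.rpow_one]
  rw [VO, Measure.restrict_apply (ball_meas n p 1)]
  refine (lt_of_lt_of_le (b := volume (Set.pi univ fun _ : Fin n => Ioc (0 : ℝ) δ)) ?_
    (measure_mono ?_)).ne'
  · rw [volume_pi_pi]
    simp only [Real.volume_Ioc, sub_zero, Finset.prod_const]
    exact ENNReal.pow_pos (ENNReal.ofReal_pos.2 hδ0) _
  · intro x hx
    simp only [mem_pi, mem_univ, true_imp_iff, mem_Ioc] at hx
    refine ⟨?_, mem_Orth.2 fun i => (hx i).1⟩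
    refine (VNorm_le_one_iff hp).2 ?_
    calc ∑ j, |x j| ^ p ≤ ∑ j : Fin n, (n : ℝ)⁻¹ := by
          refine Finset.sum_le_sum fun j _ => ?_
          rw [abs_of_pos (hx j).1, ← hδp]
          exact Real.rpow_le_rpow (hx j).1.le (hx j).2 hp.le
      _ = 1 := by simp [hn'.ne']

lemma cone_meas_eq {n : ℕ} (hn : 0 < n) {p : ℝ} (hp : 0 < p) {μ : Measure (Fin n → ℝ)}
    (hμ : IsConeMeasure p n μ) :
    μ = (VO n {x | VNorm p x ≤ 1})⁻¹ •
      Measure.map (rad p) ((VO n).restrict {x | VNorm p x ≤ 1}) := by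
  obtain ⟨hprob, hμ⟩ := hμ
  have hvD : volume (cone (Delta p n)) = VO n {x | VNorm p x ≤ 1} := by
    have := vol_cone hn hp univ MeasurableSet.univ
    simpa using this
  have hD : μ (Delta p n) = 1 := by
    rw [hμ _ (Delta_meas p n) subset_rfl, hvD]
    exact ENNReal.div_self (ball_pos hn hp) (ball_fin n hp)
  have hae : ∀ᵐ x ∂μ, x ∈ Delta p n := by
    rw [← prob_compl_eq_zero_iff (Delta_meas p n)] at hD
    exact hD
  ext A hA
  have h1 : μ A = μ (A ∩ Delta p n) := by
    refine measure_congr ?_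
    filter_upwards [hae] with x hx
    exact propext ⟨fun h => ⟨h, hx⟩, fun h => h.1⟩
  rw [h1, hμ _ (hA.inter (Delta_meas p n)) inter_subset_right, vol_cone hn hp A hA, hvD,
    Measure.smul_apply, Measure.map_apply (rad_meas p) hA,
    Measure.restrict_apply (rad_meas p hA), smul_eq_mul, ENNReal.div_eq_inv_mul, inter_comm]

/-- lower integral of the norm -/
lemma ratio {n : ℕ} (hn : 0 < n) {p q : ℝ} (hp : 0 < p) (hq : 0 < q) {μ : Measure (Fin n → ℝ)}
    (hμ : IsConeMeasure p n μ) :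
    (∫⁻ x, ENNReal.ofReal (VNorm q x) ∂μ) * (∫⁻ x, ENNReal.ofReal (VNorm p x) ∂(iidExp p n)) =
      ∫⁻ x, ENNReal.ofReal (VNorm q x) ∂(iidExp p n) := by
  have hhom : ∀ r : ℝ, 0 < r → ∀ t : ℝ, 0 < t → ∀ x : Fin n → ℝ,
      ENNReal.ofReal (VNorm r (t • x)) = ENNReal.ofReal t * ENNReal.ofReal (VNorm r x) := by
    intro r hr t ht x
    rw [VNorm_smul hr ht, ENNReal.ofReal_mul ht.le]
  have hms : ∀ r : ℝ, Measurable fun x : Fin n → ℝ => ENNReal.ofReal (VNorm r x) :=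
    fun r => (VNorm_meas r).ennreal_ofReal
  have hfin : ∀ r : ℝ, 0 < r →
      ∫⁻ x in {x | VNorm p x ≤ 1}, ENNReal.ofReal (VNorm r x) ∂(VO n) ≠ ∞ := by
    intro r hr
    refine ne_top_of_le_ne_top (b := ENNReal.ofReal ((n : ℝ) ^ (1 / r)) *
      VO n {x | VNorm p x ≤ 1}) (ENNReal.mul_ne_top ENNReal.ofReal_ne_top (ball_fin n hp)) ?_
    rw [← setLIntegral_const]
    refine setLIntegral_mono measurable_const fun x hx => ENNReal.ofReal_le_ofReal ?_
    unfold VNorm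
    refine Real.rpow_le_rpow (by positivity) ?_ (by positivity)
    calc ∑ j, |x j| ^ r ≤ ∑ j : Fin n, (1 : ℝ) := Finset.sum_le_sum fun j _ =>
          Real.rpow_le_one (abs_nonneg _) (abs_le_one_of_ball hp hx j) hr.le
      _ = n := by simp
  set a := ∫⁻ x in {x | VNorm p x ≤ 1}, ENNReal.ofReal (VNorm q x) ∂(VO n) with ha
  set b := ∫⁻ x in {x | VNorm p x ≤ 1}, ENNReal.ofReal (VNorm p x) ∂(VO n) with hb
  have P := fun φ hφ => prop_meas hn hp _ _ (hms q) (hms p) (hhom q hq) (hhom p hp) ha.symm hb.symm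
    (hfin q hq) (hfin p hp) φ hφ
  have hVO : ∀ᵐ x ∂(VO n), x ∈ Orth n := ae_restrict_mem (Orth_meas n)
  have hb0 : b ≠ 0 := by
    intro h0
    rw [hb, lintegral_eq_zero_iff (hms p)] at h0
    have h1 : ∀ᵐ x ∂((VO n).restrict {x | VNorm p x ≤ 1}), False := by
      filter_upwards [h0, ae_restrict_of_ae hVO] with x h1 h2
      have := VNorm_pos hn (q := p) h2
      simp at h1
      linarith
    rw [Filter.eventually_false_iff_eq_bot, ae_eq_bot, Measure.restrict_eq_zero] at h1
    exact ball_pos hn hp h1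
  set v := VO n {x | VNorm p x ≤ 1} with hv
  have hv0 : v ≠ 0 := ball_pos hn hp
  have hvf : v ≠ ∞ := ball_fin n hp
  -- the exponential weight
  have E : ∀ r : ℝ, ∫⁻ x, ENNReal.ofReal (VNorm r x) ∂(iidExp p n) =
      ∫⁻ x, ENNReal.ofReal (VNorm r x) * ENNReal.ofReal
        ((p / Real.Gamma (1 / p)) ^ n * Real.exp (-(VNorm p x ^ p))) ∂(VO n) := by
    intro r
    rw [iid_eq hp, lintegral_withDensity_eq_lintegral_mul (VO n) (by fun_prop) (hms r)]
    refine lintegral_congr_ae ?_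
    filter_upwards [hVO] with x hx
    rw [Pi.mul_apply, mul_comm, VNorm_rpow hp, Finset.prod_mul_distrib, ← Real.exp_sum,
      Finset.sum_neg_distrib]
    simp only [Finset.prod_const, Finset.card_univ, Fintype.card_fin]
    congr 5
    exact Finset.sum_congr rfl fun i _ => by rw [abs_of_pos (mem_Orth.1 hx i)]
  have P1 := P (fun t => ENNReal.ofReal ((p / Real.Gamma (1 / p)) ^ n * Real.exp (-(t ^ p))))
    (by fun_prop)
  rw [← E p, ← E q] at P1
  -- the truncated inverse weight
  have P2 := P ((Iic 1).indicator fun t => ENNReal.ofReal t⁻¹)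
    (Measurable.indicator (by fun_prop) measurableSet_Iic)
  have T : ∀ r : ℝ, ∫⁻ x, ENNReal.ofReal (VNorm r x) *
        ((Iic 1).indicator fun t => ENNReal.ofReal t⁻¹) (VNorm p x) ∂(VO n) =
      ∫⁻ x in {x | VNorm p x ≤ 1}, ENNReal.ofReal (VNorm r x) * ENNReal.ofReal (VNorm p x)⁻¹
        ∂(VO n) := by
    intro r
    rw [← lintegral_indicator (ball_meas n p 1)]
    refine lintegral_congr fun x => ?_
    by_cases hx : VNorm p x ≤ 1 <;> simp [indicator, hx]
  rw [T p, T q] at P2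
  have T1 : ∫⁻ x in {x | VNorm p x ≤ 1}, ENNReal.ofReal (VNorm p x) * ENNReal.ofReal (VNorm p x)⁻¹
        ∂(VO n) = v := by
    rw [hv, ← setLIntegral_one]
    refine lintegral_congr_ae ?_
    filter_upwards [ae_restrict_of_ae hVO] with x hx
    have := VNorm_pos hn (q := p) hx
    rw [← ENNReal.ofReal_mul this.le, mul_inv_cancel₀ this.ne', ENNReal.ofReal_one]
  have T2 : ∫⁻ x in {x | VNorm p x ≤ 1}, ENNReal.ofReal (VNorm q x) * ENNReal.ofReal (VNorm p x)⁻¹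
        ∂(VO n) = v * ∫⁻ x, ENNReal.ofReal (VNorm q x) ∂μ := by
    rw [cone_meas_eq hn hp hμ, lintegral_smul_measure, lintegral_map (hms q) (rad_meas p),
      smul_eq_mul, ← mul_assoc, ENNReal.mul_inv_cancel hv0 hvf, one_mul]
    refine lintegral_congr_ae ?_
    filter_upwards [ae_restrict_of_ae hVO] with x hx
    have := VNorm_pos hn (q := p) hx
    rw [rad, hhom q hq _ (inv_pos.2 this), mul_comm]
  rw [T1, T2] at P2
  set S := ∫⁻ x, ENNReal.ofReal (VNorm q x) ∂μ
  have hab : a = b * S := by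
    have : v * a = v * (b * S) := by rw [mul_comm v a, P2]; ring
    exact (ENNReal.mul_right_inj hv0 hvf).1 this
  rw [hab, mul_assoc] at P1
  exact (ENNReal.mul_right_inj hb0 (hfin p hp)).1 P1

lemma VNorm_mean {n : ℕ} (hn : 0 < n) (q : ℝ) (x : Fin n → ℝ) :
    VNorm q x = (n : ℝ) ^ (1 / q) * (∑ j, (n : ℝ)⁻¹ * |x j| ^ q) ^ (1 / q) := by
  have hn' : (0 : ℝ) < n := by exact_mod_cast hn
  rw [← Finset.mul_sum, ← Real.mul_rpow hn'.le (by positivity), ← mul_assoc,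
    mul_inv_cancel₀ hn'.ne', one_mul]
  rfl

/-- power mean inequality -/
lemma pow_mean {n : ℕ} (hn : 0 < n) {s m : ℝ} (hs : 0 < s) (hsm : s ≤ m) (x : Fin n → ℝ) :
    (∑ j, (n : ℝ)⁻¹ * |x j| ^ s) ^ (1 / s) ≤ (∑ j, (n : ℝ)⁻¹ * |x j| ^ m) ^ (1 / m) := by
  have hn' : (0 : ℝ) < n := by exact_mod_cast hn
  have hm : 0 < m := hs.trans_le hsm
  have h := Real.arith_mean_le_rpow_mean Finset.univ (fun _ : Fin n => (n : ℝ)⁻¹)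
    (fun j => |x j| ^ s) (fun _ _ => by positivity) (by simp [hn'.ne']) (fun _ _ => by positivity)
    (p := m / s) ((one_le_div hs).2 hsm)
  have e : ∀ j, (|x j| ^ s) ^ (m / s) = |x j| ^ m := fun j => by
    rw [← Real.rpow_mul (abs_nonneg _), mul_div_cancel₀ _ hs.ne']
  simp_rw [e] at h
  have h2 := Real.rpow_le_rpow (by positivity) h (z := 1 / s) (by positivity)
  refine h2.trans_eq ?_
  rw [← Real.rpow_mul (by positivity)]
  congr 1
  field_simp

lemma moment_int {p : ℝ} (hp : 0 < p) {m : ℝ} (hm : 0 < m) :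
    Integrable (fun t => |t| ^ m) (expMeasure p) := by
  rw [expMeasure, integrable_withDensity_iff_integrable_smul' (by fun_prop)
    (ae_of_all _ fun _ => ENNReal.ofReal_lt_top)]
  have h := (integrableOn_rpow_mul_exp_neg_rpow (p := p) (s := m) (by linarith) hp).const_mul
    (p / Real.Gamma (1 / p))
  refine h.congr ?_
  filter_upwards [ae_restrict_mem measurableSet_Ioi] with t ht
  have ht : 0 < t := ht
  rw [ENNReal.toReal_ofReal (mul_nonneg (coef_pos hp).le (Real.exp_pos _).le), abs_of_pos ht,
    smul_eq_mul]
  ring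

lemma moment_pos {p : ℝ} (hp : 0 < p) {m : ℝ} (hm : 0 < m) :
    0 < ∫ t, |t| ^ m ∂(expMeasure p) := by
  have := expMeasure_prob hp
  refine (integral_nonneg fun t => by positivity).lt_of_ne fun h => ?_
  have h0 := (integral_eq_zero_iff_of_nonneg (fun t => by positivity) (moment_int hp hm)).1 h.symm
  have h1 : ∀ᵐ t ∂(expMeasure p), t ∈ Ioi (0 : ℝ) :=
    (withDensity_absolutelyContinuous _ _).ae_le (ae_restrict_mem measurableSet_Ioi)
  have h2 : ∀ᵐ t ∂(expMeasure p), False := by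
    filter_upwards [h0, h1] with t ht ht'
    have ht' : 0 < t := ht'
    have : 0 < |t| ^ m := Real.rpow_pos_of_pos (abs_pos.2 ht'.ne') _
    simp only [Pi.zero_apply] at ht
    linarith
  rw [Filter.eventually_false_iff_eq_bot, ae_eq_bot] at h2
  exact IsProbabilityMeasure.ne_zero _ h2

lemma mean_int {n : ℕ} {p : ℝ} (hp : 0 < p) {m : ℝ} (hm : 0 < m) :
    Integrable (fun x : Fin n → ℝ => ∑ j, (n : ℝ)⁻¹ * |x j| ^ m) (iidExp p n) := by
  have := expMeasure_prob hp
  refine integrable_finset_sum _ fun j _ => Integrable.const_mul ?_ _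
  exact (measurePreserving_eval (fun _ : Fin n => expMeasure p) j).integrable_comp_of_integrable
    (moment_int hp hm)

lemma mean_val {n : ℕ} (hn : 0 < n) {p : ℝ} (hp : 0 < p) {m : ℝ} (hm : 0 < m) :
    ∫ x : Fin n → ℝ, ∑ j, (n : ℝ)⁻¹ * |x j| ^ m ∂(iidExp p n) = ∫ t, |t| ^ m ∂(expMeasure p) := by
  have hn' : (0 : ℝ) < n := by exact_mod_cast hn
  have := expMeasure_prob hp
  have hi : ∀ j : Fin n, Integrable (fun x : Fin n → ℝ => |x j| ^ m) (iidExp p n) := fun j =>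
    (measurePreserving_eval (fun _ : Fin n => expMeasure p) j).integrable_comp_of_integrable
      (moment_int hp hm)
  rw [integral_finset_sum _ fun j _ => (hi j).const_mul _]
  have : ∀ j : Fin n, ∫ x : Fin n → ℝ, (n : ℝ)⁻¹ * |x j| ^ m ∂(iidExp p n) =
      (n : ℝ)⁻¹ * ∫ t, |t| ^ m ∂(expMeasure p) := by
    intro j
    rw [integral_const_mul]
    congr 1
    exact integral_comp_eval (μ := fun _ : Fin n => expMeasure p) (i := j)
      (f := fun t : ℝ => |t| ^ m) (moment_int hp hm).aestronglyMeasurable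
  simp_rw [this]
  simp [hn'.ne']

lemma part_one {p q : ℝ} (hp : 0 < p) (hq : 0 < q) : ∃ c C : ℝ, 0 < c ∧ 0 < C ∧
    ∀ n : ℕ, 0 < n → Integrable (VNorm q : (Fin n → ℝ) → ℝ) (iidExp p n) ∧
      c * (n : ℝ) ^ (1 / q) ≤ ∫ x, VNorm q x ∂(iidExp p n) ∧
      ∫ x, VNorm q x ∂(iidExp p n) ≤ C * (n : ℝ) ^ (1 / q) := by
  have hprob := expMeasure_prob hp
  set m := max q 1 with hm
  have hm1 : 1 ≤ m := le_max_right _ _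
  have hmq : q ≤ m := le_max_left _ _
  have hm0 : 0 < m := by linarith
  set s := min q 1 with hs
  have hs0 : 0 < s := lt_min hq one_pos
  have hs1 : s ≤ 1 := min_le_right _ _
  have hsq : s ≤ q := min_le_left _ _
  set a := ∫ t, |t| ^ s ∂(expMeasure p) with ha
  set b := ∫ t, |t| ^ m ∂(expMeasure p) with hb
  have ha0 : 0 < a := moment_pos hp hs0
  have hb0 : 0 < b := moment_pos hp hm0
  refine ⟨a ^ (1 / s), 1 + b, by positivity, by positivity, fun n hn => ?_⟩
  have hn' : (0 : ℝ) < n := by exact_mod_cast hn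
  have : IsProbabilityMeasure (iidExp p n) := by unfold iidExp; infer_instance
  have up : ∀ x : Fin n → ℝ, VNorm q x ≤
      (n : ℝ) ^ (1 / q) * (1 + ∑ j, (n : ℝ)⁻¹ * |x j| ^ m) := by
    intro x
    rw [VNorm_mean hn]
    refine mul_le_mul_of_nonneg_left ((pow_mean hn hq hmq x).trans ?_) (by positivity)
    set T := ∑ j, (n : ℝ)⁻¹ * |x j| ^ m
    have hT : 0 ≤ T := by positivity
    have h1 : 1 / m ≤ 1 := (div_le_one hm0).2 hm1
    rcases le_total T 1 with h | h
    · exact (Real.rpow_le_one hT h (by positivity)).trans (by linarith)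
    · have := Real.rpow_le_rpow_of_exponent_le h h1
      rw [Real.rpow_one] at this
      linarith
  have lo : ∀ x : Fin n → ℝ, (n : ℝ) ^ (1 / q) * (a ^ (1 / s) * (1 + (1 / s) *
      ((∑ j, (n : ℝ)⁻¹ * |x j| ^ s) * a⁻¹ - 1))) ≤ VNorm q x := by
    intro x
    rw [VNorm_mean hn]
    refine mul_le_mul_of_nonneg_left (le_trans ?_ (pow_mean hn hs0 hsq x)) (by positivity)
    set Y := ∑ j, (n : ℝ)⁻¹ * |x j| ^ s
    have hY : 0 ≤ Y := by positivity
    have h0 : 0 ≤ Y * a⁻¹ := by positivity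
    have h1 := one_add_mul_self_le_rpow_one_add (s := Y * a⁻¹ - 1) (by linarith)
      (p := 1 / s) ((one_le_div hs0).2 hs1)
    refine (mul_le_mul_of_nonneg_left h1 (by positivity)).trans_eq ?_
    rw [add_sub_cancel, ← Real.mul_rpow ha0.le h0]
    congr 1
    field_simp
  have iu : Integrable (fun x : Fin n → ℝ =>
      (n : ℝ) ^ (1 / q) * (1 + ∑ j, (n : ℝ)⁻¹ * |x j| ^ m)) (iidExp p n) :=
    ((integrable_const _).add (mean_int hp hm0)).const_mul _
  have il0 : Integrable (fun x : Fin n → ℝ =>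
      (1 / s) * ((∑ j, (n : ℝ)⁻¹ * |x j| ^ s) * a⁻¹ - 1)) (iidExp p n) :=
    (((mean_int hp hs0).mul_const _).sub (integrable_const _)).const_mul _
  have il : Integrable (fun x : Fin n → ℝ => (n : ℝ) ^ (1 / q) * (a ^ (1 / s) * (1 + (1 / s) *
      ((∑ j, (n : ℝ)⁻¹ * |x j| ^ s) * a⁻¹ - 1)))) (iidExp p n) :=
    (((integrable_const _).add il0).const_mul _).const_mul _
  have iv : Integrable (VNorm q : (Fin n → ℝ) → ℝ) (iidExp p n) := by
    refine iu.mono' (VNorm_meas q).aestronglyMeasurable (ae_of_all _ fun x => ?_)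
    rw [Real.norm_of_nonneg (VNorm_nonneg q x)]
    exact up x
  refine ⟨iv, ?_, ?_⟩
  · refine le_trans (le_of_eq ?_) (integral_mono il iv lo)
    rw [integral_const_mul, integral_const_mul, integral_add (integrable_const _) il0,
      integral_const_mul, integral_sub ((mean_int hp hs0).mul_const _) (integrable_const _),
      integral_mul_const, mean_val hn hp hs0, ← ha, mul_inv_cancel₀ ha0.ne']
    simp [mul_comm]
  · refine (integral_mono iv iu up).trans (le_of_eq ?_)
    rw [integral_const_mul, integral_add (integrable_const _) (mean_int hp hm0),
      mean_val hn hp hm0]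
    simp [mul_comm, hb]


/-- For `n ≥ 2` and `0 < p ≤ q < ∞` there are `C_{p,q}^1, C_{p,q}^2 > 0` (depending only on
`p, q`) with: (i) `C^1 n^{1/q} ≤ E‖ω‖_q ≤ C^2 n^{1/q}`;
(ii) `C^1 E‖ω‖_q / n^{1/p} ≤ σ_0^{p,q}(μ_p) = ∫_{Δ_p^n} ‖x‖_q dμ_p ≤ C^2 E‖ω‖_q / n^{1/p}`;
(iii) `C^1 n^{1/q-1/p} ≤ σ_0^{p,q}(μ_p) ≤ C^2 n^{1/q-1/p}`. -/
theorem average_zero_term_width_cone (p q : ℝ) (hp : 0 < p) (hpq : p ≤ q) :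
    ∃ C₁ C₂ : ℝ, 0 < C₁ ∧ 0 < C₂ ∧
      ∀ n : ℕ, 2 ≤ n →
        (C₁ * (n : ℝ) ^ (1 / q) ≤ (∫ ω, VNorm q ω ∂(iidExp p n)) ∧
          (∫ ω, VNorm q ω ∂(iidExp p n)) ≤ C₂ * (n : ℝ) ^ (1 / q)) ∧
        ∀ μ : Measure (Fin n → ℝ), IsConeMeasure p n μ →
          (C₁ * ((∫ ω, VNorm q ω ∂(iidExp p n)) / (n : ℝ) ^ (1 / p)) ≤ (∫ x, VNorm q x ∂μ) ∧
            (∫ x, VNorm q x ∂μ) ≤ C₂ * ((∫ ω, VNorm q ω ∂(iidExp p n)) / (n : ℝ) ^ (1 / p))) ∧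
          (C₁ * (n : ℝ) ^ (1 / q - 1 / p) ≤ (∫ x, VNorm q x ∂μ) ∧
            (∫ x, VNorm q x ∂μ) ≤ C₂ * (n : ℝ) ^ (1 / q - 1 / p)) := by
  have hq : 0 < q := hp.trans_le hpq
  obtain ⟨c, C, hc, hC, H⟩ := part_one hp hq
  obtain ⟨d, D, hd, hD, K⟩ := part_one hp hp
  refine ⟨min c (min D⁻¹ (c / D)), max C (max d⁻¹ (C / d)), by positivity, by positivity,
    fun n hn2 => ?_⟩
  have hn : 0 < n := by omega
  have hn' : (0 : ℝ) < n := by exact_mod_cast hn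
  obtain ⟨iq, hq1, hq2⟩ := H n hn
  obtain ⟨ip, hp1, hp2⟩ := K n hn
  set F := ∫ ω, VNorm q ω ∂(iidExp p n) with hF
  set G := ∫ ω, VNorm p ω ∂(iidExp p n) with hG
  set C1 := min c (min D⁻¹ (c / D))
  set C2 := max C (max d⁻¹ (C / d))
  have a1 : C1 ≤ c := min_le_left _ _
  have a2 : C1 ≤ D⁻¹ := (min_le_right _ _).trans (min_le_left _ _)
  have a3 : C1 ≤ c / D := (min_le_right _ _).trans (min_le_right _ _)
  have b1 : C ≤ C2 := le_max_left _ _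
  have b2 : d⁻¹ ≤ C2 := (le_max_left _ _).trans (le_max_right _ _)
  have b3 : C / d ≤ C2 := (le_max_right _ _).trans (le_max_right _ _)
  set Aq := (n : ℝ) ^ (1 / q) with hAq
  set Ap := (n : ℝ) ^ (1 / p) with hAp
  have hAq0 : 0 < Aq := by positivity
  have hAp0 : 0 < Ap := by positivity
  have hF0 : 0 < F := lt_of_lt_of_le (by positivity) hq1
  have hG0 : 0 < G := lt_of_lt_of_le (by positivity) hp1
  refine ⟨⟨?_, ?_⟩, fun μ hμ => ?_⟩
  · exact (mul_le_mul_of_nonneg_right a1 hAq0.le).trans hq1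
  · exact hq2.trans (mul_le_mul_of_nonneg_right b1 hAq0.le)
  have hS : ∫ x, VNorm q x ∂μ = F / G := by
    have hr := ratio hn hp hq hμ
    rw [eq_div_iff hG0.ne', hF, hG,
      integral_eq_lintegral_of_nonneg_ae (ae_of_all _ (VNorm_nonneg q))
        (VNorm_meas q).aestronglyMeasurable,
      integral_eq_lintegral_of_nonneg_ae (ae_of_all _ (VNorm_nonneg p))
        (VNorm_meas p).aestronglyMeasurable,
      integral_eq_lintegral_of_nonneg_ae (ae_of_all _ (VNorm_nonneg q))
        (VNorm_meas q).aestronglyMeasurable, ← ENNReal.toReal_mul, hr]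
  rw [hS, Real.rpow_sub hn', ← hAq, ← hAp]
  have l1 : D⁻¹ * (F / Ap) ≤ F / G := by
    rw [show D⁻¹ * (F / Ap) = F / (D * Ap) by field_simp]
    exact div_le_div_of_nonneg_left hF0.le hG0 hp2
  have l2 : F / G ≤ d⁻¹ * (F / Ap) := by
    rw [show d⁻¹ * (F / Ap) = F / (d * Ap) by field_simp]
    exact div_le_div_of_nonneg_left hF0.le (by positivity) hp1
  refine ⟨⟨?_, ?_⟩, ?_, ?_⟩
  · exact (mul_le_mul_of_nonneg_right a2 (by positivity)).trans l1
  · exact l2.trans (mul_le_mul_of_nonneg_right b2 (by positivity))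
  · refine (mul_le_mul_of_nonneg_right a3 (by positivity)).trans (le_trans ?_ l1)
    rw [show c / D * (Aq / Ap) = D⁻¹ * (c * Aq / Ap) by field_simp]
    gcongr
  · refine le_trans (l2.trans ?_) (mul_le_mul_of_nonneg_right b3 (by positivity))
    rw [show C / d * (Aq / Ap) = d⁻¹ * (C * Aq / Ap) by field_simp]
    gcongr

end
end

section
/- Let 0<p<∞ and n ≥ 2. Then the normalized surface measure ρ_p on Δ_p^n is absolutely continuous with respect to the normalized cone measure μ_p, and for μ_p-almost every x ∈ Δ_p^n its Radon–Nikodym density is dρ_p/dμ_p(x) = c_{p,n}^{−1} (Σ_{i=1}^n x_i^{2p−2})^{1/2}, where c_{p,n} = ∫_{Δ_p^n} (Σ_{i=1}^n x_i^{2p−2})^{1/2} dμ_p(x); equivalently, ρ_p(A) = c_{p,n}^{−1} ∫_A (Σ_{i=1}^n x_i^{2p−2})^{1/2} dμ_p(x) for every Borel set A ⊆ Δ_p^n. -/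
open MeasureTheory Real Set
open scoped ENNReal

noncomputable section

/-- The positive part `Δ_p^n` of the unit sphere of `ℓ_p^n`, inside Euclidean space. -/
def DeltaE (p : ℝ) (n : ℕ) : Set (EuclideanSpace ℝ (Fin n)) :=
  {t | (∀ i, 0 ≤ t i) ∧ ∑ i, t i ^ p = 1}

/-- The cone `[0,1] · A = {t • a : t ∈ [0,1], a ∈ A}`. -/
def coneE {n : ℕ} (A : Set (EuclideanSpace ℝ (Fin n))) : Set (EuclideanSpace ℝ (Fin n)) :=
  {x | ∃ t ∈ Icc (0 : ℝ) 1, ∃ a ∈ A, x = t • a}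

/-- `μ` is the normalized cone measure on `Δ_p^n`: it is a Borel probability measure with
`μ(A) = λ([0,1]·A) / λ([0,1]·Δ_p^n)` for every Borel `A ⊆ Δ_p^n`. -/
def IsConeMeasureE (p : ℝ) (n : ℕ) (μ : Measure (EuclideanSpace ℝ (Fin n))) : Prop :=
  IsProbabilityMeasure μ ∧
    ∀ A : Set (EuclideanSpace ℝ (Fin n)), MeasurableSet A → A ⊆ DeltaE p n →
      μ A = volume (coneE A) / volume (coneE (DeltaE p n))

/-- `ρ` is the normalized surface measure on `Δ_p^n`: the `(n-1)`-dimensional Hausdorff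
measure restricted to `Δ_p^n` and normalized, `ρ(A) = H^{n-1}(A ∩ Δ_p^n)/H^{n-1}(Δ_p^n)`. -/
def IsSurfaceMeasureE (p : ℝ) (n : ℕ) (ρ : Measure (EuclideanSpace ℝ (Fin n))) : Prop :=
  ρ = (μH[(n : ℝ) - 1] (DeltaE p n))⁻¹ • (μH[(n : ℝ) - 1]).restrict (DeltaE p n)

abbrev EE (n : ℕ) := EuclideanSpace ℝ (Fin n)

lemma lint_aux (n : ℕ) (hn : 1 ≤ n) (L : ℝ) (hL : 0 < L) :
    ∫⁻ x in Ioc (0:ℝ) (1/L), ENNReal.ofReal ((x * L) ^ (n-1)) = ENNReal.ofReal (1 / (L * n)) := by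
  rw [← ofReal_integral_eq_lintegral_ofReal]
  · congr 1
    rw [← intervalIntegral.integral_of_le (by positivity)]
    simp_rw [mul_pow]
    rw [intervalIntegral.integral_mul_const, integral_pow]
    have : ((n - 1 : ℕ) : ℝ) + 1 = n := by
      have : n - 1 + 1 = n := by omega
      exact_mod_cast this
    rw [this]
    have h2 : n - 1 + 1 = n := by omega
    rw [h2]
    have hn0 : (n:ℝ) ≠ 0 := by positivity
    have : L ^ n = L ^ (n-1) * L := by rw [← pow_succ, h2]
    rw [zero_pow (by omega), sub_zero, one_div, inv_pow, this]
    field_simp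
  · exact (Continuous.integrableOn_Icc (by fun_prop)).mono_set Ioc_subset_Icc_self
  · filter_upwards [ae_restrict_mem measurableSet_Ioc] with x hx
    have := hx.1
    positivity

lemma slice_formula (n : ℕ) (hn : 2 ≤ n) (w : EE n) (hw : w ≠ 0) (B : Set (EE n))
    (hBm : MeasurableSet B) (hB : ∀ x ∈ B, inner ℝ w x = 1) :
    (μHE[n-1] : Measure (EE n)) B = ENNReal.ofReal (n * ‖w‖) * volume (coneE B) := by
  set t : Set (EE n) := {x | inner ℝ w x ∈ Ioc (0:ℝ) 1 ∧ (inner ℝ w x)⁻¹ • x ∈ B} with ht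
  have hm : Measurable (fun x : EE n => inner ℝ w x) := by fun_prop
  have htm : MeasurableSet t := by
    refine (hm measurableSet_Ioc).inter ?_
    exact (hm.inv.smul measurable_id) hBm
  have hne : Nonempty (Fin n) := ⟨⟨0, by omega⟩⟩
  have hfin : Module.finrank ℝ (EE n) = n := finrank_euclideanSpace_fin
  have hvol : volume (coneE B) = volume t := by
    apply le_antisymm
    · have : coneE B ⊆ t ∪ {0} := by
        rintro x ⟨s, hs, a, ha, rfl⟩
        rcases hs.1.eq_or_lt with h | h
        · right; simp [← h]
        · left
          have : inner ℝ w (s • a) = s := by rw [inner_smul_right, hB a ha, mul_one]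
          refine ⟨by rw [this]; exact ⟨h, hs.2⟩, ?_⟩
          rw [this, smul_smul, inv_mul_cancel₀ h.ne', one_smul]; exact ha
      refine (measure_mono this).trans ((measure_union_le _ _).trans ?_)
      simp
    · apply measure_mono
      rintro x ⟨h1, h2⟩
      refine ⟨inner ℝ w x, ⟨h1.1.le, h1.2⟩, _, h2, ?_⟩
      rw [smul_smul, mul_inv_cancel₀ h1.1.ne', one_smul]
  have hL : 0 < ‖w‖ ^ 2 := by positivity
  have key := EuclideanGeometry.euclideanHausdorffMeasure_eq_lintegral (0 : EE n) hw htm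
  rw [InnerProductSpace.euclideanHausdorffMeasure_eq_volume, hfin] at key
  have hsl : ∀ x : ℝ, (μHE[n-1] : Measure (EE n))
      (t ∩ AffineSubspace.mk' (x • w +ᵥ (0 : EE n)) (Submodule.span ℝ {w})ᗮ)
      = (Ioc (0:ℝ) (1/‖w‖^2)).indicator
        (fun x => ENNReal.ofReal ((x * ‖w‖^2)^(n-1)) * (μHE[n-1] : Measure (EE n)) B) x := by
    intro x
    have hmem : ∀ y, y ∈ AffineSubspace.mk' (x • w +ᵥ (0 : EE n)) (Submodule.span ℝ {w})ᗮ ↔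
        inner ℝ w y = x * ‖w‖^2 := by
      intro y
      rw [AffineSubspace.mem_mk', Submodule.mem_orthogonal_singleton_iff_inner_right]
      simp only [vadd_eq_add, add_zero, vsub_eq_sub, inner_sub_right, inner_smul_right,
        real_inner_self_eq_norm_sq, sub_eq_zero]
    by_cases hx : x ∈ Ioc (0:ℝ) (1/‖w‖^2)
    · rw [indicator_of_mem hx]
      have h0 : 0 < x * ‖w‖^2 := mul_pos hx.1 hL
      have h1 : x * ‖w‖^2 ≤ 1 := by
        have := hx.2; rwa [le_div_iff₀ hL] at this
      have : t ∩ AffineSubspace.mk' (x • w +ᵥ (0 : EE n)) (Submodule.span ℝ {w})ᗮ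
          = (fun y => (x * ‖w‖^2) • y) '' B := by
        ext y
        simp only [mem_inter_iff, SetLike.mem_coe, hmem, mem_image]
        constructor
        · rintro ⟨⟨h2, h3⟩, h4⟩
          refine ⟨_, h3, ?_⟩
          rw [← h4, smul_smul, mul_inv_cancel₀ (by rw [h4]; exact h0.ne'), one_smul]
        · rintro ⟨a, ha, rfl⟩
          have : inner ℝ w ((x * ‖w‖^2) • a) = x * ‖w‖^2 := by
            rw [inner_smul_right, hB a ha, mul_one]
          refine ⟨⟨by rw [this]; exact ⟨h0, h1⟩, ?_⟩, this⟩
          rw [this, smul_smul, inv_mul_cancel₀ h0.ne', one_smul]; exact ha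
      rw [this]
      have := Measure.euclideanHausdorffMeasure_smul₀ (n-1) h0.ne' B
      rw [← image_smul] at this
      rw [this, ENNReal.smul_def, smul_eq_mul]
      congr 1
      rw [ENNReal.ofReal, ENNReal.coe_inj]
      apply NNReal.coe_injective
      rw [Real.coe_toNNReal _ (by positivity)]
      simp only [NNReal.coe_pow, coe_nnnorm, Real.norm_eq_abs]
      rw [abs_of_pos h0]
    · rw [indicator_of_notMem hx]
      refine (congrArg _ ?_).trans measure_empty
      rw [eq_empty_iff_forall_notMem]
      rintro y ⟨⟨h2, h3⟩, h4⟩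
      rw [SetLike.mem_coe, hmem] at h4
      rw [h4] at h2
      apply hx
      refine ⟨?_, ?_⟩
      · exact pos_of_mul_pos_left h2.1 hL.le
      · rw [le_div_iff₀ hL]; exact h2.2
  simp_rw [hsl] at key
  rw [lintegral_indicator measurableSet_Ioc, lintegral_mul_const _ (by fun_prop),
    lint_aux n (by omega) _ hL, ← mul_assoc, ← ofReal_norm, ← ENNReal.ofReal_mul (by positivity)] at key
  rw [hvol, key, ← mul_assoc, ← ENNReal.ofReal_mul (by positivity)]
  have hn0 : (n:ℝ) ≠ 0 := by positivity
  have : n * ‖w‖ * (‖w‖ * (1 / (‖w‖ ^ 2 * n))) = 1 := by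
    have : ‖w‖ ≠ 0 := by positivity
    field_simp
  rw [this]; simp

/-- Local comparison of two measures up to constants close to one gives an inequality. -/
lemma measure_le_of_local {X : Type*} [TopologicalSpace X] [SecondCountableTopology X]
    [MeasurableSpace X] [OpensMeasurableSpace X] (m₁ m₂ : Measure X) (S : Set X)
    (N : ℕ)
    (h : ∀ q : NNReal, 1 < q → ∀ x ∈ S, ∃ U : Set X, IsOpen U ∧ x ∈ U ∧
      ∀ A, MeasurableSet A → A ⊆ S → A ⊆ U → m₁ A ≤ (q : ℝ≥0∞) ^ N * m₂ A)
    (A : Set X) (hA : MeasurableSet A) (hAS : A ⊆ S) : m₁ A ≤ m₂ A := by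
  have h1 : ∀ q : NNReal, 1 < q → m₁ A ≤ (q : ℝ≥0∞) ^ N * m₂ A := by
    intro q hq
    choose! U hUo hxU hU using h q hq
    obtain ⟨T, hTS, hTc, hT⟩ := TopologicalSpace.countable_cover_nhdsWithin
      (f := U) (s := S) (fun x hx => mem_nhdsWithin_of_mem_nhds ((hUo x hx).mem_nhds (hxU x hx)))
    rcases T.eq_empty_or_nonempty with rfl | hTn
    · have : A = ∅ := by
        apply subset_empty_iff.1
        simpa using hAS.trans hT
      simp [this]
    obtain ⟨f, hf⟩ := hTc.exists_eq_range hTn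
    have hfS : ∀ i, f i ∈ S := fun i => hTS (by rw [hf]; exact mem_range_self i)
    let D : ℕ → Set X := disjointed (fun i => U (f i))
    have hD : ∀ i, MeasurableSet (A ∩ D i) := fun i =>
      hA.inter (MeasurableSet.disjointed (fun i => (hUo _ (hfS i)).measurableSet) i)
    have hdis : Pairwise (Function.onFun Disjoint (fun i => A ∩ D i)) := by
      intro i j hij
      exact (disjoint_disjointed _ hij).mono inter_subset_right inter_subset_right
    have hAu : A = ⋃ i, A ∩ D i := by
      rw [← inter_iUnion, iUnion_disjointed, eq_comm, inter_eq_left]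
      refine hAS.trans (hT.trans ?_)
      rw [hf]; simp
    have e1 : ∀ m : Measure X, m A = ∑' i, m (A ∩ D i) := by
      intro m
      conv_lhs => rw [hAu]
      exact measure_iUnion hdis hD
    rw [e1 m₁, e1 m₂, ← ENNReal.tsum_mul_left]
    refine ENNReal.tsum_le_tsum fun i => ?_
    exact hU (f i) (hfS i) _ (hD i) (inter_subset_left.trans hAS)
      (inter_subset_right.trans (disjointed_subset _ i))
  have ht : Filter.Tendsto (fun q : NNReal => ((q : ℝ≥0∞) ^ N * m₂ A)) (nhdsWithin 1 (Ioi 1))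
      (nhds (1 * m₂ A)) := by
    apply ENNReal.Tendsto.mul_const
    · have : Filter.Tendsto (fun q : NNReal => ((q ^ N : NNReal) : ℝ≥0∞)) (nhds 1)
          (nhds (((1:NNReal) ^ N : NNReal) : ℝ≥0∞)) :=
        ENNReal.tendsto_coe.2 ((continuous_pow N).tendsto 1)
      simpa using this.mono_left nhdsWithin_le_nhds
    · left; simp
  rw [one_mul] at ht
  exact ge_of_tendsto ht (by filter_upwards [self_mem_nhdsWithin] with q hq using h1 q hq)

lemma measurable_image_aux {n : ℕ} (A : Set (EE n)) (hA : MeasurableSet A) (r : EE n → EE n)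
    (hr : ContinuousOn r A) (hi : InjOn r A) : MeasurableSet (r '' A) :=
  hA.image_of_continuousOn_injOn hr hi

lemma muHE_image_le {n d : ℕ} (A : Set (EE n)) (r : EE n → EE n) (q : NNReal)
    (h : LipschitzOnWith q r A) :
    (μHE[d] : Measure (EE n)) (r '' A) ≤ (q : ℝ≥0∞) ^ d * (μHE[d] : Measure (EE n)) A := by
  rw [Measure.euclideanHausdorffMeasure_def, Measure.smul_apply, Measure.smul_apply,
    ENNReal.smul_def, ENNReal.smul_def, smul_eq_mul, smul_eq_mul, mul_left_comm]
  gcongr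
  have := h.hausdorffMeasure_image_le (d := d) (by positivity)
  simpa using this

open scoped Pointwise in
lemma cone_scale_le {n : ℕ} (A : Set (EE n)) (q : NNReal) (hq : 0 < q) (l : EE n → ℝ)
    (h : ∀ x ∈ A, 0 ≤ l x ∧ l x ≤ q) :
    volume (coneE ((fun x => l x • x) '' A)) ≤ (q : ℝ≥0∞) ^ n * volume (coneE A) := by
  have : coneE ((fun x => l x • x) '' A) ⊆ (q : ℝ) • coneE A := by
    rintro x ⟨t, ht, _, ⟨a, ha, rfl⟩, rfl⟩
    have hq' : (0:ℝ) < q := hq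
    refine ⟨(t * l a / q) • a, ⟨t * l a / q, ⟨?_, ?_⟩, a, ha, rfl⟩, ?_⟩
    · have := ht.1; have := (h a ha).1; positivity
    · rw [div_le_one hq']
      calc t * l a ≤ 1 * l a := by gcongr; exacts [(h a ha).1, ht.2]
        _ ≤ q := by rw [one_mul]; exact (h a ha).2
    · simp only [smul_smul]
      congr 1
      field_simp
  refine (measure_mono this).trans ?_
  rw [Measure.addHaar_smul, finrank_euclideanSpace_fin]
  gcongr
  rw [abs_of_nonneg (by positivity), ENNReal.ofReal_pow (by positivity)]
  simp

/-- Two-sided comparison for a piece of a surface radially close to a hyperplane. -/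
lemma local_compare (n : ℕ) (hn : 2 ≤ n) (w : EE n) (hw : w ≠ 0) (A : Set (EE n))
    (hAm : MeasurableSet A) (q : NNReal) (hq : 1 < q)
    (hl : ∀ x ∈ A, (q : ℝ)⁻¹ ≤ (inner ℝ w x)⁻¹ ∧ (inner ℝ w x)⁻¹ ≤ q)
    (hr1 : ∀ x ∈ A, ∀ y ∈ A, ‖(inner ℝ w x)⁻¹ • x - (inner ℝ w y)⁻¹ • y‖ ≤ q * ‖x - y‖)
    (hr2 : ∀ x ∈ A, ∀ y ∈ A, ‖x - y‖ ≤ q * ‖(inner ℝ w x)⁻¹ • x - (inner ℝ w y)⁻¹ • y‖) :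
    (μHE[n-1] : Measure (EE n)) A ≤
      (q : ℝ≥0∞) ^ (2 * n - 1) * (ENNReal.ofReal (n * ‖w‖) * volume (coneE A)) ∧
    ENNReal.ofReal (n * ‖w‖) * volume (coneE A) ≤
      (q : ℝ≥0∞) ^ (2 * n - 1) * (μHE[n-1] : Measure (EE n)) A := by
  have hq0 : (0:ℝ) < q := lt_trans zero_lt_one hq
  set r : EE n → EE n := fun x => (inner ℝ w x)⁻¹ • x with hr
  have hpos : ∀ x ∈ A, 0 < (inner ℝ w x)⁻¹ := fun x hx =>
    lt_of_lt_of_le (by positivity) (hl x hx).1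
  have hlip : LipschitzOnWith q r A := by
    refine LipschitzOnWith.of_dist_le_mul fun x hx y hy => ?_
    rw [dist_eq_norm, dist_eq_norm]; exact hr1 x hx y hy
  have hinj : InjOn r A := by
    intro x hx y hy hxy
    have := hr2 x hx y hy
    have h0 : (inner ℝ w x)⁻¹ • x - (inner ℝ w y)⁻¹ • y = 0 := sub_eq_zero.2 hxy
    rw [h0, norm_zero, mul_zero] at this
    exact sub_eq_zero.1 (norm_le_zero_iff.1 this)
  have hrm : MeasurableSet (r '' A) := measurable_image_aux A hAm r hlip.continuousOn hinj
  have hB : ∀ x ∈ r '' A, inner ℝ w x = 1 := by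
    rintro _ ⟨x, hx, rfl⟩
    have := hpos x hx
    rw [hr, inner_smul_right, inv_mul_cancel₀ (inv_pos.1 this).ne']
  have hsl := slice_formula n hn w hw _ hrm hB
  -- Inverse map
  have hinv : (fun y => Function.invFunOn r A y) '' (r '' A) = A :=
    (hinj.leftInvOn_invFunOn).image_image
  have hlip2 : LipschitzOnWith q (Function.invFunOn r A) (r '' A) := by
    refine LipschitzOnWith.of_dist_le_mul ?_
    rintro _ ⟨x, hx, rfl⟩ _ ⟨y, hy, rfl⟩
    rw [hinj.leftInvOn_invFunOn hx, hinj.leftInvOn_invFunOn hy, dist_eq_norm, dist_eq_norm]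
    exact hr2 x hx y hy
  have H1 := muHE_image_le (d := n-1) A r q hlip
  have H2 := muHE_image_le (d := n-1) _ _ q hlip2
  rw [hinv] at H2
  have C1 := cone_scale_le A q hq0 (fun x => (inner ℝ w x)⁻¹)
    (fun x hx => ⟨(hpos x hx).le, (hl x hx).2⟩)
  have C2 := cone_scale_le (r '' A) q hq0 (fun y => (inner ℝ w (Function.invFunOn r A y)))
    (by
      rintro _ ⟨x, hx, rfl⟩
      rw [hinj.leftInvOn_invFunOn hx]
      have h1 := inv_pos.1 (hpos x hx)
      exact ⟨h1.le, (inv_le_inv₀ hq0 h1).1 (hl x hx).1⟩)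
  have e : (fun y => (inner ℝ w (Function.invFunOn r A y)) • y) '' (r '' A) = A := by
    rw [image_image]
    conv_rhs => rw [← image_id A]
    apply image_congr
    intro x hx
    rw [hinj.leftInvOn_invFunOn hx]
    simp only [hr, id]
    rw [smul_smul, mul_inv_cancel₀ (inv_pos.1 (hpos x hx)).ne', one_smul]
  rw [e] at C2
  have hN : 2 * n - 1 = (n - 1) + n := by omega
  rw [hN, pow_add]
  constructor
  · calc _ ≤ _ := H2
      _ = (q : ℝ≥0∞) ^ (n-1) * (ENNReal.ofReal (n * ‖w‖) * volume (coneE (r '' A))) := by rw [hsl]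
      _ ≤ (q : ℝ≥0∞) ^ (n-1) * (ENNReal.ofReal (n * ‖w‖) * (q ^ n * volume (coneE A))) := by gcongr
      _ = _ := by ring
  · calc _ ≤ ENNReal.ofReal (n * ‖w‖) * (q ^ n * volume (coneE (r '' A))) := by gcongr
      _ = q ^ n * (μHE[n-1] : Measure (EE n)) (r '' A) := by rw [hsl]; ring
      _ ≤ q ^ n * (q ^ (n-1) * (μHE[n-1] : Measure (EE n)) A) := by gcongr
      _ = _ := by ring

/-- The (unnormalized) normal vector of `Δ_p^n`. -/
def wE (p : ℝ) {n : ℕ} (x : EE n) : EE n := WithLp.toLp 2 (fun i => x i ^ (p - 1))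

/-- The density. -/
def gE (p : ℝ) {n : ℕ} (x : EE n) : ℝ := (∑ i, x i ^ (2 * p - 2)) ^ ((1 : ℝ) / 2)

lemma norm_wE (p : ℝ) {n : ℕ} (x : EE n) (hx : ∀ i, 0 < x i) : ‖wE p x‖ = gE p x := by
  rw [EuclideanSpace.norm_eq, gE, Real.sqrt_eq_rpow]
  congr 1
  refine Finset.sum_congr rfl fun i _ => ?_
  simp only [wE, Real.norm_eq_abs, sq_abs]
  rw [← Real.rpow_natCast, ← Real.rpow_mul (hx i).le]
  congr 1
  push_cast; ring

lemma inner_wE (p : ℝ) {n : ℕ} (x y : EE n) : inner ℝ (wE p x) y = ∑ i, x i ^ (p-1) * y i := by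
  simp only [PiLp.inner_apply, wE, RCLike.inner_apply, conj_trivial]
  exact Finset.sum_congr rfl fun i _ => mul_comm _ _

lemma inner_wE_self (p : ℝ) {n : ℕ} (x : EE n) (hx : ∀ i, 0 < x i) (hD : x ∈ DeltaE p n) :
    inner ℝ (wE p x) x = 1 := by
  rw [inner_wE]
  refine Eq.trans ?_ hD.2
  refine Finset.sum_congr rfl fun i _ => ?_
  rw [← Real.rpow_add_one (hx i).ne']; congr 1; ring

lemma gE_pos (p : ℝ) {n : ℕ} (hn : 2 ≤ n) (x : EE n) (hx : ∀ i, 0 < x i) : 0 < gE p x := by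
  have : Nonempty (Fin n) := ⟨⟨0, by omega⟩⟩
  apply Real.rpow_pos_of_pos
  exact Finset.sum_pos (fun i _ => Real.rpow_pos_of_pos (hx i) _) Finset.univ_nonempty

lemma gE_cont (p : ℝ) {n : ℕ} (x : EE n) (hx : ∀ i, 0 < x i) : ContinuousAt (gE p (n := n)) x := by
  unfold gE
  apply ContinuousAt.rpow_const
  · refine tendsto_finsetSum _ fun i _ => ?_
    apply ContinuousAt.rpow_const
    · fun_prop
    · left; exact (hx i).ne'
  · right; norm_num

lemma strict_F (p : ℝ) {n : ℕ} (x : EE n) (hx : ∀ i, 0 < x i) :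
    HasStrictFDerivAt (fun y : EE n => ∑ i, y i ^ p) (p • innerSL ℝ (wE p x)) x := by
  have h : ∀ i ∈ (Finset.univ : Finset (Fin n)), HasStrictFDerivAt (fun y : EE n => y i ^ p)
      ((p * x i ^ (p-1)) • (EuclideanSpace.proj i : EE n →L[ℝ] ℝ)) x := by
    intro i _
    have h1 := Real.hasStrictDerivAt_rpow_const (p := p) (Or.inl (hx i).ne')
    have h2 : HasStrictFDerivAt (fun y : EE n => y i) (EuclideanSpace.proj i : EE n →L[ℝ] ℝ) x :=
      (EuclideanSpace.proj i : EE n →L[ℝ] ℝ).hasStrictFDerivAt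
    exact h1.comp_hasStrictFDerivAt x h2
  have := HasStrictFDerivAt.fun_sum h
  refine this.congr_fderiv ?_
  ext y
  simp only [FunLike.coe_sum, Finset.sum_apply, FunLike.coe_smul, Pi.smul_apply,
    innerSL_apply_apply, inner_wE, smul_eq_mul, Finset.mul_sum, PiLp.proj_apply]
  exact Finset.sum_congr rfl fun i _ => by ring

/-- Radial projection onto the tangent hyperplane is almost an isometry near the base point. -/
lemma delta_local (p : ℝ) (hp : 0 < p) {n : ℕ} (hn : 2 ≤ n) (x₀ : EE n) (hx : ∀ i, 0 < x₀ i)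
    (hD : x₀ ∈ DeltaE p n) (q : ℝ) (hq : 1 < q) :
    ∃ U : Set (EE n), IsOpen U ∧ x₀ ∈ U ∧
      (∀ x ∈ U, q⁻¹ ≤ (inner ℝ (wE p x₀) x)⁻¹ ∧ (inner ℝ (wE p x₀) x)⁻¹ ≤ q ∧
        gE p x ≤ q * gE p x₀ ∧ gE p x₀ ≤ q * gE p x) ∧
      (∀ x ∈ U ∩ DeltaE p n, ∀ y ∈ U ∩ DeltaE p n,
        ‖(inner ℝ (wE p x₀) x)⁻¹ • x - (inner ℝ (wE p x₀) y)⁻¹ • y‖ ≤ q * ‖x - y‖ ∧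
        ‖x - y‖ ≤ q * ‖(inner ℝ (wE p x₀) x)⁻¹ • x - (inner ℝ (wE p x₀) y)⁻¹ • y‖) := by
  set w := wE p x₀ with hw
  have hw1 : inner ℝ w x₀ = 1 := inner_wE_self p x₀ hx hD
  have hq0 : 0 < q := by linarith
  set ε : ℝ := 1 - q⁻¹ with hε
  have hqi : q⁻¹ < 1 := inv_lt_one_of_one_lt₀ hq
  have hε0 : 0 < ε := by linarith
  have hqq : q * q⁻¹ = 1 := mul_inv_cancel₀ hq0.ne'
  have hε1 : 1 + ε ≤ q := by
    have : 0 ≤ (q - 1)^2 * q⁻¹ := by positivity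
    nlinarith
  have hε2 : q * (1 - ε) = 1 := by rw [hε]; linarith
  have hg0 : 0 < gE p x₀ := gE_pos p hn x₀ hx
  set M := ‖x₀‖ + 1 with hM
  have hM0 : 0 < M := by positivity
  set l : EE n → ℝ := fun x => (inner ℝ w x)⁻¹ with hl
  have hlc : ContinuousAt l x₀ := by
    apply ContinuousAt.inv₀
    · fun_prop
    · rw [hw1]; norm_num
  have hl0 : l x₀ = 1 := by simp [hl, hw1]
  set c : ℝ := ε / (2 * M * (4 * p⁻¹)) with hc
  have hc0 : 0 < c := by positivity
  have hs := (strict_F p x₀ hx).isLittleO.def hc0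
  rw [nhds_prod_eq] at hs
  obtain ⟨V, hV, hVs⟩ := (Filter.eventually_prod_self_iff'
    (r := fun a : EE n × EE n => ‖(fun y : EE n => ∑ i, y i ^ p) a.1 - (fun y : EE n => ∑ i, y i ^ p) a.2
      - (p • innerSL ℝ (wE p x₀)) (a.1 - a.2)‖ ≤ c * ‖a.1 - a.2‖)).1 hs
  have e1 : ∀ᶠ x in nhds x₀, |l x - 1| < ε / 2 := by
    have : ContinuousAt (fun x => |l x - 1|) x₀ := by fun_prop
    apply this.eventually_lt continuousAt_const
    rw [hl0]; simpa using hε0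
  have e2 : ∀ᶠ x in nhds x₀, q⁻¹ < l x := by
    apply continuousAt_const.eventually_lt hlc; rwa [hl0]
  have e3 : ∀ᶠ x in nhds x₀, l x < min q 2 := by
    apply hlc.eventually_lt continuousAt_const; rw [hl0]; exact lt_min hq (by norm_num)
  have hgc := gE_cont p x₀ hx
  have e4 : ∀ᶠ x in nhds x₀, gE p x < q * gE p x₀ := by
    apply hgc.eventually_lt continuousAt_const; nlinarith
  have e5 : ∀ᶠ x in nhds x₀, gE p x₀ < q * gE p x := by
    apply continuousAt_const.eventually_lt (continuousAt_const.mul hgc)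
    change gE p x₀ < q * gE p x₀; nlinarith
  have e6 : ∀ᶠ x in nhds x₀, ‖x‖ < M := by
    apply continuousAt_id.norm.eventually_lt continuousAt_const; simp [hM]
  have e7 : ∀ᶠ x in nhds x₀, x ∈ V := hV
  obtain ⟨U, hU, hUo, hxU⟩ := eventually_nhds_iff.1
    (e1.and (e2.and (e3.and (e4.and (e5.and (e6.and e7))))))
  refine ⟨U, hUo, hxU, ?_, ?_⟩
  · intro x hxx
    obtain ⟨h1, h2, h3, h4, h5, h6, h7⟩ := hU x hxx
    exact ⟨h2.le, (h3.trans_le (min_le_left _ _)).le, h4.le, h5.le⟩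
  · rintro x ⟨hxx, hxD⟩ y ⟨hyy, hyD⟩
    obtain ⟨h1, h2, h3, h4, h5, h6, h7⟩ := hU x hxx
    obtain ⟨k1, k2, k3, k4, k5, k6, k7⟩ := hU y hyy
    have hlx : 0 < l x := lt_trans (by positivity) h2
    have hly : 0 < l y := lt_trans (by positivity) k2
    have hlx2 : l x ≤ 2 := (h3.trans_le (min_le_right _ _)).le
    have hly2 : l y ≤ 2 := (k3.trans_le (min_le_right _ _)).le
    have hF := hVs x h7 y k7
    simp only at hF
    rw [hxD.2, hyD.2, sub_self, zero_sub, norm_neg] at hF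
    simp only [FunLike.coe_smul, Pi.smul_apply, innerSL_apply_apply, smul_eq_mul,
      Real.norm_eq_abs, abs_mul, abs_of_pos hp] at hF
    have hF' : |inner ℝ w (x - y)| ≤ p⁻¹ * c * ‖x - y‖ := by
      rw [mul_assoc, le_inv_mul_iff₀ hp]; exact hF
    have hdiff : l x - l y = - (l x * l y * inner ℝ w (x - y)) := by
      have a1 : inner ℝ w x ≠ 0 := (inv_pos.1 hlx).ne'
      have a2 : inner ℝ w y ≠ 0 := (inv_pos.1 hly).ne'
      rw [inner_sub_right]
      simp only [hl]
      field_simp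
      ring
    have hd : |l x - l y| ≤ 4 * (p⁻¹ * c * ‖x - y‖) := by
      rw [hdiff, abs_neg, abs_mul, abs_of_pos (mul_pos hlx hly)]
      have : l x * l y ≤ 4 := by nlinarith
      gcongr
    have hkey : ‖(l x • x - l y • y) - (x - y)‖ ≤ ε * ‖x - y‖ := by
      have : (l x • x - l y • y) - (x - y) = (l x - 1) • (x - y) + (l x - l y) • y := by
        module
      rw [this]
      refine (norm_add_le _ _).trans ?_
      rw [norm_smul, norm_smul, Real.norm_eq_abs, Real.norm_eq_abs]
      calc _ ≤ ε / 2 * ‖x - y‖ + 4 * (p⁻¹ * c * ‖x - y‖) * M := by gcongr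
        _ = ε * ‖x - y‖ := by
          rw [hc]; field_simp; ring
    constructor
    · calc ‖l x • x - l y • y‖ = ‖((l x • x - l y • y) - (x - y)) + (x - y)‖ := by
            rw [sub_add_cancel]
        _ ≤ ε * ‖x - y‖ + ‖x - y‖ := (norm_add_le _ _).trans (by gcongr)
        _ = (1 + ε) * ‖x - y‖ := by ring
        _ ≤ q * ‖x - y‖ := by gcongr
    · have h : ‖x - y‖ ≤ ‖l x • x - l y • y‖ + ε * ‖x - y‖ := by
        calc ‖x - y‖ = ‖(l x • x - l y • y) - ((l x • x - l y • y) - (x - y))‖ := by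
              rw [sub_sub_cancel]
          _ ≤ _ := (norm_sub_le _ _).trans (by gcongr)
      calc ‖x - y‖ = q * ((1 - ε) * ‖x - y‖) := by rw [← mul_assoc, hε2, one_mul]
        _ ≤ q * ‖l x • x - l y • y‖ := by gcongr; linarith

lemma meas_coord {n : ℕ} (i : Fin n) : Measurable (fun x : EE n => x i) := by fun_prop

lemma meas_Delta (p : ℝ) (n : ℕ) : MeasurableSet (DeltaE p n) := by
  have h1 : MeasurableSet {t : EE n | ∀ i, 0 ≤ t i} := by
    rw [ofPred_forall]
    exact MeasurableSet.iInter fun i => measurableSet_le measurable_const (meas_coord i)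
  have h2 : Measurable (fun t : EE n => ∑ i, t i ^ p) :=
    Finset.measurable_fun_sum _ fun i _ => (meas_coord i).pow_const p
  exact h1.inter (h2 (measurableSet_singleton 1))

lemma meas_gE (p : ℝ) (n : ℕ) : Measurable (gE p (n := n)) := by
  unfold gE
  exact (Finset.measurable_fun_sum _ fun i _ => (meas_coord i).pow_const _).pow_const _

/-- A measurable set meeting each line in direction `e_i` at most once is null. -/
lemma null_of_graph {n : ℕ} (i : Fin n) (Z : Set (EE n)) (hZ : MeasurableSet Z)
    (h : ∀ x ∈ Z, ∀ s : ℝ, x + s • EuclideanSpace.single i (1:ℝ) ∈ Z → s = 0) :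
    volume Z = 0 := by
  set e : EE n := EuclideanSpace.single i (1:ℝ) with he
  refine Measure.addHaar_eq_zero_of_disjoint_translates volume
    (fun k : ℕ => ((1:ℝ) / (k + 1)) • e) ?_ ?_ hZ
  · refine (Metric.isBounded_closedBall (x := (0 : EE n)) (r := 1)).subset ?_
    rintro _ ⟨k, rfl⟩
    rw [mem_closedBall_zero_iff, norm_smul, he, EuclideanSpace.norm_single, norm_one, mul_one,
      Real.norm_eq_abs, abs_of_pos (by positivity), div_le_one (by positivity)]
    have : (0:ℝ) ≤ k := by positivity
    linarith
  · intro k m hkm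
    rw [Function.onFun, disjoint_left]
    intro y hy1 hy2
    rw [singleton_add, mem_image] at hy1 hy2
    obtain ⟨a, ha, rfl⟩ := hy1
    obtain ⟨b, hb, hab⟩ := hy2
    have : a = b + ((1:ℝ) / (m + 1) - 1 / (k + 1)) • e := by
      rw [sub_smul]
      have : a = (((1:ℝ) / (m + 1)) • e + b) - ((1:ℝ) / (k + 1)) • e := by rw [hab]; abel
      rw [this]; abel
    rw [this] at ha
    have h0 := h b hb _ ha
    apply hkm
    have h1 : (1:ℝ) / (m + 1) = 1 / (k + 1) := by linarith
    have h2 : (m : ℝ) + 1 = k + 1 := by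
      rw [div_eq_div_iff (by positivity) (by positivity)] at h1; linarith
    have h3 : (m : ℝ) = k := by linarith
    exact (Nat.cast_injective h3).symm

lemma boundary_cone (p : ℝ) {n : ℕ} (i : Fin n) :
    volume (coneE {x ∈ DeltaE p n | x i = 0}) = 0 := by
  have hz : volume {x : EE n | x i = 0} = 0 := by
    refine null_of_graph i _ ((meas_coord i) (measurableSet_singleton 0)) ?_
    intro x hx s hs
    simp only [mem_ofPred_eq] at hx
    simpa [hx] using hs
  refine measure_mono_null ?_ hz
  rintro _ ⟨t, ht, a, ha, rfl⟩
  simp [ha.2]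

lemma boundary_H (p : ℝ) (hp : 0 < p) {n : ℕ} (hn : 2 ≤ n) (i : Fin n) :
    (μHE[n-1] : Measure (EE n)) {x ∈ DeltaE p n | x i = 0} = 0 := by
  set e : EE n := EuclideanSpace.single i (1:ℝ) with he
  set S : Set (EE n) := {x ∈ DeltaE p n | x i = 0} with hS
  have hSm : MeasurableSet S := (meas_Delta p n).inter ((meas_coord i) (measurableSet_singleton 0))
  have hiso : Isometry (fun x : EE n => x + e) := (IsometryEquiv.addRight e).isometry
  rw [← hiso.euclideanHausdorffMeasure_image]
  have hne : e ≠ 0 := by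
    intro h
    have : ‖e‖ = 1 := by rw [he, EuclideanSpace.norm_single, norm_one]
    rw [h, norm_zero] at this; norm_num at this
  rw [slice_formula n hn e hne]
  · -- cone is null
    rw [mul_eq_zero]; right
    set Z : Set (EE n) := {x | 0 ≤ x i ∧ ∑ j ∈ Finset.univ.erase i, x j ^ p = x i ^ p} with hZ
    have hZ0 : volume Z = 0 := by
      refine null_of_graph i Z ?_ ?_
      · refine (measurableSet_le measurable_const (meas_coord i)).inter ?_
        exact measurableSet_eq_fun
          (Finset.measurable_fun_sum _ fun j _ => (meas_coord j).pow_const p)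
          ((meas_coord i).pow_const p)
      · rintro x ⟨h1, h2⟩ s ⟨h3, h4⟩
        have hsum : ∑ j ∈ Finset.univ.erase i, (x + s • e) j ^ p
            = ∑ j ∈ Finset.univ.erase i, x j ^ p := by
          refine Finset.sum_congr rfl fun j hj => ?_
          have : j ≠ i := Finset.ne_of_mem_erase hj
          simp [he, this]
        rw [← he] at h3 h4
        rw [hsum, h2] at h4
        have := (Real.rpow_left_inj h1 h3 hp.ne').1 h4
        simpa [he] using this
    refine measure_mono_null ?_ hZ0
    rintro _ ⟨t, ht, _, ⟨a, ha, rfl⟩, rfl⟩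
    have hai : a i = 0 := ha.2
    have hi : (t • (a + e)) i = t := by simp [he, hai]
    refine ⟨by rw [hi]; exact ht.1, ?_⟩
    rw [hi]
    have hs : ∑ j ∈ Finset.univ.erase i, a j ^ p = 1 := by
      rw [← ha.1.2, ← Finset.add_sum_erase _ _ (Finset.mem_univ i), hai, Real.zero_rpow hp.ne',
        zero_add]
    calc ∑ j ∈ Finset.univ.erase i, (t • (a + e)) j ^ p
        = ∑ j ∈ Finset.univ.erase i, t ^ p * a j ^ p := by
          refine Finset.sum_congr rfl fun j hj => ?_
          have : j ≠ i := Finset.ne_of_mem_erase hj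
          rw [← Real.mul_rpow ht.1 (ha.1.1 j)]
          simp [he, this]
      _ = t ^ p := by rw [← Finset.mul_sum, hs, mul_one]
  · exact measurable_image_aux S hSm _ hiso.continuous.continuousOn hiso.injective.injOn
  · rintro _ ⟨a, ha, rfl⟩
    have hai : a i = 0 := ha.2
    simp [he, inner_add_right, EuclideanSpace.inner_single_left, hai]

lemma coneDelta_ne_zero (p : ℝ) (hp : 0 < p) {n : ℕ} (hn : 2 ≤ n) :
    volume (coneE (DeltaE p n)) ≠ 0 := by
  have : Nonempty (Fin n) := ⟨⟨0, by omega⟩⟩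
  set O : Set (EE n) := {x | (∀ i, 0 < x i) ∧ ∑ i, x i ^ p < 1} with hO
  have hOo : IsOpen O := by
    have h1 : IsOpen {x : EE n | ∀ i, 0 < x i} := by
      rw [ofPred_forall]
      exact isOpen_iInter_of_finite fun i => isOpen_lt continuous_const (by fun_prop)
    have h2 : IsOpen {x : EE n | ∑ i, x i ^ p < 1} := by
      refine isOpen_lt (continuous_finsetSum _ fun i _ => ?_) continuous_const
      exact Continuous.rpow_const (by fun_prop) (fun _ => Or.inr hp.le)
    exact h1.inter h2
  have hn0 : (0:ℝ) < n := by positivity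
  have hOn : O.Nonempty := by
    refine ⟨WithLp.toLp 2 (fun _ => ((1:ℝ) / (2 * n)) ^ (1 / p)), ?_, ?_⟩
    · intro i; simp only; positivity
    · simp only
      rw [Finset.sum_const, ← Real.rpow_mul (by positivity), one_div_mul_cancel hp.ne',
        Real.rpow_one, Finset.card_univ, Fintype.card_fin, nsmul_eq_mul]
      have : (n:ℝ) * (1 / (2 * n)) = 1/2 := by field_simp
      rw [this]; norm_num
  have hsub : O ⊆ coneE (DeltaE p n) := by
    rintro x ⟨h1, h2⟩
    have hs : 0 < ∑ i, x i ^ p :=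
      Finset.sum_pos (fun i _ => Real.rpow_pos_of_pos (h1 i) _) Finset.univ_nonempty
    set s := ∑ i, x i ^ p with hsd
    set t := s ^ (1/p) with ht
    have ht0 : 0 < t := Real.rpow_pos_of_pos hs _
    have htp : t ^ p = s := by
      rw [ht, ← Real.rpow_mul hs.le, one_div_mul_cancel hp.ne', Real.rpow_one]
    refine ⟨t, ⟨ht0.le, Real.rpow_le_one hs.le h2.le (by positivity)⟩, t⁻¹ • x, ⟨?_, ?_⟩, ?_⟩
    · intro i
      have := h1 i
      simp only [PiLp.smul_apply, smul_eq_mul]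
      positivity
    · calc ∑ i, (t⁻¹ • x) i ^ p = ∑ i, s⁻¹ * x i ^ p := by
            refine Finset.sum_congr rfl fun i _ => ?_
            simp only [PiLp.smul_apply, smul_eq_mul]
            rw [Real.mul_rpow (by positivity) (h1 i).le, Real.inv_rpow ht0.le, htp]
        _ = 1 := by rw [← Finset.mul_sum, ← hsd, inv_mul_cancel₀ hs.ne']
    · rw [smul_smul, mul_inv_cancel₀ ht0.ne', one_smul]
  exact ((hOo.measure_pos volume hOn).trans_le (measure_mono hsub)).ne'

lemma coneDelta_ne_top (p : ℝ) (hp : 0 < p) {n : ℕ} :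
    volume (coneE (DeltaE p n)) ≠ ∞ := by
  have : coneE (DeltaE p n) ⊆ Metric.closedBall 0 (√n) := by
    rintro _ ⟨t, ht, a, ha, rfl⟩
    have ha1 : ∀ i, |a i| ≤ 1 := by
      intro i
      rw [abs_of_nonneg (ha.1 i)]
      by_contra! h
      have h1 : 1 < a i ^ p := Real.one_lt_rpow h hp
      have h2 : a i ^ p ≤ ∑ j, a j ^ p :=
        Finset.single_le_sum (f := fun j => a j ^ p)
          (fun j _ => Real.rpow_nonneg (ha.1 j) _) (Finset.mem_univ i)
      rw [ha.2] at h2; linarith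
    rw [mem_closedBall_zero_iff, EuclideanSpace.norm_eq]
    apply Real.sqrt_le_sqrt
    calc _ ≤ ∑ i : Fin n, (1:ℝ) := by
          refine Finset.sum_le_sum fun i _ => ?_
          rw [Real.norm_eq_abs, PiLp.smul_apply, smul_eq_mul, abs_mul, abs_of_nonneg ht.1]
          have : t * |a i| ≤ 1 := mul_le_one₀ ht.2 (abs_nonneg _) (ha1 i)
          have h0 : 0 ≤ t * |a i| := mul_nonneg ht.1 (abs_nonneg _)
          exact pow_le_one₀ h0 this
      _ = n := by simp
  exact ((measure_mono this).trans_lt Metric.isBounded_closedBall.measure_lt_top).ne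

/-- The unnormalized density formula. -/
lemma main_density (p : ℝ) (hp : 0 < p) (n : ℕ) (hn : 2 ≤ n) (μ : Measure (EE n))
    (hμ : IsConeMeasureE p n μ) (A : Set (EE n)) (hA : MeasurableSet A) (hAD : A ⊆ DeltaE p n) :
    (μHE[n-1] : Measure (EE n)) A =
      (n * volume (coneE (DeltaE p n))) * ∫⁻ x in A, ENNReal.ofReal (gE p x) ∂μ := by
  set v := volume (coneE (DeltaE p n)) with hv
  have hv0 : v ≠ 0 := coneDelta_ne_zero p hp hn
  have hvt : v ≠ ∞ := coneDelta_ne_top p hp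
  have hμA : ∀ A : Set (EE n), MeasurableSet A → A ⊆ DeltaE p n →
      volume (coneE A) = v * μ A := by
    intro A h1 h2
    rw [hμ.2 A h1 h2, ENNReal.mul_div_cancel hv0 hvt]
  set S : Set (EE n) := {x | x ∈ DeltaE p n ∧ ∀ i, 0 < x i} with hS
  set m₂ : Measure (EE n) := ((n : ℝ≥0∞) * v) • μ.withDensity (fun x => ENNReal.ofReal (gE p x))
    with hm₂
  have hm₂A : ∀ A, MeasurableSet A →
      m₂ A = (n * v) * ∫⁻ x in A, ENNReal.ofReal (gE p x) ∂μ := by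
    intro A hA
    rw [hm₂, Measure.smul_apply, withDensity_apply _ hA, smul_eq_mul]
  have hloc : ∀ q : NNReal, 1 < q → ∀ x ∈ S, ∃ U : Set (EE n), IsOpen U ∧ x ∈ U ∧
      ∀ A, MeasurableSet A → A ⊆ S → A ⊆ U →
        (μHE[n-1] : Measure (EE n)) A ≤ (q : ℝ≥0∞) ^ (2*n) * m₂ A ∧
        m₂ A ≤ (q : ℝ≥0∞) ^ (2*n) * (μHE[n-1] : Measure (EE n)) A := by
    intro q hq x hx
    obtain ⟨U, hUo, hxU, h1, h2⟩ := delta_local p hp hn x hx.2 hx.1 q hq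
    refine ⟨U, hUo, hxU, fun A hA hAS hAU => ?_⟩
    have hAD : A ⊆ DeltaE p n := fun y hy => (hAS hy).1
    have hg0 := gE_pos p hn x hx.2
    have hnw := norm_wE p x hx.2
    have hw : wE p x ≠ 0 := by
      rw [← norm_pos_iff, hnw]; exact hg0
    obtain ⟨c1, c2⟩ := local_compare n hn (wE p x) hw A hA q hq
      (fun y hy => ⟨(h1 y (hAU hy)).1, (h1 y (hAU hy)).2.1⟩)
      (fun y hy z hz => (h2 y ⟨hAU hy, hAD hy⟩ z ⟨hAU hz, hAD hz⟩).1)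
      (fun y hy z hz => (h2 y ⟨hAU hy, hAD hy⟩ z ⟨hAU hz, hAD hz⟩).2)
    rw [hnw, hμA A hA hAD, ENNReal.ofReal_mul (by positivity), ENNReal.ofReal_natCast] at c1 c2
    rw [hm₂A A hA]
    have i1 : ∫⁻ x in A, ENNReal.ofReal (gE p x) ∂μ ≤ q * (ENNReal.ofReal (gE p x) * μ A) := by
      calc _ ≤ ∫⁻ _ in A, (q * ENNReal.ofReal (gE p x)) ∂μ := by
            refine setLIntegral_mono measurable_const fun y hy => ?_
            have := (h1 y (hAU hy)).2.2.1
            calc _ ≤ ENNReal.ofReal (q * gE p x) := ENNReal.ofReal_le_ofReal this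
              _ = _ := by rw [ENNReal.ofReal_mul (by positivity), ENNReal.ofReal_coe_nnreal]
        _ = _ := by rw [setLIntegral_const, mul_assoc]
    have i2 : ENNReal.ofReal (gE p x) * μ A ≤ q * ∫⁻ x in A, ENNReal.ofReal (gE p x) ∂μ := by
      have hgm : Measurable (fun y : EE n => ENNReal.ofReal (gE p y)) :=
        (meas_gE p n).ennreal_ofReal
      rw [← lintegral_const_mul _ hgm, ← setLIntegral_const]
      refine setLIntegral_mono (hgm.const_mul _) fun y hy => ?_
      have := (h1 y (hAU hy)).2.2.2
      calc _ ≤ ENNReal.ofReal (q * gE p y) := ENNReal.ofReal_le_ofReal this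
        _ = _ := by rw [ENNReal.ofReal_mul (by positivity), ENNReal.ofReal_coe_nnreal]
    have hN : (q : ℝ≥0∞) ^ (2 * n) = q ^ (2 * n - 1) * q := by
      rw [← pow_succ]; congr 1; omega
    rw [hN]
    constructor
    · calc _ ≤ _ := c1
        _ = (q : ℝ≥0∞) ^ (2 * n - 1) * ((n * v) * (ENNReal.ofReal (gE p x) * μ A)) := by ring
        _ ≤ (q : ℝ≥0∞) ^ (2 * n - 1) *
            ((n * v) * (q * ∫⁻ x in A, ENNReal.ofReal (gE p x) ∂μ)) := by gcongr
        _ = _ := by ring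
    · calc _ ≤ (n * v) * (q * (ENNReal.ofReal (gE p x) * μ A)) := by gcongr
        _ = q * (n * ENNReal.ofReal (gE p x) * (v * μ A)) := by ring
        _ ≤ q * (q ^ (2 * n - 1) * (μHE[n-1] : Measure (EE n)) A) := by gcongr
        _ = _ := by ring
  have hSm : MeasurableSet S := by
    have : S = DeltaE p n ∩ ⋂ i, {x : EE n | 0 < x i} := by
      ext x; simp [hS]
    rw [this]
    exact (meas_Delta p n).inter
      (MeasurableSet.iInter fun i => measurableSet_lt measurable_const (meas_coord i))
  have heq : ∀ A, MeasurableSet A → A ⊆ S → (μHE[n-1] : Measure (EE n)) A = m₂ A := by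
    intro A hA hAS
    apply le_antisymm
    · refine measure_le_of_local _ _ S (2*n) (fun q hq x hx => ?_) A hA hAS
      obtain ⟨U, h1, h2, h3⟩ := hloc q hq x hx
      exact ⟨U, h1, h2, fun A a b c => (h3 A a b c).1⟩
    · refine measure_le_of_local _ _ S (2*n) (fun q hq x hx => ?_) A hA hAS
      obtain ⟨U, h1, h2, h3⟩ := hloc q hq x hx
      exact ⟨U, h1, h2, fun A a b c => (h3 A a b c).2⟩
  -- the boundary is null
  have hsub : DeltaE p n \ S ⊆ ⋃ i : Fin n, {x ∈ DeltaE p n | x i = 0} := by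
    rintro x ⟨hx, hxS⟩
    have : ¬ ∀ i, 0 < x i := fun h => hxS ⟨hx, h⟩
    push Not at this
    obtain ⟨i, hi⟩ := this
    exact mem_iUnion.2 ⟨i, hx, le_antisymm hi (hx.1 i)⟩
  have hb1 : (μHE[n-1] : Measure (EE n)) (DeltaE p n \ S) = 0 :=
    measure_mono_null hsub (measure_iUnion_null fun i => boundary_H p hp hn i)
  have hb2 : μ (DeltaE p n \ S) = 0 := by
    refine measure_mono_null hsub (measure_iUnion_null fun i => ?_)
    have hm : MeasurableSet {x : EE n | x ∈ DeltaE p n ∧ x i = 0} :=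
      (meas_Delta p n).inter ((meas_coord i) (measurableSet_singleton 0))
    have h1 := hμ.2 {x : EE n | x ∈ DeltaE p n ∧ x i = 0} hm (fun x hx => hx.1)
    rw [boundary_cone, ENNReal.zero_div] at h1
    exact h1
  have hb3 : m₂ (DeltaE p n \ S) = 0 := by
    rw [hm₂, Measure.smul_apply, withDensity_absolutelyContinuous _ _ hb2, smul_zero]
  have hnull : ∀ m : Measure (EE n), m (DeltaE p n \ S) = 0 → m A = m (A ∩ S) := by
    intro m hm
    have h0 : m (A \ S) = 0 := measure_mono_null (sdiff_subset_sdiff_left hAD) hm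
    rw [← measure_inter_add_sdiff A hSm, h0, add_zero]
  rw [← hm₂A A hA, hnull _ hb1, hnull _ hb3]
  exact heq _ (hA.inter hSm) inter_subset_right

/-- For `0 < p < ∞` and `n ≥ 2`, the normalized surface measure `ρ_p` on `Δ_p^n` is absolutely
continuous with respect to the normalized cone measure `μ_p`, with density
`dρ_p/dμ_p (x) = c_{p,n}^{-1} (∑_i x_i^{2p-2})^{1/2}`, i.e. for every Borel `A ⊆ Δ_p^n`,
`ρ_p(A) = (∫_A (∑_i x_i^{2p-2})^{1/2} dμ_p) / (∫_{Δ_p^n} (∑_i x_i^{2p-2})^{1/2} dμ_p)`. -/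
theorem surface_measure_density_wrt_cone (p : ℝ) (hp : 0 < p) (n : ℕ) (hn : 2 ≤ n)
    (μ ρ : Measure (EuclideanSpace ℝ (Fin n)))
    (hμ : IsConeMeasureE p n μ) (hρ : IsSurfaceMeasureE p n ρ) :
    ρ ≪ μ ∧
    ∀ A : Set (EuclideanSpace ℝ (Fin n)), MeasurableSet A → A ⊆ DeltaE p n →
      ρ A = (∫⁻ x in A, ENNReal.ofReal ((∑ i, x i ^ (2 * p - 2)) ^ ((1 : ℝ) / 2)) ∂μ)
              / ∫⁻ x, ENNReal.ofReal ((∑ i, x i ^ (2 * p - 2)) ^ ((1 : ℝ) / 2)) ∂μ := by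
  obtain ⟨c, hc0, hct, hc⟩ : ∃ c : ℝ≥0∞, c ≠ 0 ∧ c ≠ ∞ ∧
      ∀ A : Set (EuclideanSpace ℝ (Fin n)), MeasurableSet A → A ⊆ DeltaE p n →
        (μH[(n : ℝ) - 1] : Measure (EuclideanSpace ℝ (Fin n))) A =
          c * ∫⁻ x in A, ENNReal.ofReal (gE p x) ∂μ := by
    set k : NNReal := Measure.addHaarScalarFactor
      (volume : Measure (EuclideanSpace ℝ (Fin (n-1)))) μH[(n-1 : ℕ)] with hk
    have hk0 : k ≠ 0 := Measure.addHaarScalarFactor_volume_hausdorffMeasure_ne_zero (n-1)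
    have hk0' : (k : ℝ≥0∞) ≠ 0 := by simpa using hk0
    have hcast : (((n - 1 : ℕ)) : ℝ) = (n : ℝ) - 1 := by
      rw [Nat.cast_sub (by omega)]; simp
    refine ⟨(k : ℝ≥0∞)⁻¹ * (n * volume (coneE (DeltaE p n))), ?_, ?_, ?_⟩
    · refine mul_ne_zero (by simp) (mul_ne_zero ?_ (coneDelta_ne_zero p hp hn))
      simp; omega
    · exact ENNReal.mul_ne_top (ENNReal.inv_ne_top.2 hk0')
        (ENNReal.mul_ne_top (by simp) (coneDelta_ne_top p hp))
    · intro A hA hAD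
      have h := main_density p hp n hn μ hμ A hA hAD
      rw [Measure.euclideanHausdorffMeasure_def, Measure.smul_apply, ENNReal.smul_def,
        smul_eq_mul, ← hk, hcast] at h
      rw [mul_assoc, ← h, ← mul_assoc, ENNReal.inv_mul_cancel hk0' ENNReal.coe_ne_top, one_mul]
  have hprob : IsProbabilityMeasure μ := hμ.1
  have hDm := meas_Delta p n
  have hDc : μ (DeltaE p n)ᶜ = 0 := by
    rw [prob_compl_eq_zero_iff hDm, hμ.2 _ hDm subset_rfl]
    exact ENNReal.div_self (coneDelta_ne_zero p hp hn) (coneDelta_ne_top p hp)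
  have hfull : ∫⁻ x, ENNReal.ofReal (gE p x) ∂μ
      = ∫⁻ x in DeltaE p n, ENNReal.ofReal (gE p x) ∂μ := by
    rw [← lintegral_add_compl _ hDm, setLIntegral_measure_zero _ _ hDc, add_zero]
  have hρ' : ρ = (μH[(n : ℝ) - 1] (DeltaE p n))⁻¹ • (μH[(n : ℝ) - 1]).restrict (DeltaE p n) := hρ
  constructor
  · refine Measure.AbsolutelyContinuous.mk fun s hs h0 => ?_
    rw [hρ', Measure.smul_apply, Measure.restrict_apply hs,
      hc _ (hs.inter hDm) inter_subset_right,
      setLIntegral_measure_zero _ _ (measure_mono_null inter_subset_left h0)]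
    simp
  · intro A hA hAD
    change ρ A = (∫⁻ x in A, ENNReal.ofReal (gE p x) ∂μ) / ∫⁻ x, ENNReal.ofReal (gE p x) ∂μ
    rw [hfull, hρ', Measure.smul_apply, Measure.restrict_apply hA, inter_eq_left.2 hAD,
      hc _ hA hAD, hc _ hDm subset_rfl, smul_eq_mul, mul_comm, ← div_eq_mul_inv,
      ENNReal.mul_div_mul_left _ _ hc0 hct]

end
end

section
/- Let 0<p<∞. There exist two positive real numbers C_p^1 and C_p^2 depending only on p such that for all n ≥ 2: σ_0^{p,∞}(ρ_p) = ∫_{Δ_p^n} x_1* dρ_p(x) = (∫_{Δ_p^n} x_1* (Σ_{i=1}^n x_i^{2p−2})^{1/2} dμ_p(x)) / (∫_{Δ_p^n} (Σ_{i=1}^n x_i^{2p−2})^{1/2} dμ_p(x)), and moreover C_p^1 · R · n^{−1/p} ≤ σ_0^{p,∞}(ρ_p) ≤ C_p^2 · R · n^{−1/p}, where R = E[ω_1* (Σ_{i=1}^n ω_i^{2p−2})^{1/2}] / E[(Σ_{i=1}^n ω_i^{2p−2})^{1/2}]. -/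
open MeasureTheory Real Set
open scoped ENNReal

noncomputable section

namespace SZW

theorem lintegral_pi_prod (n : ℕ) (μ : Measure ℝ) [SigmaFinite μ] (f : Fin n → ℝ → ℝ≥0∞)
    (hf : ∀ i, Measurable (f i)) :
    ∫⁻ x, ∏ i, f i (x i) ∂(Measure.pi fun _ : Fin n => μ) = ∏ i, ∫⁻ t, f i t ∂μ := by
  induction n with
  | zero => simp
  | succ n ih =>
    have h := (measurePreserving_piFinSuccAbove (fun _ : Fin (n+1) => μ) 0)
    rw [← h.symm.lintegral_comp_emb (MeasurableEquiv.measurableEmbedding _)]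
    simp only [Fin.prod_univ_succ, MeasurableEquiv.piFinSuccAbove_symm_apply, Fin.insertNthEquiv_zero,
      Fin.consEquiv_apply, Fin.cons_zero, Fin.cons_succ]
    rw [lintegral_prod_mul (f := fun a => f 0 a) (g := fun y : Fin n → ℝ => ∏ i, f i.succ (y i)) (hf 0).aemeasurable]
    · congr 1
      exact ih (fun i => f i.succ) (fun i => hf _)
    · exact (Finset.measurable_prod _ fun i _ => (hf _).comp (measurable_pi_apply i)).aemeasurable

theorem pi_withDensity (n : ℕ) (μ : Measure ℝ) [SigmaFinite μ] (f : ℝ → ℝ≥0∞)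
    (hf : Measurable f) [SigmaFinite (μ.withDensity f)] :
    (Measure.pi fun _ : Fin n => μ.withDensity f) =
      (Measure.pi fun _ : Fin n => μ).withDensity fun x => ∏ i, f (x i) := by
  refine (Measure.pi_eq fun s hs => ?_)
  rw [withDensity_apply _ (MeasurableSet.univ_pi hs), ← lintegral_indicator (MeasurableSet.univ_pi hs)]
  have : ∀ x : Fin n → ℝ, (univ.pi s).indicator (fun x => ∏ i, f (x i)) x
      = ∏ i, (s i).indicator f (x i) := by
    intro x
    by_cases hx : x ∈ univ.pi s
    · rw [indicator_of_mem hx]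
      refine Finset.prod_congr rfl fun i _ => ?_
      rw [indicator_of_mem (hx i (mem_univ i))]
    · rw [indicator_of_notMem hx]
      simp only [mem_pi, mem_univ, true_implies, not_forall] at hx
      obtain ⟨i, hi⟩ := hx
      exact (Finset.prod_eq_zero (Finset.mem_univ i) (indicator_of_notMem hi _)).symm
  simp_rw [this]
  rw [lintegral_pi_prod n μ _ (fun i => hf.indicator (hs i))]
  refine Finset.prod_congr rfl fun i _ => ?_
  rw [lintegral_indicator (hs i), withDensity_apply _ (hs i)]

theorem gamma_bounds (p : ℝ) (hp : 0 < p) (n : ℕ) (hn : 2 ≤ n) :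
    ((1/p+1) : ℝ) ^ (-(1/p)) * (n:ℝ) ^ (-(1/p)) ≤
      Gamma ((n-1)/p+1) / Gamma (n/p+1) ∧
    Gamma ((n-1)/p+1) / Gamma (n/p+1) ≤ ((1/p)/2) ^ (-(1/p)) * (n:ℝ) ^ (-(1/p)) := by
  set a := 1/p with ha
  have ha0 : 0 < a := by positivity
  have hn' : (2:ℝ) ≤ n := by exact_mod_cast hn
  have e1 : ((n:ℝ)-1)/p+1 = n*a - a + 1 := by rw [ha]; ring
  have e2 : (n:ℝ)/p+1 = n*a+1 := by rw [ha]; ring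
  rw [e1, e2]
  have hna : 2 * a ≤ n * a := by gcongr
  set y := n*a - a + 1 with hy
  set x := n*a+1 with hx
  have hy1 : 0 < y - 1 := by rw [hy]; linarith
  have hy0 : 0 < y := by linarith
  have hxy : x - y = a := by rw [hx, hy]; ring
  have hyx : y < x := by linarith
  have hx0 : 0 < x := by linarith
  have gx := Gamma_pos_of_pos hx0
  have gy := Gamma_pos_of_pos hy0
  have s1 := convexOn_log_Gamma.slope_mono_adjacent (x := y) (y := x) (z := x+1) hy0
    (show (0:ℝ) < x+1 by linarith) hyx (by linarith)
  have s2 := convexOn_log_Gamma.slope_mono_adjacent (x := y-1) (y := y) (z := x) hy1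
    (show (0:ℝ) < x by linarith) (by linarith) hyx
  simp only [Function.comp] at s1 s2
  have h3 : log (Gamma (x+1)) = log x + log (Gamma x) := by
    rw [Gamma_add_one hx0.ne', log_mul hx0.ne' gx.ne']
  have h4 : log (Gamma y) = log (y-1) + log (Gamma (y-1)) := by
    have := Gamma_add_one hy1.ne'
    rw [sub_add_cancel] at this
    rw [this, log_mul hy1.ne' (Gamma_pos_of_pos hy1).ne']
  rw [hxy] at s1 s2
  have t1 : (log (Gamma x) - log (Gamma y)) ≤ a * log x := by
    have : x + 1 - x = 1 := by ring
    rw [this, h3, div_le_iff₀ ha0] at s1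
    linarith
  have t2 : a * log (y-1) ≤ (log (Gamma x) - log (Gamma y)) := by
    have : y - (y - 1) = 1 := by ring
    rw [this, h4, le_div_iff₀ ha0] at s2
    linarith
  have key : Gamma y / Gamma x = exp (log (Gamma y) - log (Gamma x)) := by
    rw [exp_sub, exp_log gx, exp_log gy]
  have q1 : x ^ (-a) ≤ Gamma y / Gamma x := by
    rw [key, rpow_def_of_pos hx0]; apply exp_le_exp.2; linarith
  have q2 : Gamma y / Gamma x ≤ (y-1) ^ (-a) := by
    rw [key, rpow_def_of_pos hy1]; apply exp_le_exp.2; linarith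
  constructor
  · refine le_trans ?_ q1
    rw [← mul_rpow (by positivity) (by positivity)]
    apply rpow_le_rpow_of_nonpos hx0 _ (by linarith)
    rw [hx]; nlinarith
  · refine q2.trans ?_
    rw [← mul_rpow (by positivity) (by positivity)]
    apply rpow_le_rpow_of_nonpos (by positivity) _ (by linarith)
    rw [hy]; nlinarith
end SZW

namespace SZW
open scoped Pointwise

/-- open positive orthant -/
def Ort (n : ℕ) : Set (EuclideanSpace ℝ (Fin n)) := {x | ∀ i, 0 < x i}

/-- the `p`-gauge -/
def gau (p : ℝ) {n : ℕ} (x : EuclideanSpace ℝ (Fin n)) : ℝ := (∑ i, x i ^ p) ^ (1 / p)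

/-- radial projection to the unit `p`-sphere -/
def nrm (p : ℝ) {n : ℕ} (x : EuclideanSpace ℝ (Fin n)) : EuclideanSpace ℝ (Fin n) :=
  (gau p x)⁻¹ • x

theorem isOpen_Ort (n : ℕ) : IsOpen (Ort n) := by
  have : Ort n = ⋂ i, {x : EuclideanSpace ℝ (Fin n) | 0 < x i} := by ext; simp [Ort]
  rw [this]
  exact isOpen_iInter_of_finite fun i => isOpen_lt continuous_const (by fun_prop)

theorem measurableSet_Ort (n : ℕ) : MeasurableSet (Ort n) := (isOpen_Ort n).measurableSet

theorem measurable_gau (p : ℝ) (n : ℕ) : Measurable (gau p : EuclideanSpace ℝ (Fin n) → ℝ) := by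
  unfold gau; fun_prop

theorem measurable_nrm (p : ℝ) (n : ℕ) :
    Measurable (nrm p : EuclideanSpace ℝ (Fin n) → EuclideanSpace ℝ (Fin n)) := by
  unfold nrm
  exact (measurable_gau p n).inv.smul measurable_id

theorem sum_pos_of_Ort {p : ℝ} {n : ℕ} (hn : 0 < n) {x : EuclideanSpace ℝ (Fin n)} (hx : x ∈ Ort n) :
    0 < ∑ i, x i ^ p := by
  have : Nonempty (Fin n) := ⟨⟨0, hn⟩⟩
  exact Finset.sum_pos (fun i _ => rpow_pos_of_pos (hx i) _) Finset.univ_nonempty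

theorem gau_pos {p : ℝ} {n : ℕ} (hn : 0 < n) {x : EuclideanSpace ℝ (Fin n)} (hx : x ∈ Ort n) :
    0 < gau p x := rpow_pos_of_pos (sum_pos_of_Ort hn hx) _

theorem gau_smul {p : ℝ} (hp : 0 < p) {n : ℕ} {x : EuclideanSpace ℝ (Fin n)} (hx : ∀ i, 0 ≤ x i)
    {s : ℝ} (hs : 0 ≤ s) : gau p (s • x) = s * gau p x := by
  unfold gau
  have : ∀ i, (s • x) i ^ p = s ^ p * x i ^ p := fun i => by
    simp [mul_rpow hs (hx i)]
  simp_rw [this, ← Finset.mul_sum]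
  rw [mul_rpow (by positivity) (Finset.sum_nonneg fun i _ => rpow_nonneg (hx i) _),
    ← rpow_mul hs, mul_one_div_cancel hp.ne', rpow_one]

theorem smul_mem_Ort {n : ℕ} {x : EuclideanSpace ℝ (Fin n)} (hx : x ∈ Ort n) {s : ℝ} (hs : 0 < s) :
    s • x ∈ Ort n := fun i => by simpa using mul_pos hs (hx i)

theorem nrm_smul {p : ℝ} (hp : 0 < p) {n : ℕ} {x : EuclideanSpace ℝ (Fin n)} (hx : ∀ i, 0 ≤ x i)
    {s : ℝ} (hs : 0 < s) : nrm p (s • x) = nrm p x := by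
  unfold nrm
  rw [gau_smul hp hx hs.le, smul_smul, mul_inv, mul_right_comm, inv_mul_cancel₀ hs.ne', one_mul]

theorem gau_smul_nrm {p : ℝ} {n : ℕ} (hn : 0 < n) {x : EuclideanSpace ℝ (Fin n)} (hx : x ∈ Ort n) :
    gau p x • nrm p x = x := by
  unfold nrm
  rw [smul_smul, mul_inv_cancel₀ (gau_pos hn hx).ne', one_smul]

theorem gau_of_Delta {p : ℝ} {n : ℕ} {x : EuclideanSpace ℝ (Fin n)} (hx : x ∈ DeltaE p n) :
    gau p x = 1 := by simp [gau, hx.2]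

theorem nrm_of_Delta {p : ℝ} {n : ℕ} {x : EuclideanSpace ℝ (Fin n)} (hx : x ∈ DeltaE p n) :
    nrm p x = x := by simp [nrm, gau_of_Delta hx]

theorem nrm_mem {p : ℝ} (hp : 0 < p) {n : ℕ} (hn : 0 < n) {x : EuclideanSpace ℝ (Fin n)}
    (hx : x ∈ Ort n) : nrm p x ∈ DeltaE p n ∩ Ort n := by
  have h2 : nrm p x ∈ Ort n := smul_mem_Ort hx (inv_pos.2 (gau_pos hn hx))
  refine ⟨⟨fun i => (h2 i).le, ?_⟩, h2⟩
  have h : gau p (nrm p x) = 1 := by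
    rw [nrm, gau_smul hp (fun i => (hx i).le) (inv_pos.2 (gau_pos hn hx)).le,
      inv_mul_cancel₀ (gau_pos hn hx).ne']
  unfold gau at h
  have h3 := congrArg (fun t : ℝ => t ^ p) h
  simp only [one_rpow] at h3
  rwa [← rpow_mul (sum_pos_of_Ort hn h2).le, one_div_mul_cancel hp.ne', rpow_one] at h3

/-- unnormalised cone measure -/
def mco (p : ℝ) (n : ℕ) : Measure (EuclideanSpace ℝ (Fin n)) :=
  (volume.restrict (Ort n ∩ {x | gau p x ≤ 1})).map (nrm p)

/-- radial measure -/
def tau (n : ℕ) : Measure ℝ :=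
  (volume.restrict (Ioi (0:ℝ))).withDensity fun s => ENNReal.ofReal (n * s ^ (n - 1))

theorem tau_Iic (n : ℕ) (hn : 0 < n) (s : ℝ) (hs : 0 ≤ s) : tau n (Iic s) = ENNReal.ofReal (s ^ n) := by
  rw [tau, withDensity_apply _ measurableSet_Iic, Measure.restrict_restrict measurableSet_Iic]
  have : Iic s ∩ Ioi 0 = Ioc 0 s := by ext; simp [and_comm]
  rw [this, ← ofReal_integral_eq_lintegral_ofReal, ← intervalIntegral.integral_of_le hs]
  · congr 1
    rw [intervalIntegral.integral_const_mul, integral_pow]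
    obtain ⟨m, rfl⟩ : ∃ m, n = m + 1 := ⟨n-1, by omega⟩
    simp
    field_simp
  · exact (Continuous.integrableOn_Icc (by fun_prop)).mono_set Ioc_subset_Icc_self
  · filter_upwards [ae_restrict_mem measurableSet_Ioc] with x hx
    have := hx.1
    positivity

theorem tau_Iic_nonpos (n : ℕ) (s : ℝ) (hs : s ≤ 0) : tau n (Iic s) = 0 := by
  rw [tau, withDensity_apply _ measurableSet_Iic, Measure.restrict_restrict measurableSet_Iic]
  have : Iic s ∩ Ioi 0 = ∅ := by
    ext x; simp only [mem_inter_iff, mem_Iic, mem_Ioi, mem_empty_iff_false, iff_false]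
    intro h; linarith
  rw [this]; simp

instance (n : ℕ) : SigmaFinite (tau n) := by unfold tau; exact SigmaFinite.withDensity_ofReal _

theorem gau_le_one_subset {p : ℝ} (hp : 0 < p) {n : ℕ} {x : EuclideanSpace ℝ (Fin n)}
    (hx : ∀ i, 0 ≤ x i) (h : gau p x ≤ 1) (i : Fin n) : x i ≤ 1 := by
  have h0 : 0 ≤ ∑ i, x i ^ p := Finset.sum_nonneg fun i _ => rpow_nonneg (hx i) _
  have h1 : ∑ i, x i ^ p ≤ 1 := by
    by_contra hc
    push Not at hc
    have := one_lt_rpow hc (show 0 < 1/p by positivity)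
    unfold gau at h; linarith
  have h2 : x i ^ p ≤ 1 :=
    (Finset.single_le_sum (f := fun i => x i ^ p) (fun i _ => rpow_nonneg (hx i) _) (Finset.mem_univ i)).trans h1
  by_contra hc
  push Not at hc
  have := one_lt_rpow hc hp
  linarith

theorem vol_lt_top {p : ℝ} (hp : 0 < p) (n : ℕ) :
    volume (Ort n ∩ {x | gau p x ≤ 1}) < ∞ := by
  refine lt_of_le_of_lt (measure_mono (t := Metric.closedBall 0 (Real.sqrt n)) ?_) measure_closedBall_lt_top
  rintro x ⟨hx, h⟩
  rw [mem_closedBall_zero_iff, EuclideanSpace.norm_eq]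
  apply Real.sqrt_le_sqrt
  calc ∑ i, ‖x i‖ ^ 2 ≤ ∑ i : Fin n, (1:ℝ) := by
        refine Finset.sum_le_sum fun i _ => ?_
        have h1 := gau_le_one_subset hp (fun i => (hx i).le) h i
        have h2 := hx i
        rw [Real.norm_of_nonneg h2.le]
        nlinarith
    _ = n := by simp

theorem finite_mco {p : ℝ} (hp : 0 < p) (n : ℕ) : IsFiniteMeasure (mco p n) := by
  have : IsFiniteMeasure ((volume : Measure (EuclideanSpace ℝ (Fin n))).restrict (Ort n ∩ {x | gau p x ≤ 1})) :=
    ⟨by simpa using vol_lt_top hp n⟩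
  unfold mco
  infer_instance

theorem polar {p : ℝ} (hp : 0 < p) {n : ℕ} (hn : 0 < n) :
    (volume.restrict (Ort n)).map (fun x => (nrm p x, gau p x)) = (mco p n).prod (tau n) := by
  have := finite_mco hp n
  have hmeas : Measurable (fun x : EuclideanSpace ℝ (Fin n) => (nrm p x, gau p x)) :=
    (measurable_nrm p n).prodMk (measurable_gau p n)
  symm
  refine Measure.prod_eq fun A S hA hS => ?_
  rw [Measure.map_apply hmeas (hA.prod hS), Measure.restrict_apply (hmeas (hA.prod hS))]
  set K := Ort n ∩ nrm p ⁻¹' A with hK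
  have hKm : MeasurableSet K := (measurableSet_Ort n).inter (measurable_nrm p n hA)
  have key : (volume.restrict K).map (gau p) = (mco p n A) • tau n := by
    have hscale : ∀ s : ℝ, 0 < s → volume (gau p ⁻¹' Iic s ∩ K) = ENNReal.ofReal (s ^ n) * mco p n A := by
      intro s hs
      have hm : mco p n A = volume (gau p ⁻¹' Iic 1 ∩ K) := by
        rw [mco, Measure.map_apply (measurable_nrm p n) hA, Measure.restrict_apply (measurable_nrm p n hA)]
        congr 1; ext x; simp only [hK, mem_inter_iff, mem_preimage, mem_ofPred_eq, mem_Iic]; tauto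
      have hset : gau p ⁻¹' Iic s ∩ K = s • (gau p ⁻¹' Iic 1 ∩ K) := by
        ext x
        rw [Set.mem_smul_set_iff_inv_smul_mem₀ hs.ne']
        simp only [hK, mem_inter_iff, mem_preimage, mem_Iic]
        have hO : s⁻¹ • x ∈ Ort n ↔ x ∈ Ort n :=
          ⟨fun h => by simpa [smul_smul, hs.ne'] using smul_mem_Ort h hs, fun h => smul_mem_Ort h (inv_pos.2 hs)⟩
        rw [hO]
        by_cases hx : x ∈ Ort n
        · have hx' : ∀ i, 0 ≤ x i := fun i => (hx i).le
          rw [gau_smul hp hx' (inv_pos.2 hs).le, nrm_smul hp hx' (inv_pos.2 hs), inv_mul_le_iff₀ hs, mul_one]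
        · simp [hx]
      rw [hset, Measure.addHaar_smul, hm, finrank_euclideanSpace_fin, abs_of_pos (by positivity)]
    have hval : ∀ s : ℝ, ((volume.restrict K).map (gau p)) (Iic s) = ((mco p n A) • tau n) (Iic s) := by
      intro s
      rw [Measure.map_apply (measurable_gau p n) measurableSet_Iic,
        Measure.restrict_apply (measurable_gau p n measurableSet_Iic), Measure.smul_apply, smul_eq_mul]
      rcases le_or_gt s 0 with hs | hs
      · rw [tau_Iic_nonpos n s hs, mul_zero]
        have : gau p ⁻¹' Iic s ∩ K = ∅ := by
          ext x
          simp only [hK, mem_inter_iff, mem_preimage, mem_Iic, mem_empty_iff_false, iff_false]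
          rintro ⟨h1, h2, -⟩
          have := gau_pos (p := p) hn h2
          linarith
        rw [this]; simp
      · rw [hscale s hs, tau_Iic n hn s hs.le, mul_comm]
    refine Measure.ext_of_generateFrom_of_iUnion (range Iic) (fun k : ℕ => Iic (k:ℝ))
      (BorelSpace.measurable_eq.trans (borel_eq_generateFrom_Iic ℝ)) isPiSystem_Iic ?_ ?_ ?_ ?_
    · ext x; simp only [mem_iUnion, mem_Iic, mem_univ, iff_true]; exact exists_nat_ge x
    · intro k; exact ⟨_, rfl⟩
    · intro k
      rw [hval, Measure.smul_apply, smul_eq_mul, tau_Iic n hn _ (by positivity)]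
      exact ENNReal.mul_ne_top (measure_ne_top _ _) ENNReal.ofReal_ne_top
    · rintro _ ⟨s, rfl⟩; exact hval s
  have := congrArg (fun ν : Measure ℝ => ν S) key
  simp only [Measure.smul_apply, smul_eq_mul] at this
  rw [← this, Measure.map_apply (measurable_gau p n) hS, Measure.restrict_apply (measurable_gau p n hS)]
  congr 1; ext x; simp only [hK, mem_inter_iff, mem_preimage, mem_prod]; tauto
end SZW

namespace SZW
open scoped Pointwise

theorem kthMax_eq_norm {n : ℕ} (hn : 0 < n) (x : Fin n → ℝ) : kthMax x 1 = ‖x‖ := by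
  have : Nonempty (Fin n) := ⟨⟨0, hn⟩⟩
  obtain ⟨j, hj⟩ := Finite.exists_max (fun i => |x i|)
  refine IsGreatest.csSup_eq ⟨⟨{j}, by simp, ?_⟩, ?_⟩
  · intro i hi
    rw [Finset.mem_singleton.1 hi]
    exact (pi_norm_le_iff_of_nonneg (abs_nonneg _)).2 hj
  · rintro t ⟨S, hS, h⟩
    obtain ⟨i, hi⟩ := Finset.card_pos.1 hS
    exact (h i hi).trans (norm_le_pi_norm x i)

instance (p : ℝ) : SigmaFinite (expMeasure p) := by
  unfold expMeasure; exact SigmaFinite.withDensity_ofReal _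

theorem lintegral_iid {p : ℝ} (hp : 0 < p) {n : ℕ} (hn : 0 < n) (k : ℝ) (hk : -1 < n + k - 1)
    (f : EuclideanSpace ℝ (Fin n) → ℝ≥0∞) (hf : Measurable f)
    (hom : ∀ s : ℝ, 0 < s → ∀ x ∈ Ort n, f (s • x) = ENNReal.ofReal (s ^ k) * f x) :
    ∫⁻ ω, f (WithLp.toLp 2 ω) ∂(iidExp p n) =
      ENNReal.ofReal (p / Gamma (1/p)) ^ n *
        (ENNReal.ofReal (n * ((1/p) * Gamma ((n + k)/p))) * ∫⁻ x, f x ∂(mco p n)) := by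
  have := finite_mco hp n
  set c := p / Gamma (1/p) with hc
  have hc0 : 0 < c := div_pos hp (Gamma_pos_of_pos (by positivity))
  set d : ℝ → ℝ≥0∞ := fun t => ENNReal.ofReal (c * exp (-(t ^ p))) with hd
  have hdm : Measurable d := by rw [hd]; fun_prop
  have h1 : iidExp p n = (volume.restrict (univ.pi fun _ : Fin n => Ioi (0:ℝ))).withDensity
      fun x => ∏ i, d (x i) := by
    have : SigmaFinite ((volume.restrict (Ioi (0:ℝ))).withDensity d) :=
      SigmaFinite.withDensity_ofReal _
    rw [iidExp, volume_pi, Measure.restrict_pi_pi, ← pi_withDensity n _ d hdm]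
    rfl
  have hdm2 : Measurable (fun x : Fin n → ℝ => ∏ i, d (x i)) :=
    Finset.measurable_prod _ fun i _ => hdm.comp (measurable_pi_apply i)
  have hdm3 : Measurable (fun x : EuclideanSpace ℝ (Fin n) => ∏ i, d (x i)) := by
    refine Finset.measurable_prod _ fun i _ => hdm.comp (by fun_prop)
  rw [h1, lintegral_withDensity_eq_lintegral_mul _ hdm2
    (show Measurable (fun ω : Fin n → ℝ => f (WithLp.toLp 2 ω)) from hf.comp (by fun_prop))]
  have hpre : (univ.pi fun _ : Fin n => Ioi (0:ℝ)) = WithLp.toLp 2 ⁻¹' (Ort n) := by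
    ext x; simp [Ort]
  have h2 := (PiLp.volume_preserving_toLp (Fin n)).setLIntegral_comp_preimage (measurableSet_Ort n)
    (hdm3.mul hf)
  rw [hpre]
  refine Eq.trans h2 ?_
  set G : EuclideanSpace ℝ (Fin n) × ℝ → ℝ≥0∞ :=
    fun z => (ENNReal.ofReal c ^ n * f z.1) * ENNReal.ofReal (z.2 ^ k * exp (-(z.2 ^ p))) with hG
  have hGm : Measurable G := by
    rw [hG]
    exact ((hf.comp measurable_fst).const_mul _).mul (by fun_prop)
  have hmeas : Measurable (fun x : EuclideanSpace ℝ (Fin n) => (nrm p x, gau p x)) :=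
    (measurable_nrm p n).prodMk (measurable_gau p n)
  have h3 : ∫⁻ x in Ort n, (∏ i, d (x i)) * f x = ∫⁻ x in Ort n, G (nrm p x, gau p x) := by
    refine setLIntegral_congr_fun (measurableSet_Ort n) fun x hx => ?_
    have e1 : f x = ENNReal.ofReal (gau p x ^ k) * f (nrm p x) := by
      conv_lhs => rw [← gau_smul_nrm (p := p) hn hx]
      exact hom _ (gau_pos hn hx) _ (nrm_mem hp hn hx).2
    have e2 : ∏ i, d (x i) = ENNReal.ofReal c ^ n * ENNReal.ofReal (exp (-(gau p x ^ p))) := by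
      simp only [hd, ENNReal.ofReal_mul hc0.le, Finset.prod_mul_distrib, Finset.prod_const,
        Finset.card_univ, Fintype.card_fin]
      rw [← ENNReal.ofReal_prod_of_nonneg (fun i _ => (exp_pos _).le), ← exp_sum,
        Finset.sum_neg_distrib]
      congr 4
      rw [gau, ← rpow_mul (sum_pos_of_Ort hn hx).le, one_div_mul_cancel hp.ne', rpow_one]
    simp only [hG]
    rw [e1, e2, ENNReal.ofReal_mul (rpow_nonneg (gau_pos hn hx).le _)]
    ring
  refine Eq.trans h3 ?_
  rw [← lintegral_map (f := G) (g := fun x => (nrm p x, gau p x)) hGm hmeas, polar hp hn]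
  refine (lintegral_prod_mul (f := fun x => ENNReal.ofReal c ^ n * f x)
    (g := fun s : ℝ => ENNReal.ofReal (s ^ k * exp (-(s ^ p))))
    (hf.const_mul _).aemeasurable (by fun_prop)).trans ?_
  rw [lintegral_const_mul _ hf, mul_assoc]
  congr 1
  rw [mul_comm]
  congr 1
  rw [tau, lintegral_withDensity_eq_lintegral_mul _ (by fun_prop) (by fun_prop)]
  have hI := integral_rpow_mul_exp_neg_rpow (q := n + k - 1) hp hk
  rw [sub_add_cancel] at hI
  rw [← hI,
    ENNReal.ofReal_mul (by positivity), ofReal_integral_eq_lintegral_ofReal,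
    ← lintegral_const_mul _ (by fun_prop)]
  · refine setLIntegral_congr_fun measurableSet_Ioi fun s hs => ?_
    have hs : 0 < s := hs
    simp only [Pi.mul_apply]
    rw [← ENNReal.ofReal_mul (by positivity), ← ENNReal.ofReal_mul (by positivity)]
    congr 1
    have : s ^ ((n:ℝ) + k - 1) = s ^ (n-1) * s ^ k := by
      rw [← rpow_natCast, ← rpow_add hs, Nat.cast_sub (by omega)]
      congr 1; push_cast; ring
    rw [this]; ring
  · exact integrableOn_rpow_mul_exp_neg_rpow hk hp
  · filter_upwards [ae_restrict_mem measurableSet_Ioi] with x hx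
    have : 0 < x := hx
    positivity

theorem measurableSet_Delta (p : ℝ) (n : ℕ) : MeasurableSet (DeltaE p n) := by
  unfold DeltaE
  have h1 : MeasurableSet {t : EuclideanSpace ℝ (Fin n) | ∀ i, 0 ≤ t i} := by
    have : {t : EuclideanSpace ℝ (Fin n) | ∀ i, 0 ≤ t i} = ⋂ i, {t | 0 ≤ t i} := by ext; simp
    rw [this]
    exact MeasurableSet.iInter fun i => measurableSet_le measurable_const (by fun_prop)
  exact h1.inter (measurableSet_eq_fun (by fun_prop) measurable_const)

theorem coord_null {n : ℕ} (i : Fin n) : volume {x : EuclideanSpace ℝ (Fin n) | x i = 0} = 0 := by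
  have h := (PiLp.volume_preserving_ofLp (Fin n)).measure_preimage
    (s := {x : Fin n → ℝ | x i = 0}) (measurableSet_eq_fun (by fun_prop) (by fun_prop)).nullMeasurableSet
  refine h.trans ?_
  rw [volume_pi]
  exact Measure.pi_hyperplane _ i 0

theorem coords_null (n : ℕ) : ∀ᵐ x : EuclideanSpace ℝ (Fin n), ∀ i, x i ≠ 0 := by
  rw [ae_all_iff]
  intro i
  rw [ae_iff]
  simpa using coord_null i

theorem mco_apply (p : ℝ) {n : ℕ} {A : Set (EuclideanSpace ℝ (Fin n))} (hA : MeasurableSet A) :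
    mco p n A = volume (nrm p ⁻¹' A ∩ (Ort n ∩ {x | gau p x ≤ 1})) := by
  rw [mco, Measure.map_apply (measurable_nrm p n) hA, Measure.restrict_apply (measurable_nrm p n hA)]

theorem vol_cone {p : ℝ} (hp : 0 < p) {n : ℕ} (hn : 0 < n) {A : Set (EuclideanSpace ℝ (Fin n))}
    (hA : MeasurableSet A) (hAD : A ⊆ DeltaE p n) : volume (coneE A) = mco p n A := by
  rw [mco_apply p hA]
  apply measure_congr
  filter_upwards [coords_null n] with x hx
  apply propext
  constructor
  · rintro ⟨t, ht, a, ha, rfl⟩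
    have ht0 : 0 < t := by
      refine lt_of_le_of_ne ht.1 fun h => hx ⟨0, hn⟩ ?_
      simp [← h]
    have haD := hAD ha
    have ha0 : ∀ i, 0 < a i := fun i => lt_of_le_of_ne (haD.1 i) fun h => hx i (by simp [← h])
    refine ⟨?_, smul_mem_Ort ha0 ht0, ?_⟩
    · change nrm p (t • a) ∈ A
      rwa [nrm_smul hp haD.1 ht0, nrm_of_Delta haD]
    · change gau p (t • a) ≤ 1
      rw [gau_smul hp haD.1 ht0.le, gau_of_Delta haD, mul_one]; exact ht.2
  · rintro ⟨h1, h2, h3⟩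
    exact ⟨gau p x, ⟨(gau_pos hn h2).le, h3⟩, nrm p x, h1, (gau_smul_nrm hn h2).symm⟩

theorem mco_compl {p : ℝ} (hp : 0 < p) {n : ℕ} (hn : 0 < n) :
    mco p n (DeltaE p n ∩ Ort n)ᶜ = 0 := by
  rw [mco_apply p ((measurableSet_Delta p n).inter (measurableSet_Ort n)).compl]
  convert measure_empty (μ := volume) using 2
  ext x
  simp only [mem_inter_iff, mem_preimage, mem_compl_iff, mem_empty_iff_false, iff_false]
  rintro ⟨h1, h2, -⟩
  exact h1 (nrm_mem hp hn h2)

theorem mco_univ_ne_zero {p : ℝ} (hp : 0 < p) {n : ℕ} (hn : 0 < n) : mco p n univ ≠ 0 := by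
  intro h0
  have := finite_mco hp n
  have h := congrArg (fun ν => ν univ) (polar (n := n) hp hn)
  have hmeas : Measurable (fun x : EuclideanSpace ℝ (Fin n) => (nrm p x, gau p x)) :=
    (measurable_nrm p n).prodMk (measurable_gau p n)
  simp only [← univ_prod_univ, Measure.prod_prod, h0, zero_mul] at h
  rw [univ_prod_univ, Measure.map_apply hmeas MeasurableSet.univ, preimage_univ, Measure.restrict_apply_univ] at h
  refine (isOpen_Ort n).measure_ne_zero volume ⟨WithLp.toLp 2 fun _ => 1, fun i => ?_⟩ h
  simp

theorem cone_measure_eq {p : ℝ} (hp : 0 < p) {n : ℕ} (hn : 0 < n)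
    {μ : Measure (EuclideanSpace ℝ (Fin n))} (h : IsConeMeasureE p n μ) :
    ∃ v : ℝ≥0∞, v ≠ 0 ∧ v ≠ ∞ ∧ μ = v • mco p n := by
  have := finite_mco hp n
  obtain ⟨hP, hμ⟩ := h
  have hD := measurableSet_Delta p n
  have hmD : mco p n (DeltaE p n)ᶜ = 0 :=
    measure_mono_null (compl_subset_compl.2 inter_subset_left) (mco_compl hp hn)
  have hV : volume (coneE (DeltaE p n)) = mco p n univ := by
    rw [vol_cone hp hn hD subset_rfl, ← measure_add_measure_compl hD, hmD, add_zero]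
  have hV0 := mco_univ_ne_zero hp hn
  refine ⟨(mco p n univ)⁻¹, by simp, by simpa using hV0, ?_⟩
  have hμD : μ (DeltaE p n)ᶜ = 0 := by
    rw [prob_compl_eq_zero_iff hD, hμ _ hD subset_rfl, hV, ENNReal.div_self hV0 (by simp)]
  ext S hS
  have e1 : μ S = μ (S ∩ DeltaE p n) := (measure_inter_conull' (measure_mono_null (by intro x hx; exact hx.2) hμD)).symm
  have e2 : mco p n S = mco p n (S ∩ DeltaE p n) := (measure_inter_conull' (measure_mono_null (by intro x hx; exact hx.2) hmD)).symm
  rw [e1, hμ _ (hS.inter hD) inter_subset_right, hV, vol_cone hp hn (hS.inter hD) inter_subset_right,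
    Measure.smul_apply, e2, smul_eq_mul, ENNReal.div_eq_inv_mul]

theorem vol_Delta {p : ℝ} (hp : 0 < p) {n : ℕ} (hn : 0 < n) : volume (DeltaE p n) = 0 := by
  have := finite_mco hp n
  have hmeas : Measurable (fun x : EuclideanSpace ℝ (Fin n) => (nrm p x, gau p x)) :=
    (measurable_nrm p n).prodMk (measurable_gau p n)
  have h := congrArg (fun ν => ν (univ ×ˢ {1})) (polar (n := n) hp hn)
  have ht : tau n {1} = 0 := by
    rw [tau]; exact withDensity_absolutelyContinuous _ _ (by simp)
  simp only [Measure.prod_prod, ht, mul_zero] at h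
  have hm1 : MeasurableSet ((univ : Set (EuclideanSpace ℝ (Fin n))) ×ˢ ({1} : Set ℝ)) :=
    MeasurableSet.univ.prod (measurableSet_singleton _)
  rw [Measure.map_apply hmeas hm1, Measure.restrict_apply (hmeas hm1)] at h
  refine measure_mono_null_ae ?_ h
  filter_upwards [coords_null n] with x hx hxD
  have hxD : x ∈ DeltaE p n := hxD
  refine ⟨⟨mem_univ _, gau_of_Delta hxD⟩, fun i => lt_of_le_of_ne (hxD.1 i) (hx i).symm⟩
end SZW

namespace SZW
open scoped Pointwise

theorem hausdorff_vol (d : ℕ) : ∃ c : ℝ≥0∞, c ≠ 0 ∧ c ≠ ∞ ∧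
    (μH[(d:ℝ)] : Measure (EuclideanSpace ℝ (Fin d))) = c • volume := by
  have h : (μH[(d:ℝ)] : Measure (EuclideanSpace ℝ (Fin d))).IsAddHaarMeasure := by
    simpa using MeasureTheory.isAddHaarMeasure_hausdorffMeasure (E := EuclideanSpace ℝ (Fin d))
  refine ⟨Measure.addHaarScalarFactor μH[(d:ℝ)] (volume : Measure (EuclideanSpace ℝ (Fin d))), ?_, by simp, ?_⟩
  · exact_mod_cast (Measure.addHaarScalarFactor_pos_of_isAddHaarMeasure _ _).ne'
  · exact Measure.isAddLeftInvariant_eq_smul _ _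

/-- insertion of a coordinate -/
def ins {d : ℕ} (i : Fin (d+1)) (a : ℝ) (v : EuclideanSpace ℝ (Fin d)) : EuclideanSpace ℝ (Fin (d+1)) :=
  WithLp.toLp 2 (i.insertNth a v.ofLp)

theorem ins_same {d : ℕ} (i : Fin (d+1)) (a : ℝ) (v : EuclideanSpace ℝ (Fin d)) : ins i a v i = a := by
  simp [ins]

theorem ins_succAbove {d : ℕ} (i : Fin (d+1)) (a : ℝ) (v : EuclideanSpace ℝ (Fin d)) (j : Fin d) :
    ins i a v (i.succAbove j) = v j := by
  simp [ins]

theorem isometry_ins {d : ℕ} (i : Fin (d+1)) (a : ℝ) : Isometry (ins i a) := by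
  refine Isometry.of_dist_eq fun v w => ?_
  rw [EuclideanSpace.dist_eq, EuclideanSpace.dist_eq, Fin.sum_univ_succAbove _ i]
  simp [ins_same, ins_succAbove]

theorem ins_surj {d : ℕ} (i : Fin (d+1)) (x : EuclideanSpace ℝ (Fin (d+1))) :
    ins i (x i) (WithLp.toLp 2 fun j => x (i.succAbove j)) = x := by
  ext j
  refine Fin.succAboveCases i ?_ ?_ j
  · rw [ins_same]
  · intro k; rw [ins_succAbove]

theorem hausdorff_face {d : ℕ} (i : Fin (d+1)) (a : ℝ) (B : Set (EuclideanSpace ℝ (Fin (d+1))))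
    (hB : ∀ x ∈ B, x i = a) : μH[(d:ℝ)] B = μH[(d:ℝ)] (ins i a ⁻¹' B) := by
  rw [← (isometry_ins i a).hausdorffMeasure_image (Or.inl (by positivity))]
  congr 1
  ext x
  constructor
  · intro hx
    refine ⟨WithLp.toLp 2 fun j => x (i.succAbove j), ?_, ?_⟩
    · rw [mem_preimage, ← hB x hx, ins_surj]; exact hx
    · rw [← hB x hx, ins_surj]
  · rintro ⟨v, hv, rfl⟩; exact hv

theorem boundary_null {p : ℝ} (hp : 0 < p) {d : ℕ} (hd : 0 < d) :
    μH[(d:ℝ)] (DeltaE p (d+1) \ Ort (d+1)) = 0 := by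
  have hsub : DeltaE p (d+1) \ Ort (d+1) ⊆ ⋃ i, (DeltaE p (d+1) ∩ {x | x i = 0}) := by
    rintro x ⟨hx, hxO⟩
    simp only [Ort, mem_ofPred_eq, not_forall, not_lt] at hxO
    obtain ⟨i, hi⟩ := hxO
    exact mem_iUnion.2 ⟨i, hx, le_antisymm hi (hx.1 i)⟩
  refine measure_mono_null hsub (measure_iUnion_null fun i => ?_)
  rw [hausdorff_face i 0 _ (fun x hx => hx.2)]
  obtain ⟨c, -, -, hc⟩ := hausdorff_vol d
  rw [hc, Measure.smul_apply, smul_eq_mul]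
  refine mul_eq_zero_of_right _ (measure_mono_null ?_ (vol_Delta hp hd))
  rintro v ⟨⟨h1, h2⟩, -⟩
  refine ⟨fun j => by simpa [ins_succAbove] using h1 (i.succAbove j), ?_⟩
  rw [Fin.sum_univ_succAbove _ i] at h2
  simpa [ins_same, ins_succAbove, zero_rpow hp.ne'] using h2

theorem cone_hyp0 (d : ℕ) : ∃ k : ℝ≥0∞, k ≠ 0 ∧ k ≠ ∞ ∧
    ∀ B : Set (EuclideanSpace ℝ (Fin (d+1))), MeasurableSet B → (∀ x ∈ B, x 0 = 1) →
      volume (coneE B) = k * μH[(d:ℝ)] B := by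
  obtain ⟨c, hc0, hct, hc⟩ := hausdorff_vol d
  refine ⟨ENNReal.ofReal ((d+1:ℝ)⁻¹) * c⁻¹, ?_, ?_, ?_⟩
  · refine mul_ne_zero ?_ (by simpa using hct)
    simp; positivity
  · exact ENNReal.mul_ne_top ENNReal.ofReal_ne_top (by simpa using hc0)
  intro B hB hB1
  rw [hausdorff_face 0 1 B hB1, hc, Measure.smul_apply, smul_eq_mul, mul_assoc, ← mul_assoc c⁻¹,
    ENNReal.inv_mul_cancel hc0 hct, one_mul]
  set S : Set (EuclideanSpace ℝ (Fin (d+1))) := {x | x 0 ∈ Ioc (0:ℝ) 1 ∧ (x 0)⁻¹ • x ∈ B} with hS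
  have hSm : MeasurableSet S := by
    have m0 : Measurable (fun x : EuclideanSpace ℝ (Fin (d+1)) => x 0) := by fun_prop
    exact (m0 measurableSet_Ioc).inter ((m0.inv.smul measurable_id) hB)
  have e1 : volume (coneE B) = volume S := by
    apply measure_congr
    filter_upwards [coords_null (d+1)] with x hx
    apply propext
    constructor
    · rintro ⟨t, ht, b, hb, rfl⟩
      have hb1 := hB1 b hb
      have ht0 : t ≠ 0 := by have := hx 0; simp at this; tauto
      refine ⟨⟨?_, ?_⟩, ?_⟩
      · simpa [hb1] using lt_of_le_of_ne ht.1 ht0.symm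
      · simpa [hb1] using ht.2
      · simpa [hb1, smul_smul, ht0] using hb
    · rintro ⟨⟨h1, h2⟩, h3⟩
      exact ⟨x 0, ⟨h1.le, h2⟩, _, h3, by rw [smul_smul, mul_inv_cancel₀ h1.ne', one_smul]⟩
  set B' : Set (Fin d → ℝ) := {u | ins 0 1 (WithLp.toLp 2 u) ∈ B} with hB'
  have hmi : Measurable (fun u : Fin d → ℝ => ins 0 1 (WithLp.toLp 2 u)) :=
    (isometry_ins 0 1).continuous.measurable.comp (by fun_prop)
  have e2 : volume (ins 0 1 ⁻¹' B) = volume B' := by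
    rw [← (PiLp.volume_preserving_toLp (Fin d)).measure_preimage
      ((isometry_ins 0 1).continuous.measurable hB).nullMeasurableSet]
    rfl
  have hmp := (PiLp.volume_preserving_toLp (Fin (d+1))).comp
    (volume_preserving_piFinSuccAbove (fun _ : Fin (d+1) => ℝ) 0).symm
  rw [e1, e2, ← hmp.measure_preimage hSm.nullMeasurableSet, Measure.volume_eq_prod,
    Measure.prod_apply (hmp.measurable hSm)]
  have e3 : ∀ t : ℝ, volume (Prod.mk t ⁻¹' ((WithLp.toLp 2 ∘
      (MeasurableEquiv.piFinSuccAbove (fun _ : Fin (d+1) => ℝ) 0).symm) ⁻¹' S)) =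
      (Ioc (0:ℝ) 1).indicator (fun t => ENNReal.ofReal (t ^ d) * volume B') t := by
    intro t
    by_cases ht : t ∈ Ioc (0:ℝ) 1
    · rw [indicator_of_mem ht]
      have : (Prod.mk t ⁻¹' ((WithLp.toLp 2 ∘
        (MeasurableEquiv.piFinSuccAbove (fun _ : Fin (d+1) => ℝ) 0).symm) ⁻¹' S)) = t • B' := by
        ext u
        rw [Set.mem_smul_set_iff_inv_smul_mem₀ ht.1.ne']
        have hv : t⁻¹ • (WithLp.toLp 2 (Fin.cons t u : Fin (d+1) → ℝ)) =
            ins 0 1 (WithLp.toLp 2 (t⁻¹ • u)) := by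
          ext j
          refine Fin.cases ?_ (fun k => ?_) j
          · simp [ins, ht.1.ne']
          · simp [ins]
        simp [hS, hB', ht.1, ht.2]
        exact iff_of_eq (congrArg (· ∈ B) hv)
      rw [this, Measure.addHaar_smul, Module.finrank_fintype_fun_eq_card, Fintype.card_fin,
        abs_of_pos (pow_pos ht.1 _)]
    · rw [indicator_of_notMem ht]
      convert measure_empty (μ := volume) using 2
      ext u
      have : ¬ (0 < t ∧ t ≤ 1) := ht
      simp only [mem_preimage, hS, mem_empty_iff_false, iff_false]
      intro h
      exact ht (by simpa using h.1)
  simp_rw [e3]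
  rw [lintegral_indicator measurableSet_Ioc, lintegral_mul_const _ (by fun_prop)]
  congr 1
  rw [← ofReal_integral_eq_lintegral_ofReal, ← intervalIntegral.integral_of_le zero_le_one, integral_pow]
  · simp
  · exact (Continuous.integrableOn_Icc (by fun_prop)).mono_set Ioc_subset_Icc_self
  · filter_upwards [ae_restrict_mem measurableSet_Ioc] with x hx
    have := hx.1
    positivity

theorem cone_hyp (d : ℕ) : ∃ k : ℝ≥0∞, k ≠ 0 ∧ k ≠ ∞ ∧
    ∀ w : EuclideanSpace ℝ (Fin (d+1)), w ≠ 0 →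
    ∀ B : Set (EuclideanSpace ℝ (Fin (d+1))), MeasurableSet B → (∀ x ∈ B, inner ℝ w x = 1) →
      ENNReal.ofReal ‖w‖ * volume (coneE B) = k * μH[(d:ℝ)] B := by
  obtain ⟨k, hk0, hkt, hk⟩ := cone_hyp0 d
  refine ⟨k, hk0, hkt, fun w hw B hB hB1 => ?_⟩
  set r := ‖w‖ with hr
  have hr0 : 0 < r := norm_pos_iff.2 hw
  set e : EuclideanSpace ℝ (Fin (d+1)) := EuclideanSpace.single 0 1 with he
  have hn : ‖w‖ = ‖r • e‖ := by rw [norm_smul, he]; simp [hr]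
  set φ := (Submodule.reflection (Submodule.span ℝ {w - r • e})ᗮ) with hφ
  have hφw : φ w = r • e := Submodule.reflection_sub hn
  have himg : φ '' B = φ.symm ⁻¹' B := by
    exact φ.toHomeomorph.toEquiv.image_eq_preimage_symm B
  have hB2 : MeasurableSet (r • (φ '' B)) := by
    rw [himg]
    exact (φ.symm.continuous.measurable hB).const_smul_of_ne_zero hr0.ne'
  have h1 : ∀ x ∈ r • (φ '' B), x 0 = 1 := by
    rintro _ ⟨_, ⟨b, hb, rfl⟩, rfl⟩
    have h2 := hB1 b hb
    rw [← φ.inner_map_map, hφw, inner_smul_left, he, EuclideanSpace.inner_single_left] at h2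
    simpa using h2
  have h3 := hk _ hB2 h1
  have h4 : coneE (r • (φ '' B)) = r • (φ '' coneE B) := by
    ext x
    constructor
    · rintro ⟨t, ht, _, ⟨_, ⟨b, hb, rfl⟩, rfl⟩, rfl⟩
      refine ⟨_, ⟨t • b, ⟨t, ht, b, hb, rfl⟩, rfl⟩, ?_⟩
      simp only [map_smul, smul_comm r t]
    · rintro ⟨_, ⟨_, ⟨t, ht, b, hb, rfl⟩, rfl⟩, rfl⟩
      refine ⟨t, ht, _, ⟨_, ⟨b, hb, rfl⟩, rfl⟩, ?_⟩
      simp only [map_smul, smul_comm r t]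
  have h5 : volume (φ '' coneE B) = volume (coneE B) := by
    have : φ '' coneE B = φ.symm ⁻¹' coneE B := by
      exact φ.toHomeomorph.toEquiv.image_eq_preimage_symm _
    rw [this]
    exact φ.symm.measurePreserving.measure_preimage_equiv (f := φ.symm.toHomeomorph.toMeasurableEquiv) _
  have h6 : μH[(d:ℝ)] (φ '' B) = μH[(d:ℝ)] B := φ.isometry.hausdorffMeasure_image (Or.inl (by positivity)) B
  rw [h4, Measure.addHaar_smul, h5, Measure.hausdorffMeasure_smul₀ (by positivity) hr0.ne', h6,
    finrank_euclideanSpace_fin, abs_of_pos (by positivity), pow_succ', ENNReal.ofReal_mul hr0.le] at h3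
  have h7 : (‖r‖₊ ^ (d:ℝ)) • μH[(d:ℝ)] B = ENNReal.ofReal (r ^ d) * μH[(d:ℝ)] B := by
    rw [ENNReal.smul_def, smul_eq_mul]
    congr 1
    rw [NNReal.rpow_natCast, ENNReal.coe_pow, ENNReal.ofReal_pow hr0.le]
    congr 1
    rw [← Real.enorm_of_nonneg hr0.le]; rfl
  rw [h7] at h3
  have h8 : ENNReal.ofReal (r ^ d) ≠ 0 := by simp; positivity
  refine (ENNReal.mul_right_inj h8 ENNReal.ofReal_ne_top).1 ?_
  rw [mul_left_comm, ← mul_assoc, h3]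
  ring
end SZW

namespace SZW
open scoped Pointwise Topology

theorem le_of_locally_le {X : Type*} [TopologicalSpace X] [SecondCountableTopology X]
    [MeasurableSpace X] [BorelSpace X] (α β : Measure X) (D : Set X)
    (h : ∀ x ∈ D, ∃ U ∈ 𝓝 x, ∀ A, MeasurableSet A → A ⊆ U ∩ D → α A ≤ β A)
    (A : Set X) (hA : MeasurableSet A) (hAD : A ⊆ D) : α A ≤ β A := by
  have h' : ∀ x, ∃ U, IsOpen U ∧ (x ∈ D → x ∈ U ∧ ∀ A, MeasurableSet A → A ⊆ U ∩ D → α A ≤ β A) := by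
    intro x
    by_cases hx : x ∈ D
    · obtain ⟨U, hU, hU2⟩ := h x hx
      obtain ⟨V, hVU, hV, hxV⟩ := mem_nhds_iff.1 hU
      exact ⟨V, hV, fun _ => ⟨hxV, fun A hA hAV => hU2 A hA (hAV.trans (inter_subset_inter_left _ hVU))⟩⟩
    · exact ⟨∅, isOpen_empty, fun h => absurd h hx⟩
  choose f hfo hf using h'
  obtain ⟨t, htD, htc, ht⟩ := TopologicalSpace.countable_cover_nhdsWithin (s := D) (f := f)
    (fun x hx => mem_nhdsWithin_of_mem_nhds ((hfo x).mem_nhds (hf x hx).1))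
  rcases t.eq_empty_or_nonempty with rfl | hne
  · have : A = ∅ := by
      refine subset_empty_iff.1 (hAD.trans (ht.trans ?_)); simp
    simp [this]
  obtain ⟨u, rfl⟩ := htc.exists_eq_range hne
  have hm : ∀ k, MeasurableSet (A ∩ disjointed (fun k => f (u k)) k) := fun k =>
    hA.inter (MeasurableSet.disjointed (fun k => (hfo _).measurableSet) k)
  have hU : A = ⋃ k, A ∩ disjointed (fun k => f (u k)) k := by
    rw [← inter_iUnion, iUnion_disjointed]
    refine (inter_eq_left.2 ?_).symm
    refine hAD.trans (ht.trans ?_)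
    simp
  have hd : Pairwise (Function.onFun Disjoint fun k => A ∩ disjointed (fun k => f (u k)) k) := by
    intro i j hij
    exact (disjoint_disjointed _ hij).mono inter_subset_right inter_subset_right
  rw [hU, measure_iUnion hd hm, measure_iUnion hd hm]
  refine ENNReal.tsum_le_tsum fun k => (hf (u k) (htD ⟨k, rfl⟩)).2 _ (hm k) ?_
  exact fun x hx => ⟨disjointed_subset (fun k => f (u k)) k hx.2, hAD hx.1⟩

/-- gradient of the gauge on the sphere -/
def grd (p : ℝ) {n : ℕ} (x : EuclideanSpace ℝ (Fin n)) : EuclideanSpace ℝ (Fin n) :=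
  WithLp.toLp 2 fun i => x i ^ (p - 1)

/-- the density -/
def den (p : ℝ) {n : ℕ} (x : EuclideanSpace ℝ (Fin n)) : ℝ :=
  (∑ i, x i ^ (2 * p - 2)) ^ ((1 : ℝ) / 2)

theorem norm_grd {p : ℝ} {n : ℕ} {x : EuclideanSpace ℝ (Fin n)} (hx : x ∈ Ort n) :
    ‖grd p x‖ = den p x := by
  rw [EuclideanSpace.norm_eq, den, sqrt_eq_rpow]
  congr 1
  refine Finset.sum_congr rfl fun i _ => ?_
  have : 0 < x i := hx i
  simp only [grd]
  rw [Real.norm_of_nonneg (by positivity), ← rpow_natCast, ← rpow_mul this.le]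
  congr 1; push_cast; ring

theorem den_pos {p : ℝ} {n : ℕ} (hn : 0 < n) {x : EuclideanSpace ℝ (Fin n)} (hx : x ∈ Ort n) :
    0 < den p x := rpow_pos_of_pos (sum_pos_of_Ort hn hx) _

theorem measurable_den (p : ℝ) (n : ℕ) : Measurable (den p : EuclideanSpace ℝ (Fin n) → ℝ) := by
  unfold den; fun_prop

theorem continuousAt_den {p : ℝ} {n : ℕ} (hn : 0 < n) {x : EuclideanSpace ℝ (Fin n)} (hx : x ∈ Ort n) :
    ContinuousAt (den p) x := by
  unfold den
  refine ContinuousAt.rpow_const ?_ (Or.inl (sum_pos_of_Ort hn hx).ne')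
  refine tendsto_finsetSum _ fun i _ => ?_
  exact ContinuousAt.rpow_const (f := fun x : EuclideanSpace ℝ (Fin n) => x i) (by fun_prop) (Or.inl (hx i).ne')

theorem inner_grd {p : ℝ} {n : ℕ} (x y : EuclideanSpace ℝ (Fin n)) :
    inner ℝ (grd p x) y = ∑ i, x i ^ (p-1) * y i := by
  simp [grd, PiLp.inner_apply, mul_comm]

theorem inner_grd_self {p : ℝ} {n : ℕ} {x : EuclideanSpace ℝ (Fin n)} (hx : x ∈ DeltaE p n ∩ Ort n) :
    inner ℝ (grd p x) x = 1 := by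
  rw [inner_grd]
  refine Eq.trans ?_ hx.1.2
  refine Finset.sum_congr rfl fun i _ => ?_
  have := hx.2 i
  nth_rewrite 2 [← rpow_one (x i)]
  rw [← rpow_add this, sub_add_cancel]

theorem strict_sum {p : ℝ} {n : ℕ} {x : EuclideanSpace ℝ (Fin n)} (hx : x ∈ Ort n) :
    HasStrictFDerivAt (fun y : EuclideanSpace ℝ (Fin n) => ∑ i, y i ^ p)
      (p • innerSL ℝ (grd p x)) x := by
  have h : ∀ i : Fin n, HasStrictFDerivAt (fun y : EuclideanSpace ℝ (Fin n) => y i ^ p)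
      ((p * x i ^ (p-1)) • (EuclideanSpace.proj i : EuclideanSpace ℝ (Fin n) →L[ℝ] ℝ)) x := by
    intro i
    exact (Real.hasStrictDerivAt_rpow_const_of_ne (hx i).ne' p).comp_hasStrictFDerivAt x
      (EuclideanSpace.proj i : EuclideanSpace ℝ (Fin n) →L[ℝ] ℝ).hasStrictFDerivAt
  have h2 := HasStrictFDerivAt.fun_sum (u := Finset.univ) fun i _ => h i
  refine h2.congr_fderiv ?_
  ext v
  simp [inner_grd, Finset.mul_sum, mul_assoc]

theorem local_geom {p : ℝ} (hp : 0 < p) {n : ℕ} {x₀ : EuclideanSpace ℝ (Fin n)}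
    (hx₀ : x₀ ∈ DeltaE p n ∩ Ort n) {δ : ℝ} (hδ : 0 < δ) :
    ∃ U ∈ 𝓝 x₀, ∀ x ∈ U ∩ (DeltaE p n ∩ Ort n), 0 < inner ℝ (grd p x₀) x ∧
      |(inner ℝ (grd p x₀) x)⁻¹ - 1| ≤ δ ∧
      ∀ y ∈ U ∩ (DeltaE p n ∩ Ort n),
      ‖((inner ℝ (grd p x₀) x)⁻¹ • x - (inner ℝ (grd p x₀) y)⁻¹ • y) - (x - y)‖ ≤ δ * ‖x - y‖ := by
  set w := grd p x₀ with hw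
  set R := ‖x₀‖ + 1 with hR
  have hR0 : 0 < R := by positivity
  set η := δ / (8 * R) with hη
  have hη0 : 0 < η := by positivity
  have hw1 : inner ℝ w x₀ = 1 := inner_grd_self hx₀
  have c1 : ContinuousAt (fun x : EuclideanSpace ℝ (Fin n) => inner ℝ w x) x₀ := by fun_prop
  have c2 : ContinuousAt (fun x : EuclideanSpace ℝ (Fin n) => (inner ℝ w x)⁻¹) x₀ :=
    c1.inv₀ (by rw [hw1]; norm_num)
  have E1 : ∀ᶠ x in 𝓝 x₀, 1/2 < inner ℝ w x := c1.eventually_const_lt (show (1/2:ℝ) < inner ℝ w x₀ by rw [hw1]; norm_num)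
  have E2 : ∀ᶠ x in 𝓝 x₀, |(inner ℝ w x)⁻¹ - 1| < δ/2 := by
    have := c2.eventually (Metric.ball_mem_nhds _ (half_pos hδ))
    simpa [hw1, Real.dist_eq] using this
  have E3 : ∀ᶠ x in 𝓝 x₀, ‖x‖ < R := continuousAt_id.norm.eventually_lt_const (by simp [hR])
  have E4 := (strict_sum (p := p) hx₀.2).isLittleO.def (mul_pos hp hη0)
  rw [nhds_prod_eq] at E4
  obtain ⟨V, hV, hV2⟩ := Filter.eventually_prod_self_iff'.1 E4
  refine ⟨_, Filter.inter_mem hV (E1.and (E2.and E3)), ?_⟩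
  rintro x ⟨⟨hxV, hx1, hx2, hx3⟩, hxD⟩
  refine ⟨by linarith, by linarith, ?_⟩
  rintro y ⟨⟨hyV, hy1, hy2, hy3⟩, hyD⟩
  have h4 := hV2 x hxV y hyV
  simp only [hxD.1.2, hyD.1.2, sub_self, zero_sub, norm_neg] at h4
  have h5 : |inner ℝ w x - inner ℝ w y| ≤ η * ‖x - y‖ := by
    simp only [_root_.smul_apply, innerSL_apply_apply, smul_eq_mul, inner_sub_right,
      norm_mul, Real.norm_eq_abs, abs_of_pos hp, mul_assoc] at h4
    exact le_of_mul_le_mul_left h4 hp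
  set a := inner ℝ w x with ha
  set b := inner ℝ w y with hb
  have ha0 : 0 < a := by linarith
  have hb0 : 0 < b := by linarith
  have h6 : |a⁻¹ - b⁻¹| ≤ 4 * η * ‖x - y‖ := by
    have e : a⁻¹ - b⁻¹ = (b - a) / (a * b) := by field_simp
    rw [e, abs_div, abs_of_pos (mul_pos ha0 hb0), div_le_iff₀ (mul_pos ha0 hb0), abs_sub_comm]
    have : 1/4 ≤ a * b := by nlinarith
    have : 0 ≤ η * ‖x-y‖ := by positivity
    nlinarith
  have e2 : (a⁻¹ • x - b⁻¹ • y) - (x - y) = (a⁻¹ - 1) • (x - y) + (a⁻¹ - b⁻¹) • y := by module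
  rw [e2]
  calc _ ≤ |a⁻¹ - 1| * ‖x-y‖ + |a⁻¹ - b⁻¹| * ‖y‖ := by
        refine (norm_add_le _ _).trans ?_
        rw [norm_smul, norm_smul, Real.norm_eq_abs, Real.norm_eq_abs]
    _ ≤ δ/2 * ‖x-y‖ + (4 * η * ‖x - y‖) * R := by gcongr
    _ = δ * ‖x-y‖ := by rw [hη]; field_simp; ring

theorem local_meas {p : ℝ} (hp : 0 < p) {d : ℕ} {k : ℝ≥0∞}
    (hk : ∀ w : EuclideanSpace ℝ (Fin (d+1)), w ≠ 0 →
      ∀ B : Set (EuclideanSpace ℝ (Fin (d+1))), MeasurableSet B → (∀ x ∈ B, inner ℝ w x = 1) →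
      ENNReal.ofReal ‖w‖ * volume (coneE B) = k * μH[(d:ℝ)] B)
    {x₀ : EuclideanSpace ℝ (Fin (d+1))}
    (hx₀ : x₀ ∈ DeltaE p (d+1) ∩ Ort (d+1)) {Q : ℝ} (hQ : 1 < Q) :
    ∃ U ∈ 𝓝 x₀, ∀ A, MeasurableSet A → A ⊆ U ∩ (DeltaE p (d+1) ∩ Ort (d+1)) →
      k * μH[(d:ℝ)] A ≤ ENNReal.ofReal Q ^ (2*d+1) * (ENNReal.ofReal (den p x₀) * mco p (d+1) A) ∧
      ENNReal.ofReal (den p x₀) * mco p (d+1) A ≤ ENNReal.ofReal Q ^ (2*d+1) * (k * μH[(d:ℝ)] A) := by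
  have hQ0 : 0 < Q := by linarith
  set δ := 1 - Q⁻¹ with hδ
  have hδ0 : 0 < δ := by have := inv_lt_one_of_one_lt₀ hQ; linarith
  have hδ1 : 1 - δ = Q⁻¹ := by rw [hδ]; ring
  have hδ2 : 1 + δ ≤ Q := by
    have : Q * Q⁻¹ = 1 := mul_inv_cancel₀ hQ0.ne'
    have hi : 0 < Q⁻¹ := by positivity
    nlinarith [mul_pos hi (sub_pos.2 hQ), sq_nonneg (Q - 1), mul_nonneg hi.le (sq_nonneg (Q-1))]
  obtain ⟨U, hU, hU2⟩ := local_geom hp hx₀ hδ0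
  refine ⟨U, hU, fun A hA hAU => ?_⟩
  set w := grd p x₀ with hw
  have hwn : ‖w‖ = den p x₀ := norm_grd hx₀.2
  have hw0 : w ≠ 0 := norm_pos_iff.1 (by rw [hwn]; exact den_pos (by omega) hx₀.2)
  set pj : EuclideanSpace ℝ (Fin (d+1)) → EuclideanSpace ℝ (Fin (d+1)) := fun x => (inner ℝ w x)⁻¹ • x with hpj
  set B := pj '' A with hB
  have hnpj : ∀ x ∈ A, nrm p (pj x) = x := fun x hx => by
    have hxU := hAU hx
    rw [hpj]
    simp only
    rw [nrm_smul hp hxU.2.1.1 (inv_pos.2 (hU2 x hxU).1), nrm_of_Delta hxU.2.1]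
  have hB1 : ∀ x ∈ B, inner ℝ w x = 1 := by
    rintro _ ⟨x, hx, rfl⟩
    rw [hpj]
    simp only
    rw [inner_smul_right, inv_mul_cancel₀ (hU2 x (hAU hx)).1.ne']
  have hBm : MeasurableSet B := by
    have : B = {y | inner ℝ w y = 1} ∩ (Ort (d+1) ∩ nrm p ⁻¹' A) := by
      ext y
      constructor
      · intro hy
        refine ⟨hB1 y hy, ?_⟩
        obtain ⟨x, hx, rfl⟩ := hy
        refine ⟨smul_mem_Ort (hAU hx).2.2 (inv_pos.2 (hU2 x (hAU hx)).1), ?_⟩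
        rw [mem_preimage, hnpj x hx]; exact hx
      · rintro ⟨h1, h2, h3⟩
        have h1 : inner ℝ w y = 1 := h1
        refine ⟨nrm p y, h3, ?_⟩
        have hg := gau_pos (p := p) (by omega) h2
        simp only [hpj, nrm, inner_smul_right, h1, mul_one, inv_inv, smul_smul]
        rw [mul_inv_cancel₀ hg.ne', one_smul]
    rw [this]
    exact (measurableSet_eq_fun (by fun_prop) measurable_const).inter
      ((measurableSet_Ort _).inter (measurable_nrm p _ hA))
  have hcone := hk w hw0 B hBm hB1
  rw [hwn] at hcone
  have hvA : volume (coneE A) = mco p (d+1) A := vol_cone hp (by omega) hA (fun x hx => (hAU hx).2.1)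
  have hQe : ((Q.toNNReal : ℝ≥0∞)) = ENNReal.ofReal Q := rfl
  -- Hausdorff comparisons
  have H1 : μH[(d:ℝ)] B ≤ ENNReal.ofReal Q ^ d * μH[(d:ℝ)] A := by
    have hl : LipschitzOnWith Q.toNNReal pj A := by
      refine LipschitzOnWith.of_dist_le_mul fun x hx y hy => ?_
      rw [dist_eq_norm, dist_eq_norm, Real.coe_toNNReal _ hQ0.le]
      have h := (hU2 x (hAU hx)).2.2 y (hAU hy)
      have h2 := norm_sub_norm_le (pj x - pj y) (x - y)
      have : ‖pj x - pj y‖ ≤ (1 + δ) * ‖x - y‖ := by simp only [hpj] at h2 ⊢; linarith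
      exact this.trans (by gcongr)
    simpa [ENNReal.rpow_natCast, hQe] using hl.hausdorffMeasure_image_le (d := (d:ℝ)) (by positivity)
  have H2 : μH[(d:ℝ)] A ≤ ENNReal.ofReal Q ^ d * μH[(d:ℝ)] B := by
    have hl : LipschitzOnWith Q.toNNReal (nrm p) B := by
      refine LipschitzOnWith.of_dist_le_mul ?_
      rintro _ ⟨x, hx, rfl⟩ _ ⟨y, hy, rfl⟩
      rw [hnpj x hx, hnpj y hy, dist_eq_norm, dist_eq_norm, Real.coe_toNNReal _ hQ0.le]
      have h := (hU2 x (hAU hx)).2.2 y (hAU hy)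
      have h2 := norm_sub_norm_le (x - y) (pj x - pj y)
      rw [norm_sub_rev (x - y)] at h2
      have : (1 - δ) * ‖x - y‖ ≤ ‖pj x - pj y‖ := by simp only [hpj] at h2 ⊢; linarith
      rw [hδ1, inv_mul_le_iff₀ hQ0] at this
      exact this
    have hAB : nrm p '' B = A := by
      rw [hB, image_image]
      exact (image_congr hnpj).trans (image_id' A)
    have := hl.hausdorffMeasure_image_le (d := (d:ℝ)) (by positivity)
    rw [hAB] at this
    simpa [ENNReal.rpow_natCast, hQe] using this
  -- volume comparisons
  have V1 : volume (coneE B) ≤ ENNReal.ofReal Q ^ (d+1) * mco p (d+1) A := by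
    have hsub : coneE B ⊆ Q • coneE A := by
      rintro _ ⟨t, ht, _, ⟨x, hx, rfl⟩, rfl⟩
      obtain ⟨h1, h2, -⟩ := hU2 x (hAU hx)
      have h3 := (abs_le.1 h2).2
      have h4 : (inner ℝ w x)⁻¹ ≤ Q := by linarith
      have h5 : 0 < (inner ℝ w x)⁻¹ := inv_pos.2 h1
      refine ⟨(Q⁻¹ * t * (inner ℝ w x)⁻¹) • x, ⟨_, ⟨?_, ?_⟩, x, hx, rfl⟩, ?_⟩
      · have := ht.1; positivity
      · rw [mul_assoc, inv_mul_le_iff₀ hQ0, mul_one]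
        have := ht.1; have := ht.2; nlinarith
      · simp only [hpj, smul_smul]
        congr 1; field_simp
    refine (measure_mono hsub).trans ?_
    rw [Measure.addHaar_smul, hvA, finrank_euclideanSpace_fin, abs_of_pos (by positivity),
      ENNReal.ofReal_pow hQ0.le]
  have V2 : mco p (d+1) A ≤ ENNReal.ofReal Q ^ (d+1) * volume (coneE B) := by
    have hsub : coneE A ⊆ Q • coneE B := by
      rintro _ ⟨t, ht, x, hx, rfl⟩
      obtain ⟨h1, h2, -⟩ := hU2 x (hAU hx)
      have h3 := (abs_le.1 h2).1
      have h4 : Q⁻¹ ≤ (inner ℝ w x)⁻¹ := by linarith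
      have h4 : inner ℝ w x ≤ Q := (inv_le_inv₀ hQ0 h1).1 h4
      refine ⟨(Q⁻¹ * t * (inner ℝ w x)) • pj x, ⟨_, ⟨?_, ?_⟩, pj x, ⟨x, hx, rfl⟩, rfl⟩, ?_⟩
      · have := ht.1; positivity
      · rw [mul_assoc, inv_mul_le_iff₀ hQ0, mul_one]
        have := ht.1; have := ht.2; nlinarith
      · simp only [hpj, smul_smul]
        congr 1; field_simp
    rw [← hvA]
    refine (measure_mono hsub).trans ?_
    rw [Measure.addHaar_smul, finrank_euclideanSpace_fin, abs_of_pos (by positivity),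
      ENNReal.ofReal_pow hQ0.le]
  set q := ENNReal.ofReal Q
  set g := ENNReal.ofReal (den p x₀)
  constructor
  · calc k * μH[(d:ℝ)] A ≤ k * (q ^ d * μH[(d:ℝ)] B) := by gcongr
      _ = q ^ d * (k * μH[(d:ℝ)] B) := by ring
      _ = q ^ d * (g * volume (coneE B)) := by rw [hcone]
      _ ≤ q ^ d * (g * (q ^ (d+1) * mco p (d+1) A)) := by gcongr
      _ = _ := by ring
  · calc g * mco p (d+1) A ≤ g * (q ^ (d+1) * volume (coneE B)) := by gcongr
      _ = q ^ (d+1) * (g * volume (coneE B)) := by ring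
      _ = q ^ (d+1) * (k * μH[(d:ℝ)] B) := by rw [hcone]
      _ ≤ q ^ (d+1) * (k * (q ^ d * μH[(d:ℝ)] A)) := by gcongr
      _ = _ := by ring
end SZW

namespace SZW
open scoped Pointwise Topology

theorem le_of_all_Q {a b : ℝ≥0∞} (m : ℕ) (h : ∀ Q : ℝ, 1 < Q → a ≤ ENNReal.ofReal Q ^ m * b) : a ≤ b := by
  have ht : Filter.Tendsto (fun Q : ℝ => ENNReal.ofReal Q ^ m * b) (𝓝[>] 1) (𝓝 (1 * b)) := by
    refine ENNReal.Tendsto.mul_const ?_ (Or.inl one_ne_zero)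
    have : Filter.Tendsto (fun Q : ℝ => ENNReal.ofReal Q ^ m) (𝓝 1) (𝓝 (ENNReal.ofReal 1 ^ m)) :=
      ((ENNReal.continuous_pow m).comp ENNReal.continuous_ofReal).tendsto 1
    simpa using this.mono_left nhdsWithin_le_nhds
  rw [one_mul] at ht
  refine ge_of_tendsto ht ?_
  filter_upwards [self_mem_nhdsWithin] with Q hQ using h Q hQ

theorem surface_eq {p : ℝ} (hp : 0 < p) {d : ℕ} (hd : 0 < d) : ∃ k : ℝ≥0∞, k ≠ 0 ∧ k ≠ ∞ ∧
    k • (μH[(d:ℝ)]).restrict (DeltaE p (d+1)) =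
      (mco p (d+1)).withDensity fun x => ENNReal.ofReal (den p x) := by
  obtain ⟨k, hk0, hkt, hk⟩ := cone_hyp d
  refine ⟨k, hk0, hkt, ?_⟩
  set D := DeltaE p (d+1) ∩ Ort (d+1) with hD
  have hDm : MeasurableSet D := (measurableSet_Delta p _).inter (measurableSet_Ort _)
  set M := (mco p (d+1)).withDensity fun x => ENNReal.ofReal (den p x) with hM
  -- local estimate with the integral
  have loc : ∀ Q : ℝ, 1 < Q → ∀ x ∈ D, ∃ U ∈ 𝓝 x, ∀ A, MeasurableSet A → A ⊆ U ∩ D →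
      (k • (μH[(d:ℝ)] : Measure (EuclideanSpace ℝ (Fin (d+1))))) A ≤ (ENNReal.ofReal Q ^ (2*d+2) • M) A ∧
      M A ≤ (ENNReal.ofReal Q ^ (2*d+2) • (k • (μH[(d:ℝ)] : Measure (EuclideanSpace ℝ (Fin (d+1)))))) A := by
    intro Q hQ x hx
    have hQ0 : 0 < Q := by linarith
    obtain ⟨U, hU, hU2⟩ := local_meas hp hk hx hQ
    have hpos : 0 < den p x := den_pos (by omega) hx.2
    have hc : ContinuousAt (den p) x := continuousAt_den (by omega) hx.2
    have E1 : ∀ᶠ y in 𝓝 x, den p y < Q * den p x := hc.eventually_lt_const (by nlinarith)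
    have E2 : ∀ᶠ y in 𝓝 x, Q⁻¹ * den p x < den p y := hc.eventually_const_lt (by
      have := inv_lt_one_of_one_lt₀ hQ; nlinarith)
    refine ⟨_, Filter.inter_mem hU (E1.and E2), fun A hA hAU => ?_⟩
    obtain ⟨h1, h2⟩ := hU2 A hA (fun y hy => ⟨(hAU hy).1.1, (hAU hy).2⟩)
    have hMA : M A = ∫⁻ y in A, ENNReal.ofReal (den p y) ∂(mco p (d+1)) := withDensity_apply _ hA
    have i1 : ENNReal.ofReal (den p x) * mco p (d+1) A ≤ ENNReal.ofReal Q * M A := by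
      rw [hMA, ← lintegral_const_mul' _ _ ENNReal.ofReal_ne_top, ← setLIntegral_const]
      refine setLIntegral_mono' hA fun y hy => ?_
      rw [← ENNReal.ofReal_mul hQ0.le]
      apply ENNReal.ofReal_le_ofReal
      have : Q⁻¹ * den p x < den p y := (hAU hy).1.2.2
      rw [inv_mul_lt_iff₀ hQ0] at this
      exact this.le
    have i2 : M A ≤ ENNReal.ofReal Q * (ENNReal.ofReal (den p x) * mco p (d+1) A) := by
      rw [hMA, ← mul_assoc, ← ENNReal.ofReal_mul hQ0.le, ← setLIntegral_const]
      refine setLIntegral_mono' hA fun y hy => ?_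
      exact ENNReal.ofReal_le_ofReal (hAU hy).1.2.1.le
    simp only [Measure.smul_apply, smul_eq_mul]
    set q := ENNReal.ofReal Q
    constructor
    · calc _ ≤ _ := h1
        _ ≤ q ^ (2*d+1) * (q * M A) := by gcongr
        _ = _ := by ring
    · calc _ ≤ _ := i2
        _ ≤ q * (q ^ (2*d+1) * (k * μH[(d:ℝ)] A)) := by gcongr
        _ = _ := by ring
  have glob : ∀ A, MeasurableSet A → A ⊆ D → k * μH[(d:ℝ)] A = M A := by
    intro A hA hAD
    apply le_antisymm
    · refine le_of_all_Q (2*d+2) fun Q hQ => ?_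
      have := le_of_locally_le (k • (μH[(d:ℝ)] : Measure (EuclideanSpace ℝ (Fin (d+1)))))
        (ENNReal.ofReal Q ^ (2*d+2) • M) D (fun x hx => by
          obtain ⟨U, hU, h⟩ := loc Q hQ x hx
          exact ⟨U, hU, fun A hA hAU => (h A hA hAU).1⟩) A hA hAD
      simpa using this
    · refine le_of_all_Q (2*d+2) fun Q hQ => ?_
      have := le_of_locally_le M
        (ENNReal.ofReal Q ^ (2*d+2) • (k • (μH[(d:ℝ)] : Measure (EuclideanSpace ℝ (Fin (d+1)))))) D (fun x hx => by
          obtain ⟨U, hU, h⟩ := loc Q hQ x hx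
          exact ⟨U, hU, fun A hA hAU => (h A hA hAU).2⟩) A hA hAD
      simpa using this
  ext S hS
  have hMD : M Dᶜ = 0 := withDensity_absolutelyContinuous _ _ (mco_compl hp (by omega))
  have e1 : M S = M (S ∩ D) :=
    (measure_inter_conull' (measure_mono_null (by intro x hx; exact hx.2) hMD)).symm
  have e2 : μH[(d:ℝ)] (S ∩ DeltaE p (d+1)) = μH[(d:ℝ)] (S ∩ D) := by
    have : S ∩ D = (S ∩ DeltaE p (d+1)) ∩ Ort (d+1) := by rw [hD, inter_assoc]
    rw [this]
    refine (measure_inter_conull' (measure_mono_null ?_ (boundary_null hp hd))).symm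
    exact fun x hx => ⟨hx.1.2, hx.2⟩
  rw [Measure.smul_apply, Measure.restrict_apply hS, e1, e2, smul_eq_mul, glob _ (hS.inter hDm) inter_subset_right]

theorem toReal_lint {α : Type*} [MeasurableSpace α] (ν : Measure α) (f : α → ℝ) (hf : Measurable f)
    (h0 : ∀ᵐ x ∂ν, 0 ≤ f x) : ∫ x, f x ∂ν = (∫⁻ x, ENNReal.ofReal (f x) ∂ν).toReal :=
  integral_eq_lintegral_of_nonneg_ae h0 hf.aestronglyMeasurable

/-- sup norm on Euclidean space -/
def sup {n : ℕ} (x : EuclideanSpace ℝ (Fin n)) : ℝ := ‖x.ofLp‖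

theorem measurable_sup (n : ℕ) : Measurable (sup : EuclideanSpace ℝ (Fin n) → ℝ) := by
  unfold sup; fun_prop

theorem den_smul {p : ℝ} {n : ℕ} {x : EuclideanSpace ℝ (Fin n)} (hx : x ∈ Ort n) {s : ℝ} (hs : 0 < s) :
    den p (s • x) = s ^ (p - 1) * den p x := by
  unfold den
  have : ∀ i, (s • x) i ^ (2*p-2) = s ^ (2*p-2) * x i ^ (2*p-2) := fun i => by
    simp [mul_rpow hs.le (hx i).le]
  simp_rw [this, ← Finset.mul_sum]
  rw [mul_rpow (by positivity) (Finset.sum_nonneg fun i _ => rpow_nonneg (hx i).le _),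
    ← rpow_mul hs.le]
  congr 2; ring

theorem ae_nonneg_iid (p : ℝ) (n : ℕ) : ∀ᵐ ω ∂(iidExp p n), ∀ i, 0 ≤ ω i := by
  rw [ae_all_iff]
  intro i
  have : ∀ᵐ t ∂(expMeasure p), 0 ≤ t := by
    have h : ∀ᵐ t ∂(volume.restrict (Ioi (0:ℝ))), 0 ≤ t := by
      filter_upwards [ae_restrict_mem measurableSet_Ioi] with t ht using le_of_lt ht
    exact (withDensity_absolutelyContinuous _ _).ae_le h
  exact (Measure.quasiMeasurePreserving_eval (μ := fun _ : Fin n => expMeasure p) i).ae this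

theorem den_nonneg {p : ℝ} {n : ℕ} {x : EuclideanSpace ℝ (Fin n)} (hx : ∀ i, 0 ≤ x i) : 0 ≤ den p x :=
  rpow_nonneg (Finset.sum_nonneg fun i _ => rpow_nonneg (hx i) _) _

theorem main (p : ℝ) (hp : 0 < p) (n : ℕ) (hn : 2 ≤ n)
    (μ ρ : Measure (EuclideanSpace ℝ (Fin n))) (hμ : IsConeMeasureE p n μ) (hρ : IsSurfaceMeasureE p n ρ) :
    ∃ W D : ℝ, 0 ≤ W ∧ 0 ≤ D ∧ ∃ v a : ℝ, v ≠ 0 ∧ a ≠ 0 ∧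
      ∫ x, kthMax (fun i => x i) 1 ∂ρ = W / D ∧
      (∫ x, kthMax (fun i => x i) 1 * (∑ i, x i ^ (2 * p - 2)) ^ ((1 : ℝ) / 2) ∂μ) = v * W ∧
      (∫ x, (∑ i, x i ^ (2 * p - 2)) ^ ((1 : ℝ) / 2) ∂μ) = v * D ∧
      (∫ ω, kthMax ω 1 * (∑ i, ω i ^ (2 * p - 2)) ^ ((1 : ℝ) / 2) ∂(iidExp p n)) =
        a * (Gamma (n / p + 1) * W) ∧
      (∫ ω, (∑ i, ω i ^ (2 * p - 2)) ^ ((1 : ℝ) / 2) ∂(iidExp p n)) =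
        a * (Gamma ((n - 1) / p + 1) * D) := by
  have hn0 : 0 < n := by omega
  set fW : EuclideanSpace ℝ (Fin n) → ℝ := fun x => sup x * den p x with hfW
  have hfWm : Measurable fW := (measurable_sup n).mul (measurable_den p n)
  have hsup : ∀ x : EuclideanSpace ℝ (Fin n), 0 ≤ sup x := fun x => norm_nonneg _
  set LW := ∫⁻ x, ENNReal.ofReal (fW x) ∂(mco p n) with hLW
  set LD := ∫⁻ x, ENNReal.ofReal (den p x) ∂(mco p n) with hLD
  obtain ⟨v, hv0, hvt, hv⟩ := cone_measure_eq hp hn0 hμ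
  have aem : ∀ᵐ x ∂(mco p n), ∀ i, 0 ≤ x i := by
    have h : ∀ᵐ x ∂(mco p n), x ∈ DeltaE p n ∩ Ort n := mco_compl hp hn0
    filter_upwards [h] with x hx using hx.1.1
  have aeμ : ∀ᵐ x ∂μ, ∀ i, 0 ≤ x i := by
    rw [hv]; exact Measure.ae_smul_measure aem v
  have hG1 : 0 < Gamma ((n:ℝ)/p+1) := Gamma_pos_of_pos (by positivity)
  set a : ℝ := (p / Gamma (1/p)) ^ n * (n * (1/p)) with ha
  have ha0 : 0 < a := by
    have : 0 < Gamma (1/p) := Gamma_pos_of_pos (by positivity)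
    positivity
  have hn2 : (2:ℝ) ≤ n := by exact_mod_cast hn
  refine ⟨LW.toReal, LD.toReal, ENNReal.toReal_nonneg, ENNReal.toReal_nonneg, v.toReal, a,
    ENNReal.toReal_ne_zero.2 ⟨hv0, hvt⟩, ha0.ne', ?_, ?_, ?_, ?_, ?_⟩
  · -- surface measure
    simp_rw [kthMax_eq_norm hn0]
    change ∫ x, sup x ∂ρ = _
    rw [toReal_lint _ _ (measurable_sup n) (Filter.Eventually.of_forall hsup)]
    obtain ⟨d, rfl⟩ : ∃ d, n = d + 1 := ⟨n - 1, by omega⟩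
    obtain ⟨k, hk0, hkt, hk⟩ := surface_eq hp (d := d) (by omega)
    have hdc : ((d + 1 : ℕ) : ℝ) - 1 = d := by push_cast; ring
    unfold IsSurfaceMeasureE at hρ
    rw [hdc] at hρ
    have e1 : k * μH[(d:ℝ)] (DeltaE p (d+1)) = LD := by
      have := congrArg (fun ν => ν univ) hk
      simpa [withDensity_apply] using this
    have e2 : k * ∫⁻ x, ENNReal.ofReal (sup x) ∂((μH[(d:ℝ)]).restrict (DeltaE p (d+1))) = LW := by
      have := congrArg (fun ν => ∫⁻ x, ENNReal.ofReal (sup x) ∂ν) hk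
      simp only at this
      rw [lintegral_smul_measure, smul_eq_mul] at this
      rw [this, lintegral_withDensity_eq_lintegral_mul _ (measurable_den p _).ennreal_ofReal
        (measurable_sup _).ennreal_ofReal, hLW]
      refine lintegral_congr fun x => ?_
      simp only [Pi.mul_apply, hfW]
      rw [ENNReal.ofReal_mul (hsup x), mul_comm]
    have hk' : k.toReal ≠ 0 := ENNReal.toReal_ne_zero.2 ⟨hk0, hkt⟩
    rw [hρ, lintegral_smul_measure, ← e1, ← e2]
    simp only [ENNReal.toReal_mul, smul_eq_mul, ENNReal.toReal_inv]
    rw [mul_div_mul_left _ _ hk', div_eq_inv_mul]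
  · simp_rw [kthMax_eq_norm hn0]
    change ∫ x, fW x ∂μ = _
    rw [toReal_lint _ _ hfWm (by filter_upwards [aeμ] with x hx using mul_nonneg (hsup x) (den_nonneg hx)),
      hv, lintegral_smul_measure, smul_eq_mul, ENNReal.toReal_mul]
  · change ∫ x, den p x ∂μ = _
    rw [toReal_lint _ _ (measurable_den p n) (by filter_upwards [aeμ] with x hx using (den_nonneg hx)),
      hv, lintegral_smul_measure, smul_eq_mul, ENNReal.toReal_mul]
  · simp_rw [kthMax_eq_norm hn0]
    change ∫ ω, fW (WithLp.toLp 2 ω) ∂(iidExp p n) = _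
    rw [toReal_lint _ (fun ω : Fin n → ℝ => fW (WithLp.toLp 2 ω)) (hfWm.comp (by fun_prop))
      (by filter_upwards [ae_nonneg_iid p n] with x hx using mul_nonneg (hsup _) (den_nonneg hx)),
      lintegral_iid hp hn0 p (by linarith) (fun x => ENNReal.ofReal (fW x)) hfWm.ennreal_ofReal]
    · rw [← hLW]
      have hg : ((n:ℝ) + p)/p = n/p + 1 := by field_simp
      have hc0 : 0 < p / Gamma (1/p) := div_pos hp (Gamma_pos_of_pos (by positivity))
      rw [ENNReal.toReal_mul, ENNReal.toReal_mul, ENNReal.toReal_pow, hg,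
        ENNReal.toReal_ofReal hc0.le, ENNReal.toReal_ofReal (by positivity), ha]
      ring
    · intro s hs x hx
      have e : s ^ p = s * s ^ (p-1) := by
        rw [← rpow_one_add' hs.le (by simpa using hp.ne')]; congr 1; ring
      have e2 : sup (s • x) = s * sup x := by
        simp [sup, norm_smul, abs_of_pos hs]
      rw [← ENNReal.ofReal_mul (by positivity)]
      congr 1
      simp only [hfW]
      rw [den_smul hx hs, e2, e]; ring
  · change ∫ ω, den p (WithLp.toLp 2 ω) ∂(iidExp p n) = _
    rw [toReal_lint _ (fun ω : Fin n → ℝ => den p (WithLp.toLp 2 ω)) ((measurable_den p n).comp (by fun_prop))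
      (by filter_upwards [ae_nonneg_iid p n] with x hx using (den_nonneg hx)),
      lintegral_iid hp hn0 (p-1) (by linarith) (fun x => ENNReal.ofReal (den p x))
        (measurable_den p n).ennreal_ofReal]
    · rw [← hLD]
      have hg : ((n:ℝ) + (p - 1))/p = (n-1)/p + 1 := by field_simp; ring
      have hc0 : 0 < p / Gamma (1/p) := div_pos hp (Gamma_pos_of_pos (by positivity))
      have : 0 < Gamma (((n:ℝ)-1)/p+1) := Gamma_pos_of_pos (by
        have : 0 ≤ ((n:ℝ)-1)/p := div_nonneg (by linarith) hp.le
        linarith)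
      rw [ENNReal.toReal_mul, ENNReal.toReal_mul, ENNReal.toReal_pow, hg,
        ENNReal.toReal_ofReal hc0.le, ENNReal.toReal_ofReal (by positivity), ha]
      ring
    · intro s hs x hx
      rw [← ENNReal.ofReal_mul (by positivity), den_smul hx hs]
end SZW

/-- For `0 < p < ∞` there are `C_p^1, C_p^2 > 0` depending only on `p` such that for all
`n ≥ 2`: `σ_0^{p,∞}(ρ_p) = ∫_{Δ_p^n} x_1^* dρ_p` equals the ratio
`(∫_{Δ_p^n} x_1^* (∑_i x_i^{2p-2})^{1/2} dμ_p) / (∫_{Δ_p^n} (∑_i x_i^{2p-2})^{1/2} dμ_p)`,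
and `C_p^1 R n^{-1/p} ≤ σ_0^{p,∞}(ρ_p) ≤ C_p^2 R n^{-1/p}`, where
`R = E[ω_1^* (∑_i ω_i^{2p-2})^{1/2}] / E[(∑_i ω_i^{2p-2})^{1/2}]`. -/
theorem surface_measure_zero_width_formula (p : ℝ) (hp : 0 < p) :
    ∃ C₁ C₂ : ℝ, 0 < C₁ ∧ 0 < C₂ ∧
      ∀ n : ℕ, 2 ≤ n →
        ∀ μ ρ : Measure (EuclideanSpace ℝ (Fin n)),
          IsConeMeasureE p n μ → IsSurfaceMeasureE p n ρ →
          (∫ x, kthMax (fun i => x i) 1 ∂ρ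
              = (∫ x, kthMax (fun i => x i) 1 * (∑ i, x i ^ (2 * p - 2)) ^ ((1 : ℝ) / 2) ∂μ)
                / ∫ x, (∑ i, x i ^ (2 * p - 2)) ^ ((1 : ℝ) / 2) ∂μ) ∧
          C₁ * ((∫ ω, kthMax ω 1 * (∑ i, ω i ^ (2 * p - 2)) ^ ((1 : ℝ) / 2) ∂(iidExp p n))
                  / ∫ ω, (∑ i, ω i ^ (2 * p - 2)) ^ ((1 : ℝ) / 2) ∂(iidExp p n))
              * (n : ℝ) ^ (-(1 / p))
            ≤ ∫ x, kthMax (fun i => x i) 1 ∂ρ ∧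
          ∫ x, kthMax (fun i => x i) 1 ∂ρ
            ≤ C₂ * ((∫ ω, kthMax ω 1 * (∑ i, ω i ^ (2 * p - 2)) ^ ((1 : ℝ) / 2) ∂(iidExp p n))
                  / ∫ ω, (∑ i, ω i ^ (2 * p - 2)) ^ ((1 : ℝ) / 2) ∂(iidExp p n))
              * (n : ℝ) ^ (-(1 / p)) := by
  refine ⟨(1/p+1)^(-(1/p)), ((1/p)/2)^(-(1/p)), by positivity, by positivity,
    fun n hn μ ρ hμ hρ => ?_⟩
  obtain ⟨W, D, hW, hD, v, a, hv, ha, h1, h2, h3, h4, h5⟩ := SZW.main p hp n hn μ ρ hμ hρ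
  obtain ⟨g1, g2⟩ := SZW.gamma_bounds p hp n hn
  have hn2 : (2:ℝ) ≤ n := by exact_mod_cast hn
  have hG1 : 0 < Gamma ((n:ℝ)/p+1) := Gamma_pos_of_pos (by positivity)
  have hG0 : 0 < Gamma (((n:ℝ)-1)/p+1) := Gamma_pos_of_pos (by
    have : 0 ≤ ((n:ℝ)-1)/p := div_nonneg (by linarith) hp.le
    linarith)
  rw [h1, h2, h3, h4, h5, mul_div_mul_left _ _ hv, mul_div_mul_left _ _ ha, mul_div_mul_comm]
  set G1 := Gamma ((n:ℝ)/p+1)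
  set G0 := Gamma (((n:ℝ)-1)/p+1)
  have hR : 0 ≤ G1 / G0 * (W / D) := by positivity
  have e : W / D = (G1 / G0 * (W / D)) * (G0 / G1) := by
    generalize W / D = q
    field_simp
  have k1 := mul_le_mul_of_nonneg_left g1 hR
  have k2 := mul_le_mul_of_nonneg_left g2 hR
  rw [← e] at k1 k2
  refine ⟨rfl, ?_, ?_⟩
  · refine le_trans (le_of_eq ?_) k1
    ring
  · refine le_trans k2 (le_of_eq ?_)
    ring

end
end
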